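/- arXiv:2501.18234 — 6 statements merged into one kernel-verified Lean document; each statement's English description precedes it below -/
import Mathlib

section
/- Uniqueness of radial solutions for β>0 (Theorem 1.15). Let β>0, n ≥ 0 (real) and δ>0. Let V : ℝ² → ℝ be nonnegative, radially symmetric and radially decreasing (V(x) ≤ V(y) whenever ‖x‖ ≥ ‖y‖), continuous on ℝ² and continuously differentiable on ℝ²∖{0}, with radial profile v (V(x) = v(‖x‖)) such that: r ↦ r·v'(r) extends continuously to [0,∞); sup_{r ≥ 0} r^{n+2+δ}·v(r) < ∞; and for every constant c with 0 < c < n+2 there exists r_c > 0 such that c·v(r) + r·v'(r) ≥ 0 for all 0 < r ≤ r_c and c·v(r) + r·v'(r) ≤ 0 for all r ≥ r_c. Then there exists at most one radially symmetric, twice continuously differentiable ψ : ℝ² → ℝ satisfying -Δψ(x) = 4πβ·‖x‖ⁿ·V(x)·e^{ψ(x)} for every x ∈ ℝ² and ∫_{ℝ²} ‖x‖ⁿ·V(x)·e^{ψ(x)} dx = 1. -/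
open MeasureTheory Real Filter Bornology Metric
open scoped NNReal

noncomputable section

abbrev R2 : Type := EuclideanSpace ℝ (Fin 2)

/-- The Laplacian of `f : ℝ² → ℝ`, via the second iterated Fréchet derivative. -/
def lap (f : R2 → ℝ) (x : R2) : ℝ :=
  ∑ i : Fin 2, iteratedFDeriv ℝ 2 f x ![EuclideanSpace.single i 1, EuclideanSpace.single i 1]

/-- `ψ` is a weak (distributional) solution of `-Δψ = g` on `ℝ²`:
for every smooth compactly supported test function `φ`, `∫ ψ·Δφ = -∫ g·φ`. -/
def IsWeakSol (ψ g : R2 → ℝ) : Prop :=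
  ∀ φ : R2 → ℝ, ContDiff ℝ (⊤ : ℕ∞) φ → HasCompactSupport φ →
    ∫ x : R2, ψ x * lap φ x = -∫ x : R2, g x * φ x

/-- `f` is radially symmetric. -/
def RadSym (f : R2 → ℝ) : Prop := ∀ x y : R2, ‖x‖ = ‖y‖ → f x = f y

open Set Topology

/-- A radial profile with derivative `q` solving the ODE of `-Δψ = L ‖x‖ ^ n V e ^ ψ`. -/
structure RadialSolution (L n : ℝ) (v u q : ℝ → ℝ) : Prop where
  hasDerivAt : ∀ r, HasDerivAt u (q r) r
  continuous : Continuous q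
  zero : q 0 = 0
  hasDerivAt_deriv : ∀ r, 0 < r →
    HasDerivAt q (-(q r) / r - L * r ^ n * v r * exp (u r)) r

/-- The conditions on the profile of the potential used in the uniqueness proof. -/
structure RadialWeight (n δ : ℝ) (v : ℝ → ℝ) : Prop where
  continuousOn : ContinuousOn v (Ici 0)
  differentiableAt : ∀ r, 0 < r → DifferentiableAt ℝ v r
  nonneg : ∀ r, 0 ≤ r → 0 ≤ v r
  antitoneOn : AntitoneOn v (Ici 0)
  zero_pos : 0 < v 0
  decay : ∃ M : ℝ, ∀ r : ℝ, 0 ≤ r → r ^ (n + 2 + δ) * v r ≤ M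
  crossing : ∀ c : ℝ, 0 < c → c < n + 2 → ∃ rc : ℝ, 0 < rc ∧
      (∀ r : ℝ, 0 < r → r ≤ rc → 0 ≤ c * v r + r * deriv v r) ∧
      (∀ r : ℝ, rc ≤ r → c * v r + r * deriv v r ≤ 0)

theorem le_of_hasDerivAt_nonneg {f f' : ℝ → ℝ} {a b : ℝ} (hab : a ≤ b)
    (hf : ContinuousOn f (Icc a b)) (hd : ∀ x ∈ Ioo a b, HasDerivAt f (f' x) x)
    (h0 : ∀ x ∈ Ioo a b, 0 ≤ f' x) : f a ≤ f b := by
  refine monotoneOn_of_deriv_nonneg (convex_Icc a b) hf ?_ ?_ (left_mem_Icc.2 hab)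
    (right_mem_Icc.2 hab) hab
  · rw [interior_Icc]
    exact fun x hx => (hd x hx).differentiableAt.differentiableWithinAt
  · rw [interior_Icc]
    intro x hx
    rw [(hd x hx).deriv]
    exact h0 x hx

theorem hasDerivAt_eq_zero_of_le {f f' : ℝ → ℝ} {a b : ℝ}
    (hf : ContinuousOn f (Icc a b)) (hd : ∀ x ∈ Ioo a b, HasDerivAt f (f' x) x)
    (h0 : ∀ x ∈ Ioo a b, 0 ≤ f' x) (hba : f b ≤ f a) : ∀ x ∈ Ioo a b, f' x = 0 := by
  have key : ∀ y ∈ Ioo a b, f y = f a := by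
    intro y hy
    have h1 : f a ≤ f y := le_of_hasDerivAt_nonneg hy.1.le
      (hf.mono (Icc_subset_Icc_right hy.2.le)) (fun x hx => hd x ⟨hx.1, hx.2.trans hy.2⟩)
      (fun x hx => h0 x ⟨hx.1, hx.2.trans hy.2⟩)
    have h2 : f y ≤ f b := le_of_hasDerivAt_nonneg hy.2.le
      (hf.mono (Icc_subset_Icc_left hy.1.le)) (fun x hx => hd x ⟨hy.1.trans hx.1, hx.2⟩)
      (fun x hx => h0 x ⟨hy.1.trans hx.1, hx.2⟩)
    linarith
  intro x hx
  have h : f =ᶠ[𝓝 x] fun _ => f a := by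
    filter_upwards [Ioo_mem_nhds hx.1 hx.2] with y hy using key y hy
  exact (hd x hx).unique ((hasDerivAt_const x (f a)).congr_of_eventuallyEq h)

theorem abs_exp_sub_exp_le {a b A : ℝ} (ha : a ≤ A) (hb : b ≤ A) :
    |exp a - exp b| ≤ exp A * |a - b| := by
  wlog h : b ≤ a generalizing a b
  · rw [abs_sub_comm, abs_sub_comm a b]
    exact this hb ha (le_of_not_ge h)
  rw [abs_of_nonneg (sub_nonneg.2 (exp_le_exp.2 h)), abs_of_nonneg (sub_nonneg.2 h)]
  have h1 : exp b = exp a * exp (b - a) := by rw [← exp_add]; congr 1; ring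
  have h2 := add_one_le_exp (b - a)
  have h3 : exp a ≤ exp A := exp_le_exp.2 ha
  have h4 : exp a - exp b ≤ exp a * (a - b) := by
    rw [h1]; nlinarith [exp_pos a]
  exact h4.trans (mul_le_mul_of_nonneg_right h3 (sub_nonneg.2 h))

namespace RadialWeight

variable {n δ : ℝ} {v : ℝ → ℝ}

theorem deriv_nonpos (hv : RadialWeight n δ v) {r : ℝ} (hr : 0 < r) : deriv v r ≤ 0 := by
  have h := (hv.antitoneOn.mono Ioi_subset_Ici_self).derivWithin_nonpos (x := r)
  rwa [derivWithin_of_isOpen isOpen_Ioi hr] at h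

theorem eq_zero_of_le (hv : RadialWeight n δ v) {a r : ℝ} (ha : 0 ≤ a) (h : v a = 0)
    (hr : a ≤ r) : v r = 0 :=
  le_antisymm (h ▸ hv.antitoneOn ha (ha.trans hr) hr) (hv.nonneg r (ha.trans hr))

theorem rpow_mul_eq (hv : RadialWeight n δ v) {c a b : ℝ} (ha : 0 < a) (hab : a ≤ b)
    (h : ∀ r ∈ Ioo a b, c * v r + r * deriv v r = 0) : a ^ c * v a = b ^ c * v b := by
  have hd : ∀ r, 0 < r → HasDerivAt (fun r => r ^ c * v r)
      (r ^ (c - 1) * (c * v r + r * deriv v r)) r := by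
    intro r hr
    have h1 := (hasDerivAt_rpow_const (p := c) (Or.inl hr.ne')).mul
      (hv.differentiableAt r hr).hasDerivAt
    refine h1.congr_deriv ?_
    rw [rpow_sub_one hr.ne']
    field_simp
  have hc : ContinuousOn (fun r => r ^ c * v r) (Icc a b) :=
    fun r hr => (hd r (ha.trans_le hr.1)).continuousAt.continuousWithinAt
  have h0 : ∀ r ∈ Ioo a b, r ^ (c - 1) * (c * v r + r * deriv v r) = 0 :=
    fun r hr => by rw [h r hr, mul_zero]
  apply le_antisymm
  · exact le_of_hasDerivAt_nonneg hab hc (fun r hr => hd r (ha.trans hr.1))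
      fun r hr => (h0 r hr).ge
  · have := le_of_hasDerivAt_nonneg (f := fun r => -(r ^ c * v r)) hab hc.neg
      (fun r hr => (hd r (ha.trans hr.1)).neg) fun r hr => by
        rw [h0 r hr, neg_zero]
    linarith

end RadialWeight

namespace RadialSolution

variable {L n δ : ℝ} {v u q : ℝ → ℝ}

theorem continuous_sol (h : RadialSolution L n v u q) : Continuous u :=
  continuous_iff_continuousAt.2 fun r => (h.hasDerivAt r).continuousAt

theorem hasDerivAt_mass (h : RadialSolution L n v u q) {r : ℝ} (hr : 0 < r) :
    HasDerivAt (fun r => -(r * q r)) (L * r ^ (n + 1) * v r * exp (u r)) r := by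
  refine ((hasDerivAt_id' r).mul (h.hasDerivAt_deriv r hr)).neg.congr_deriv ?_
  rw [rpow_add_one hr.ne']
  field_simp
  ring

theorem mass_nonneg (h : RadialSolution L n v u q) (hL : 0 ≤ L) (hv : RadialWeight n δ v)
    {r : ℝ} (hr : 0 ≤ r) : 0 ≤ -(r * q r) := by
  have := le_of_hasDerivAt_nonneg (f := fun r => -(r * q r)) hr
    ((continuous_id.mul h.continuous).neg.continuousOn)
    (fun x hx => h.hasDerivAt_mass hx.1) fun x hx => by
      have := hv.nonneg x hx.1.le
      have := rpow_nonneg hx.1.le (n + 1)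
      positivity
  simpa using this

theorem le_zero (h : RadialSolution L n v u q) (hL : 0 ≤ L) (hv : RadialWeight n δ v)
    {r : ℝ} (hr : 0 ≤ r) : u r ≤ u 0 := by
  have := le_of_hasDerivAt_nonneg (f := fun r => -u r) hr h.continuous_sol.neg.continuousOn
    (fun x _ => (h.hasDerivAt x).neg) fun x hx => by
      have := h.mass_nonneg hL hv hx.1.le
      have h2 := hx.1
      by_contra! hneg
      nlinarith
  linarith

theorem hasDerivAt_pohozaev (h : RadialSolution L n v u q) (hv : RadialWeight n δ v) (c : ℝ)
    {r : ℝ} (hr : 0 < r) :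
    HasDerivAt (fun r => L * r ^ (n + 2) * v r * exp (u r) + (-(r * q r)) ^ 2 / 2
      - c * (-(r * q r)))
      (L * r ^ (n + 1) * exp (u r) * ((n + 2 - c) * v r + r * deriv v r)) r := by
  have h1 := (((hasDerivAt_rpow_const (p := n + 2) (Or.inl hr.ne')).const_mul L).mul
      (hv.differentiableAt r hr).hasDerivAt).mul (h.hasDerivAt r).exp
  have h2 := h.hasDerivAt_mass hr
  refine ((h1.add ((h2.pow 2).div_const 2)).sub (h2.const_mul c)).congr_deriv ?_
  have e1 : r ^ (n + 2 - 1) = r ^ (n + 1) := by congr 1; ring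
  have e2 : r ^ (n + 2) = r ^ (n + 1) * r := by rw [← rpow_add_one hr.ne']; congr 1; ring
  simp only [Pi.mul_apply]
  rw [e1, e2]
  push_cast
  ring

theorem continuousOn_pohozaev (h : RadialSolution L n v u q) (hv : RadialWeight n δ v)
    (hn : 0 ≤ n) (c : ℝ) :
    ContinuousOn (fun r => L * r ^ (n + 2) * v r * exp (u r) + (-(r * q r)) ^ 2 / 2
      - c * (-(r * q r))) (Ici 0) := by
  have h1 : Continuous fun r : ℝ => r ^ (n + 2) := continuous_rpow_const (by linarith)
  have h2 := h.continuous
  have h3 := h.continuous_sol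
  have h4 := hv.continuousOn
  fun_prop

theorem tendsto_density (h : RadialSolution L n v u q) (hv : RadialWeight n δ v)
    (hL : 0 ≤ L) (hδ : 0 < δ) :
    Tendsto (fun r => L * r ^ (n + 2) * v r * exp (u r)) atTop (𝓝 0) := by
  obtain ⟨M, hM⟩ := hv.decay
  have hlim : Tendsto (fun r : ℝ => L * M * exp (u 0) * r ^ (-δ)) atTop (𝓝 0) := by
    simpa using (tendsto_rpow_neg_atTop hδ).const_mul (L * M * exp (u 0))
  refine squeeze_zero' ?_ ?_ hlim
  · filter_upwards [eventually_gt_atTop 0] with r hr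
    have := hv.nonneg r hr.le
    positivity
  · filter_upwards [eventually_gt_atTop 0] with r hr
    have h1 : r ^ (n + 2) = r ^ (n + 2 + δ) * r ^ (-δ) := by
      rw [← rpow_add hr]; congr 1; ring
    have h2 : exp (u r) ≤ exp (u 0) := exp_le_exp.2 (h.le_zero hL hv hr.le)
    have h3 := hM r hr.le
    have h4 := hv.nonneg r hr.le
    have h5 : 0 ≤ r ^ (-δ) := rpow_nonneg hr.le _
    have h6 : 0 ≤ r ^ (n + 2 + δ) := rpow_nonneg hr.le _
    have h7 : 0 ≤ M := (mul_nonneg h6 h4).trans h3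
    calc L * r ^ (n + 2) * v r * exp (u r)
        = L * r ^ (-δ) * ((r ^ (n + 2 + δ) * v r) * exp (u r)) := by rw [h1]; ring
      _ ≤ L * r ^ (-δ) * (M * exp (u 0)) := by gcongr
      _ = _ := by ring

theorem tendsto_mass (h : RadialSolution L n v u q)
    (hint : IntegrableOn (fun r => r ^ (n + 1) * v r * exp (u r)) (Ioi 0)) :
    Tendsto (fun r => -(r * q r)) atTop
      (𝓝 (L * ∫ r in Ioi 0, r ^ (n + 1) * v r * exp (u r))) := by
  have h1 := (intervalIntegral_tendsto_integral_Ioi 0 hint tendsto_id).const_mul L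
  refine h1.congr' ?_
  filter_upwards [eventually_gt_atTop 0] with R hR
  rw [← intervalIntegral.integral_const_mul]
  have := intervalIntegral.integral_eq_sub_of_hasDerivAt_of_le hR.le
    (f := fun r => -(r * q r)) (f' := fun r => L * (r ^ (n + 1) * v r * exp (u r)))
    ((continuous_id.mul h.continuous).neg.continuousOn)
    (fun x hx => (h.hasDerivAt_mass hx.1).congr_deriv (by ring))
    (((intervalIntegrable_iff_integrableOn_Ioc_of_le hR.le).2
      (hint.mono_set Ioc_subset_Ioi_self)).const_mul L)
  simpa using this

theorem eqOn_of_zero_eq {u₁ q₁ u₂ q₂ : ℝ → ℝ} (h₁ : RadialSolution L n v u₁ q₁)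
    (h₂ : RadialSolution L n v u₂ q₂) (hv : RadialWeight n δ v) (hL : 0 ≤ L) (hn : 0 ≤ n)
    (h0 : u₁ 0 = u₂ 0) {R : ℝ} (hR : 0 ≤ R) : u₁ R = u₂ R := by
  set C : ℝ := L * R ^ n * v 0 * exp (u₁ 0) with hC
  set E : ℝ → ℝ := fun r => ((u₁ r - u₂ r) ^ 2 + (q₁ r - q₂ r) ^ 2) * exp (-(1 + C) * r)
  have hcu₁ := h₁.continuous_sol
  have hcu₂ := h₂.continuous_sol
  have hcq₁ := h₁.continuous
  have hcq₂ := h₂.continuous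
  have hE : ∀ r, 0 < r → HasDerivAt (fun r => -E r)
      ((((1 + C) * ((u₁ r - u₂ r) ^ 2 + (q₁ r - q₂ r) ^ 2)
        - 2 * (u₁ r - u₂ r) * (q₁ r - q₂ r) + 2 * (q₁ r - q₂ r) ^ 2 / r
        + 2 * (q₁ r - q₂ r) * (L * r ^ n * v r) * (exp (u₁ r) - exp (u₂ r))))
        * exp (-(1 + C) * r)) r := by
    intro r hr
    have a := ((h₁.hasDerivAt r).sub (h₂.hasDerivAt r)).pow 2
    have b := ((h₁.hasDerivAt_deriv r hr).sub (h₂.hasDerivAt_deriv r hr)).pow 2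
    have e := ((hasDerivAt_id' r).const_mul (-(1 + C))).exp
    refine ((a.add b).mul e).neg.congr_deriv ?_
    simp only [Pi.add_apply, Pi.pow_apply, Pi.sub_apply]
    push_cast
    field_simp
    ring
  have hle := le_of_hasDerivAt_nonneg (f := fun r => -E r) hR (by fun_prop)
    (fun r hr => hE r hr.1) (by
      intro r hr
      refine mul_nonneg ?_ (exp_pos _).le
      have hr0 := hr.1
      have k1 := abs_exp_sub_exp_le (h₁.le_zero hL hv hr0.le)
        (h0 ▸ h₂.le_zero hL hv hr0.le)
      have k2 : r ^ n ≤ R ^ n := rpow_le_rpow hr0.le hr.2.le hn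
      have k3 : v r ≤ v 0 := hv.antitoneOn self_mem_Ici hr0.le hr0.le
      have k4 := hv.nonneg r hr0.le
      have := hv.zero_pos
      have k5 : |L * r ^ n * v r * (exp (u₁ r) - exp (u₂ r))| ≤ C * |u₁ r - u₂ r| := by
        rw [abs_mul, abs_of_nonneg (by positivity)]
        calc _ ≤ L * R ^ n * v 0 * (exp (u₁ 0) * |u₁ r - u₂ r|) := by gcongr
          _ = _ := by rw [hC]; ring
      have k6 : 0 ≤ 2 * (q₁ r - q₂ r) ^ 2 / r := by positivity
      have hC0 : 0 ≤ C := by positivity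
      set d := u₁ r - u₂ r
      set e := q₁ r - q₂ r
      set w := L * r ^ n * v r * (exp (u₁ r) - exp (u₂ r)) with hw
      have k7 : |e * w| ≤ |e| * (C * |d|) := by rw [abs_mul]; gcongr
      have k8 := neg_abs_le (e * w)
      have k9 : 2 * (|e| * |d|) ≤ d ^ 2 + e ^ 2 := by
        nlinarith [sq_nonneg (|e| - |d|), sq_abs e, sq_abs d]
      have k10 : 2 * e * (L * r ^ n * v r) * (exp (u₁ r) - exp (u₂ r)) = 2 * (e * w) := by
        rw [hw]; ring
      rw [k10]
      nlinarith [sq_nonneg (d - e), mul_le_mul_of_nonneg_left k9 hC0])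
  have hE0 : E 0 = 0 := by simp [E, h0, h₁.zero, h₂.zero]
  have hER : E R ≤ 0 := by simpa [hE0] using hle
  by_contra hne
  have : 0 < (u₁ R - u₂ R) ^ 2 := by
    have := sub_ne_zero.2 hne
    positivity
  have : 0 < E R := by positivity
  linarith


theorem not_lt_of_tendsto {u₁ q₁ u₂ q₂ : ℝ → ℝ} {ℓ : ℝ} (h₁ : RadialSolution L n v u₁ q₁)
    (h₂ : RadialSolution L n v u₂ q₂) (hv : RadialWeight n δ v) (hL : 0 < L) (hn : 0 ≤ n)
    (hδ : 0 < δ) (ht₁ : Tendsto (fun r => -(r * q₁ r)) atTop (𝓝 ℓ))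
    (ht₂ : Tendsto (fun r => -(r * q₂ r)) atTop (𝓝 ℓ)) : ¬ u₁ 0 < u₂ 0 := by
  intro h0
  have hcu₁ := h₁.continuous_sol
  have hcu₂ := h₂.continuous_sol
  have hcq₁ := h₁.continuous
  have hcq₂ := h₂.continuous
  set p : ℝ → ℝ := fun r => -(r * q₂ r) - -(r * q₁ r) with hp
  have hpc : Continuous p := by fun_prop
  have hp0 : p 0 = 0 := by simp [hp]
  have hplim : Tendsto p atTop (𝓝 0) := by simpa [hp] using ht₂.sub ht₁
  have hpd : ∀ r, 0 < r →
      HasDerivAt p (L * r ^ (n + 1) * v r * (exp (u₂ r) - exp (u₁ r))) r := fun r hr =>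
    ((h₂.hasDerivAt_mass hr).sub (h₁.hasDerivAt_mass hr)).congr_deriv (by ring)
  -- the mass difference is positive as long as the solutions are ordered
  have hppos : ∀ R, 0 < R → (∀ r ∈ Ico 0 R, u₁ r < u₂ r) → 0 < p R := by
    intro R hR hlt
    by_contra! hle
    have hz := hasDerivAt_eq_zero_of_le (f := p) (a := 0) (b := R) hpc.continuousOn
      (fun r hr => hpd r hr.1) (fun r hr => by
        have h3 := hv.nonneg r hr.1.le
        have h4 := exp_lt_exp.2 (hlt r ⟨hr.1.le, hr.2⟩)
        have h5 := hr.1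
        have : 0 ≤ exp (u₂ r) - exp (u₁ r) := by linarith
        positivity) (by rw [hp0]; exact hle)
    have hev : ∀ᶠ r in 𝓝[>] (0 : ℝ), 0 < v r :=
      ((hv.continuousOn 0 self_mem_Ici).mono Ioi_subset_Ici_self).eventually
        (lt_mem_nhds hv.zero_pos)
    obtain ⟨r, hvr, hr⟩ := (hev.and (Ioo_mem_nhdsGT hR)).exists
    have h4 := exp_lt_exp.2 (hlt r ⟨hr.1.le, hr.2⟩)
    have h5 : 0 < exp (u₂ r) - exp (u₁ r) := by linarith
    have h6 := hr.1
    have : 0 < L * r ^ (n + 1) * v r * (exp (u₂ r) - exp (u₁ r)) := by positivity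
    exact this.ne' (hz r hr)
  -- the solutions must cross
  obtain ⟨R, hR0, hR⟩ : ∃ R, 0 ≤ R ∧ u₂ R ≤ u₁ R := by
    by_contra! hlt
    have h1 : 0 < p 1 := hppos 1 one_pos fun r hr => hlt r hr.1
    have h2 : p 1 ≤ 0 := by
      refine ge_of_tendsto hplim ?_
      filter_upwards [eventually_ge_atTop 1] with r hr
      exact le_of_hasDerivAt_nonneg hr hpc.continuousOn
        (fun x hx => hpd x (one_pos.trans hx.1)) fun x hx => by
          have h3 : 0 < x := one_pos.trans hx.1
          have h4 := hv.nonneg x h3.le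
          have h5 := exp_lt_exp.2 (hlt x h3.le)
          have : 0 ≤ exp (u₂ x) - exp (u₁ x) := by linarith
          positivity
    linarith
  obtain ⟨r₀, ⟨⟨hr₀0, -⟩, hr₀le⟩, hmin⟩ :=
    (isCompact_Icc.inter_right (isClosed_le hcu₂ hcu₁) :
      IsCompact (Icc 0 R ∩ {r | u₂ r ≤ u₁ r})).exists_isLeast ⟨R, ⟨hR0, le_rfl⟩, hR⟩
  simp only [mem_ofPred_eq] at hr₀le
  have hlt : ∀ r ∈ Ico 0 r₀, u₁ r < u₂ r := by
    intro r hr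
    by_contra! hle
    rcases le_total r R with h | h
    · exact (hmin ⟨⟨hr.1, h⟩, hle⟩).not_gt hr.2
    · exact ((hmin ⟨⟨hR0, le_rfl⟩, hR⟩).trans h).not_gt hr.2
  have hr₀ : 0 < r₀ := by
    rcases hr₀0.lt_or_eq with h | h
    · exact h
    · rw [← h] at hr₀le; exact absurd h0 hr₀le.not_gt
  have hr₀eq : u₁ r₀ = u₂ r₀ := by
    refine le_antisymm ?_ hr₀le
    refine le_of_tendsto_of_tendsto (hcu₁.continuousAt.tendsto.mono_left nhdsWithin_le_nhds)
      (hcu₂.continuousAt.tendsto.mono_left nhdsWithin_le_nhds) (b := 𝓝[<] r₀) ?_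
    filter_upwards [Ioo_mem_nhdsLT hr₀] with r hr using (hlt r ⟨hr.1.le, hr.2⟩).le
  have hpr₀ : 0 < p r₀ := hppos r₀ hr₀ hlt
  -- the Pohozaev difference, normalised to vanish at `0` and at the crossing point
  set c : ℝ := (-(r₀ * q₁ r₀) + -(r₀ * q₂ r₀)) / 2 with hcdef
  set P : (ℝ → ℝ) → (ℝ → ℝ) → ℝ → ℝ := fun u q r =>
    L * r ^ (n + 2) * v r * exp (u r) + (-(r * q r)) ^ 2 / 2 - c * (-(r * q r)) with hP
  set D : ℝ → ℝ := fun r => P u₂ q₂ r - P u₁ q₁ r with hD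
  set B : ℝ → ℝ := fun r => (n + 2 - c) * v r + r * deriv v r with hB
  have hDc : ContinuousOn D (Ici 0) :=
    (h₂.continuousOn_pohozaev hv hn c).sub (h₁.continuousOn_pohozaev hv hn c)
  have hDd : ∀ r, 0 < r →
      HasDerivAt D (L * r ^ (n + 1) * (exp (u₂ r) - exp (u₁ r)) * B r) r := fun r hr =>
    ((h₂.hasDerivAt_pohozaev hv c hr).sub (h₁.hasDerivAt_pohozaev hv c hr)).congr_deriv
      (by simp only [hB]; ring)
  have hD0 : D 0 = 0 := by
    have : (0 : ℝ) ^ (n + 2) = 0 := zero_rpow (by linarith)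
    simp [hD, hP, this]
  have hDr₀ : D r₀ = 0 := by
    simp only [hD, hP, hr₀eq, hcdef]; ring
  have hcpos : 0 < c := by
    have h3 := h₁.mass_nonneg hL.le hv hr₀0
    have h4 : 0 < -(r₀ * q₂ r₀) - -(r₀ * q₁ r₀) := hpr₀
    rw [hcdef]; linarith
  have hBneg : ∀ r, r₀ ≤ r → B r ≤ 0 := by
    intro r hr
    rcases le_or_gt (n + 2 - c) 0 with hc | hc
    · have h3 := hv.nonneg r (hr₀0.trans hr)
      have h4 := hv.deriv_nonpos (hr₀.trans_le hr)
      have h5 : 0 < r := hr₀.trans_le hr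
      simp only [hB]
      nlinarith [mul_nonneg h5.le (neg_nonneg.2 h4), mul_nonneg h3 (neg_nonneg.2 hc)]
    · obtain ⟨rc, hrc, hpos, hneg⟩ := hv.crossing (n + 2 - c) hc (by linarith)
      rcases le_or_gt rc r₀ with h | h
      · exact hneg r (h.trans hr)
      · exfalso
        have hz := hasDerivAt_eq_zero_of_le (f := D) (a := 0) (b := r₀)
          (hDc.mono Icc_subset_Ici_self) (fun r hr => hDd r hr.1) (fun r hr => by
            have h3 := exp_lt_exp.2 (hlt r ⟨hr.1.le, hr.2⟩)
            have h4 : 0 ≤ exp (u₂ r) - exp (u₁ r) := by linarith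
            have h5 : 0 ≤ B r := hpos r hr.1 (hr.2.le.trans h.le)
            have h6 := hr.1
            positivity) (by rw [hD0, hDr₀])
        have hB0 : ∀ r ∈ Ioo 0 r₀, B r = 0 := fun r hr => by
          have h3 := exp_lt_exp.2 (hlt r ⟨hr.1.le, hr.2⟩)
          have h4 : 0 < exp (u₂ r) - exp (u₁ r) := by linarith
          have h6 := hr.1
          have h7 : L * r ^ (n + 1) * (exp (u₂ r) - exp (u₁ r)) ≠ 0 := by positivity
          exact (mul_eq_zero.1 (hz r hr)).resolve_left h7
        have hcst : ∀ r ∈ Ioo 0 r₀, r ^ (n + 2 - c) * v r = r₀ ^ (n + 2 - c) * v r₀ :=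
          fun r hr => hv.rpow_mul_eq hr.1 hr.2.le fun x hx => hB0 x ⟨hr.1.trans hx.1, hx.2⟩
        have hlim : Tendsto (fun r => r ^ (n + 2 - c) * v r) (𝓝[>] 0) (𝓝 0) := by
          have h3 : Tendsto (fun r : ℝ => r ^ (n + 2 - c)) (𝓝[>] 0) (𝓝 (0 ^ (n + 2 - c))) :=
            ((continuous_rpow_const hc.le).tendsto 0).mono_left nhdsWithin_le_nhds
          have h4 := h3.mul ((hv.continuousOn 0 self_mem_Ici).mono Ioi_subset_Ici_self)
          rwa [zero_rpow hc.ne', zero_mul] at h4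
        have hzero : r₀ ^ (n + 2 - c) * v r₀ = 0 := by
          refine tendsto_nhds_unique (tendsto_const_nhds.congr' ?_) hlim
          filter_upwards [Ioo_mem_nhdsGT hr₀] with r hr using (hcst r hr).symm
        have hev : ∀ᶠ r in 𝓝[>] (0 : ℝ), 0 < v r :=
          ((hv.continuousOn 0 self_mem_Ici).mono Ioi_subset_Ici_self).eventually
            (lt_mem_nhds hv.zero_pos)
        obtain ⟨r, hvr, hr⟩ := (hev.and (Ioo_mem_nhdsGT hr₀)).exists
        have h3 := hcst r hr
        have h4 := hr.1
        have h5 : 0 < r ^ (n + 2 - c) * v r := by positivity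
        rw [h3, hzero] at h5
        exact h5.false
  -- while the mass difference stays positive, the solutions stay in reversed order
  have hrev : ∀ b, r₀ < b → (∀ r ∈ Ico r₀ b, 0 < p r) → u₂ b < u₁ b := by
    intro b hb hpb
    have hd : ∀ r ∈ Ioo r₀ b, HasDerivAt (fun r => u₁ r - u₂ r) (q₁ r - q₂ r) r :=
      fun r _ => (h₁.hasDerivAt r).sub (h₂.hasDerivAt r)
    have hpos : ∀ r ∈ Ioo r₀ b, 0 < q₁ r - q₂ r := by
      intro r hr
      have h3 : 0 < -(r * q₂ r) - -(r * q₁ r) := hpb r ⟨hr.1.le, hr.2⟩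
      have h4 : 0 < r := hr₀.trans hr.1
      exact pos_of_mul_pos_right (by linarith : 0 < r * (q₁ r - q₂ r)) h4.le
    by_contra! hle
    obtain ⟨x, hx⟩ := nonempty_Ioo.2 hb
    have := hasDerivAt_eq_zero_of_le (by fun_prop) hd (fun r hr => (hpos r hr).le)
      (by simp only [hr₀eq]; linarith) x hx
    exact (hpos x hx).ne' this
  have hDmono : ∀ a b, r₀ ≤ a → a ≤ b → (∀ r ∈ Ico r₀ b, 0 < p r) → D a ≤ D b := by
    intro a b ha hab hpb
    refine le_of_hasDerivAt_nonneg hab (hDc.mono fun x hx => (hr₀0.trans ha).trans hx.1)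
      (fun r hr => hDd r (hr₀.trans_le (ha.trans hr.1.le))) fun r hr => ?_
    have h3 := hrev r (ha.trans_lt hr.1) fun x hx => hpb x ⟨hx.1, hx.2.trans hr.2⟩
    have h4 := exp_lt_exp.2 h3
    have h5 := hBneg r (ha.trans hr.1.le)
    have h6 : 0 < r := hr₀.trans_le (ha.trans hr.1.le)
    have h7 : 0 ≤ L * r ^ (n + 1) := by positivity
    rw [mul_assoc]
    exact mul_nonneg h7 (mul_nonneg_of_nonpos_of_nonpos (by linarith) h5)
  have hconst : ∀ b, r₀ < b → (∀ r ∈ Ico r₀ b, 0 < p r) → D b ≤ 0 →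
      r₀ ^ (n + 2 - c) * v r₀ = b ^ (n + 2 - c) * v b := by
    intro b hb hpb hDb
    refine hv.rpow_mul_eq hr₀ hb.le fun r hr => ?_
    have hneg : ∀ x ∈ Ioo r₀ b, exp (u₂ x) - exp (u₁ x) < 0 := fun x hx =>
      sub_neg.2 (exp_lt_exp.2 (hrev x hx.1 fun y hy => hpb y ⟨hy.1, hy.2.trans hx.2⟩))
    have hz := hasDerivAt_eq_zero_of_le (f := D) (a := r₀) (b := b)
      (hDc.mono fun x hx => hr₀0.trans hx.1) (fun r hr => hDd r (hr₀.trans hr.1))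
      (fun x hx => by
        have h6 : 0 < x := hr₀.trans hx.1
        have h7 : 0 ≤ L * x ^ (n + 1) := by positivity
        rw [mul_assoc]
        exact mul_nonneg h7 (mul_nonneg_of_nonpos_of_nonpos (hneg x hx).le (hBneg x hx.1.le)))
      (by rw [hDr₀]; exact hDb) r hr
    have h6 : 0 < r := hr₀.trans hr.1
    have h7 : L * r ^ (n + 1) ≠ 0 := by positivity
    exact (mul_eq_zero.1 hz).resolve_left (mul_ne_zero h7 (hneg r hr).ne)
  have hvr₀ : v r₀ = 0 := by
    have hpw : (r₀ ^ (n + 2 - c)) ≠ 0 := (rpow_pos_of_pos hr₀ _).ne'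
    by_cases hex : ∃ b, r₀ ≤ b ∧ p b ≤ 0
    · obtain ⟨b, hb0, hb⟩ := hex
      obtain ⟨s, ⟨⟨hs0, -⟩, hsle⟩, hsmin⟩ :=
        (isCompact_Icc.inter_right (isClosed_le hpc continuous_const) :
          IsCompact (Icc r₀ b ∩ {r | p r ≤ 0})).exists_isLeast ⟨b, ⟨hb0, le_rfl⟩, hb⟩
      simp only [mem_ofPred_eq] at hsle
      have hps : ∀ r ∈ Ico r₀ s, 0 < p r := by
        intro r hr
        by_contra! hle
        rcases le_total r b with h | h
        · exact (hsmin ⟨⟨hr.1, h⟩, hle⟩).not_gt hr.2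
        · exact ((hsmin ⟨⟨hb0, le_rfl⟩, hb⟩).trans h).not_gt hr.2
      have hs : r₀ < s := hs0.lt_of_ne fun h => by rw [← h] at hsle; linarith
      have hps0 : p s = 0 := by
        refine le_antisymm hsle ?_
        refine ge_of_tendsto (x := 𝓝[<] s)
          (hpc.continuousAt.tendsto.mono_left nhdsWithin_le_nhds) ?_
        filter_upwards [Ioo_mem_nhdsLT hs] with r hr using (hps r ⟨hr.1.le, hr.2⟩).le
      have hq : -(s * q₂ s) = -(s * q₁ s) := sub_eq_zero.1 hps0
      have hDs : D s = L * s ^ (n + 2) * v s * (exp (u₂ s) - exp (u₁ s)) := by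
        simp only [hD, hP, hq]; ring
      have hlt_s := sub_neg.2 (exp_lt_exp.2 (hrev s hs hps))
      have hs_pos : 0 < s := hr₀.trans hs
      have hvs := hv.nonneg s hs_pos.le
      have h7 : 0 < L * s ^ (n + 2) := by positivity
      have hDs_le : D s ≤ 0 := by
        rw [hDs]
        exact mul_nonpos_of_nonneg_of_nonpos (by positivity) hlt_s.le
      have hDs_ge : 0 ≤ D s := hDr₀ ▸ hDmono r₀ s le_rfl hs.le hps
      have hvs0 : v s = 0 := by
        have h8 : L * s ^ (n + 2) * v s * (exp (u₂ s) - exp (u₁ s)) = 0 :=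
          hDs ▸ le_antisymm hDs_le hDs_ge
        exact (mul_eq_zero.1 ((mul_eq_zero.1 h8).resolve_right hlt_s.ne)).resolve_left h7.ne'
      have := hconst s hs hps hDs_le
      rw [hvs0, mul_zero] at this
      exact (mul_eq_zero.1 this).resolve_left hpw
    · push Not at hex
      have hDlim : Tendsto D atTop (𝓝 0) := by
        have k : ∀ {u q : ℝ → ℝ}, RadialSolution L n v u q →
            Tendsto (fun r => -(r * q r)) atTop (𝓝 ℓ) →
            Tendsto (P u q) atTop (𝓝 (0 + ℓ ^ 2 / 2 - c * ℓ)) := fun h ht =>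
          ((h.tendsto_density hv hL.le hδ).add ((ht.pow 2).div_const 2)).sub (ht.const_mul c)
        simpa using (k h₂ ht₂).sub (k h₁ ht₁)
      have hDle : ∀ b, r₀ ≤ b → D b ≤ 0 := fun b hb => by
        refine ge_of_tendsto hDlim ?_
        filter_upwards [eventually_ge_atTop b] with r hr
        exact hDmono b r hb hr fun x hx => hex x hx.1
      obtain ⟨M, hM⟩ := hv.decay
      have hlim : Tendsto (fun r : ℝ => M * r ^ (-(δ + c))) atTop (𝓝 0) := by
        simpa using (tendsto_rpow_neg_atTop (by linarith : 0 < δ + c)).const_mul M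
      have hle : r₀ ^ (n + 2 - c) * v r₀ ≤ 0 := by
        refine ge_of_tendsto hlim ?_
        filter_upwards [eventually_gt_atTop r₀] with r hr
        have hr_pos : 0 < r := hr₀.trans hr
        rw [hconst r hr (fun x hx => hex x hx.1) (hDle r hr.le)]
        have h3 : r ^ (n + 2 - c) = r ^ (n + 2 + δ) * r ^ (-(δ + c)) := by
          rw [← rpow_add hr_pos]; congr 1; ring
        calc r ^ (n + 2 - c) * v r = (r ^ (n + 2 + δ) * v r) * r ^ (-(δ + c)) := by
              rw [h3]; ring
          _ ≤ M * r ^ (-(δ + c)) := by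
              have := hM r hr_pos.le
              gcongr
      have hge : 0 ≤ r₀ ^ (n + 2 - c) * v r₀ :=
        mul_nonneg (rpow_nonneg hr₀0 _) (hv.nonneg r₀ hr₀0)
      exact (mul_eq_zero.1 (le_antisymm hle hge)).resolve_left hpw
  have hpge : p r₀ ≤ 0 := by
    refine ge_of_tendsto hplim ?_
    filter_upwards [eventually_ge_atTop r₀] with r hr
    refine le_of_hasDerivAt_nonneg hr hpc.continuousOn
      (fun x hx => hpd x (hr₀.trans hx.1)) fun x hx => ?_
    rw [hv.eq_zero_of_le hr₀0 hvr₀ hx.1.le]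
    simp
  linarith

theorem eqOn_of_integral_eq {u₁ q₁ u₂ q₂ : ℝ → ℝ} (h₁ : RadialSolution L n v u₁ q₁)
    (h₂ : RadialSolution L n v u₂ q₂) (hv : RadialWeight n δ v) (hL : 0 < L) (hn : 0 ≤ n)
    (hδ : 0 < δ)
    (hi₁ : IntegrableOn (fun r => r ^ (n + 1) * v r * exp (u₁ r)) (Ioi 0))
    (hi₂ : IntegrableOn (fun r => r ^ (n + 1) * v r * exp (u₂ r)) (Ioi 0))
    (heq : ∫ r in Ioi 0, r ^ (n + 1) * v r * exp (u₁ r)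
      = ∫ r in Ioi 0, r ^ (n + 1) * v r * exp (u₂ r)) {R : ℝ} (hR : 0 ≤ R) :
    u₁ R = u₂ R := by
  have ht₁ := h₁.tendsto_mass hi₁
  have ht₂ := h₂.tendsto_mass hi₂
  rw [← heq] at ht₂
  exact h₁.eqOn_of_zero_eq h₂ hv hL.le hn (le_antisymm
    (not_lt.1 (h₂.not_lt_of_tendsto h₁ hv hL hn hδ ht₂ ht₁))
    (not_lt.1 (h₁.not_lt_of_tendsto h₂ hv hL hn hδ ht₁ ht₂))) hR

end RadialSolution

section Plane

theorem norm_single_add_single (r t : ℝ) :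
    ‖r • (EuclideanSpace.single 0 1 : R2) + t • (EuclideanSpace.single 1 1 : R2)‖
      = √(r ^ 2 + t ^ 2) := by
  rw [EuclideanSpace.norm_eq, Fin.sum_univ_two]
  simp

theorem norm_smul_single (r : ℝ) : ‖r • (EuclideanSpace.single 0 1 : R2)‖ = |r| := by
  rw [norm_smul]
  simp

variable {ψ : R2 → ℝ}

theorem hasDerivAt_comp_line (hψ : ContDiff ℝ 2 ψ) (x e : R2) (t : ℝ) :
    HasDerivAt (fun t : ℝ => ψ (x + t • e)) (fderiv ℝ ψ (x + t • e) e) t := by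
  have h1 : HasDerivAt (fun t : ℝ => x + t • e) e t := by
    simpa using ((hasDerivAt_id' t).smul_const e).const_add x
  exact ((hψ.differentiable (by norm_num)).differentiableAt.hasFDerivAt).comp_hasDerivAt t h1

theorem hasDerivAt_fderiv_comp_line (hψ : ContDiff ℝ 2 ψ) (x e : R2) (t : ℝ) :
    HasDerivAt (fun t : ℝ => fderiv ℝ ψ (x + t • e) e)
      (iteratedFDeriv ℝ 2 ψ (x + t • e) ![e, e]) t := by
  have h1 : HasDerivAt (fun t : ℝ => x + t • e) e t := by
    simpa using ((hasDerivAt_id' t).smul_const e).const_add x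
  have h2 : Differentiable ℝ (fderiv ℝ ψ) :=
    (hψ.fderiv_right (m := 1) (by norm_num)).differentiable (by norm_num)
  have h3 := (h2.differentiableAt.hasFDerivAt (x := x + t • e)).comp_hasDerivAt t h1
  rw [iteratedFDeriv_two_apply]
  simpa using h3.clm_apply (hasDerivAt_const t e)

theorem HasDerivAt.id_mul_of_continuousAt {g : ℝ → ℝ} (hg : ContinuousAt g 0) :
    HasDerivAt (fun t => t * g t) (g 0) 0 := by
  rw [hasDerivAt_iff_tendsto_slope]
  refine (hg.tendsto.mono_left nhdsWithin_le_nhds).congr' ?_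
  filter_upwards [self_mem_nhdsWithin] with t ht
  have : t ≠ 0 := ht
  simp [slope_def_field, this]

theorem RadSym.apply_eq (h : RadSym ψ) (x : R2) :
    ψ x = ψ (‖x‖ • EuclideanSpace.single 0 1) :=
  h _ _ (by rw [norm_smul_single, abs_norm])

theorem radialSolution_of_radSym {L n : ℝ} {V : R2 → ℝ} {v : ℝ → ℝ}
    (hprof : ∀ x : R2, V x = v ‖x‖) (hrad : RadSym ψ) (hψ : ContDiff ℝ 2 ψ)
    (heq : ∀ x : R2, -lap ψ x = L * ‖x‖ ^ n * V x * exp (ψ x)) :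
    RadialSolution L n v (fun r => ψ (r • EuclideanSpace.single 0 1))
      (fun r => fderiv ℝ ψ (r • EuclideanSpace.single 0 1) (EuclideanSpace.single 0 1)) := by
  set e : R2 := EuclideanSpace.single 0 1 with he
  set e' : R2 := EuclideanSpace.single 1 1 with he'
  set u : ℝ → ℝ := fun r => ψ (r • e) with hu
  set q : ℝ → ℝ := fun r => fderiv ℝ ψ (r • e) e with hq
  have hud : ∀ r, HasDerivAt u (q r) r := fun r => by
    simpa using hasDerivAt_comp_line hψ 0 e r
  have hqd : ∀ r, HasDerivAt q (iteratedFDeriv ℝ 2 ψ (r • e) ![e, e]) r := fun r => by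
    simpa using hasDerivAt_fderiv_comp_line hψ 0 e r
  have hqc : Continuous q := continuous_iff_continuousAt.2 fun r => (hqd r).continuousAt
  refine ⟨hud, hqc, ?_, ?_⟩
  · have h1 : HasDerivAt (fun r => u (-r)) (-q 0) 0 := by
      have h2 : HasDerivAt u (q 0) (-0) := by simpa using hud 0
      exact (h2.comp (0 : ℝ) (hasDerivAt_neg (0 : ℝ))).congr_deriv (by ring)
    have h2 : (fun r => u (-r)) = u := by
      funext r
      exact hrad _ _ (by simp [norm_smul])
    rw [h2] at h1
    linarith [h1.unique (hud 0)]
  · intro r hr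
    refine (hqd r).congr_deriv ?_
    have hs : ∀ t : ℝ, 0 < r ^ 2 + t ^ 2 := fun t => by positivity
    have hsq : ∀ t : ℝ, HasDerivAt (fun t => √(r ^ 2 + t ^ 2)) (t / √(r ^ 2 + t ^ 2)) t := by
      intro t
      refine (((hasDerivAt_pow 2 t).const_add (r ^ 2)).sqrt (hs t).ne').congr_deriv ?_
      have := sqrt_pos.2 (hs t)
      rw [div_eq_div_iff (by positivity) this.ne']
      push_cast
      ring
    have hline : (fun t : ℝ => ψ (r • e + t • e')) = fun t => u √(r ^ 2 + t ^ 2) := by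
      funext t
      rw [hrad.apply_eq, norm_single_add_single]
    have hd1 : (fun t : ℝ => fderiv ℝ ψ (r • e + t • e') e')
        = fun t => t * (q √(r ^ 2 + t ^ 2) / √(r ^ 2 + t ^ 2)) := by
      funext t
      have h1 := hasDerivAt_comp_line hψ (r • e) e' t
      rw [hline] at h1
      rw [h1.unique ((hud _).comp t (hsq t))]
      ring
    have hd2 : iteratedFDeriv ℝ 2 ψ (r • e) ![e', e'] = q r / r := by
      have h1 := hasDerivAt_fderiv_comp_line hψ (r • e) e' 0
      rw [hd1, zero_smul, add_zero] at h1
      have hg : ContinuousAt (fun t => q √(r ^ 2 + t ^ 2) / √(r ^ 2 + t ^ 2)) 0 := by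
        have h3 : Continuous fun t : ℝ => √(r ^ 2 + t ^ 2) := by fun_prop
        exact (hqc.comp h3).continuousAt.div h3.continuousAt (sqrt_pos.2 (hs 0)).ne'
      rw [h1.unique (HasDerivAt.id_mul_of_continuousAt hg)]
      simp [sqrt_sq hr.le]
    have hlap := heq (r • e)
    rw [lap, Fin.sum_univ_two, ← he, ← he', hd2, hprof, norm_smul_single, abs_of_pos hr] at hlap
    linear_combination -hlap

end Plane

theorem integral_norm_rpow_mul (n : ℝ) (v u : ℝ → ℝ) :
    ∫ x : R2, ‖x‖ ^ n * v ‖x‖ * exp (u ‖x‖)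
      = 2 * (volume : Measure R2).real (ball 0 1)
        * ∫ r in Ioi 0, r ^ (n + 1) * v r * exp (u r) := by
  rw [integral_fun_norm_addHaar (volume : Measure R2) (fun r => r ^ n * v r * exp (u r))]
  simp only [finrank_euclideanSpace, Fintype.card_fin, smul_eq_mul, nsmul_eq_mul]
  rw [setIntegral_congr_fun measurableSet_Ioi (g := fun r => r ^ (n + 1) * v r * exp (u r))]
  · push_cast; ring
  · intro r hr
    have : r ≠ 0 := ne_of_gt hr
    simp only [rpow_add_one this]
    ring

/-- Theorem 1.15: uniqueness of radially symmetric solutions for β > 0 under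
decay and monotonicity conditions on V. -/
theorem uniqueness_beta_pos (β n δ : ℝ) (hβ : 0 < β) (hn : 0 ≤ n) (hδ : 0 < δ)
    (V : R2 → ℝ) (v : ℝ → ℝ) (hprof : ∀ x : R2, V x = v ‖x‖)
    (hV0 : ∀ x, 0 ≤ V x) (hVrad : RadSym V)
    (hVdec : ∀ x y : R2, ‖y‖ ≤ ‖x‖ → V x ≤ V y)
    (hVcont : Continuous V) (hVC1 : ContDiffOn ℝ 1 V {(0:R2)}ᶜ)
    (hrv : ∃ w : ℝ → ℝ, ContinuousOn w (Set.Ici 0) ∧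
      ∀ r : ℝ, 0 < r → w r = r * deriv v r)
    (hsup : ∃ M : ℝ, ∀ r : ℝ, 0 ≤ r → r ^ (n + 2 + δ) * v r ≤ M)
    (hc : ∀ c : ℝ, 0 < c → c < n + 2 → ∃ rc : ℝ, 0 < rc ∧
      (∀ r : ℝ, 0 < r → r ≤ rc → 0 ≤ c * v r + r * deriv v r) ∧
      (∀ r : ℝ, rc ≤ r → c * v r + r * deriv v r ≤ 0))
    (ψ₁ ψ₂ : R2 → ℝ)
    (h₁rad : RadSym ψ₁) (h₁C : ContDiff ℝ 2 ψ₁)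
    (heq₁ : ∀ x : R2, -lap ψ₁ x = 4 * π * β * ‖x‖ ^ n * V x * Real.exp (ψ₁ x))
    (hint₁ : (∫ x : R2, ‖x‖ ^ n * V x * Real.exp (ψ₁ x)) = 1)
    (h₂rad : RadSym ψ₂) (h₂C : ContDiff ℝ 2 ψ₂)
    (heq₂ : ∀ x : R2, -lap ψ₂ x = 4 * π * β * ‖x‖ ^ n * V x * Real.exp (ψ₂ x))
    (hint₂ : (∫ x : R2, ‖x‖ ^ n * V x * Real.exp (ψ₂ x)) = 1) :
    ψ₁ = ψ₂ := by
  set e : R2 := EuclideanSpace.single 0 1 with he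
  have hVv : ∀ r, 0 ≤ r → V (r • e) = v r := fun r hr => by
    rw [hprof, norm_smul_single, abs_of_nonneg hr]
  have hnorm : ∀ r, 0 ≤ r → ‖r • e‖ = r := fun r hr => by
    rw [norm_smul_single, abs_of_nonneg hr]
  have hv : RadialWeight n δ v := by
    refine ⟨?_, ?_, ?_, ?_, ?_, hsup, hc⟩
    · have h : Continuous fun r : ℝ => V (r • e) := by fun_prop
      exact h.continuousOn.congr fun r hr => (hVv r hr).symm
    · intro r hr
      have h1 : r • e ∈ ({0}ᶜ : Set R2) := by
        have := hnorm r hr.le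
        rw [mem_compl_singleton_iff, ← norm_ne_zero_iff, this]
        exact hr.ne'
      have h2 : DifferentiableAt ℝ V (r • e) :=
        (hVC1.differentiableOn one_ne_zero).differentiableAt
          (isOpen_compl_singleton.mem_nhds h1)
      have h3 : DifferentiableAt ℝ (fun r : ℝ => V (r • e)) r :=
        DifferentiableAt.comp r h2 (by fun_prop)
      refine h3.congr_of_eventuallyEq ?_
      filter_upwards [lt_mem_nhds hr] with s hs using (hVv s hs.le).symm
    · exact fun r hr => hVv r hr ▸ hV0 _
    · intro a ha b hb hab
      rw [← hVv a ha, ← hVv b hb]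
      exact hVdec _ _ (by rwa [hnorm a ha, hnorm b hb])
    · have h0 : V 0 = v 0 := by simpa using hVv 0 le_rfl
      rw [← h0]
      refine (hV0 0).lt_of_ne fun h => ?_
      have hz : ∀ x, V x = 0 := fun x => le_antisymm (h ▸ hVdec x 0 (by simp)) (hV0 x)
      simp [hz] at hint₁
  have h₁ := radialSolution_of_radSym hprof h₁rad h₁C heq₁
  have h₂ := radialSolution_of_radSym hprof h₂rad h₂C heq₂
  have key : ∀ {ψ : R2 → ℝ}, RadSym ψ → (∫ x : R2, ‖x‖ ^ n * V x * exp (ψ x)) = 1 →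
      2 * (volume : Measure R2).real (ball 0 1)
        * ∫ r in Ioi 0, r ^ (n + 1) * v r * exp (ψ (r • e)) = 1 := by
    intro ψ hψ hint
    rw [← integral_norm_rpow_mul n v fun r => ψ (r • e), ← hint]
    refine integral_congr_ae (Eventually.of_forall fun x => ?_)
    simp only [hprof]
    rw [hψ.apply_eq x]
  have k₁ := key h₁rad hint₁
  have k₂ := key h₂rad hint₂
  have hint : ∀ {f : ℝ → ℝ}, 2 * (volume : Measure R2).real (ball 0 1) * ∫ r in Ioi 0, f r = 1 →
      IntegrableOn f (Ioi 0) := fun {f} hf => by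
    by_contra hni
    rw [integral_undef hni, mul_zero] at hf
    exact zero_ne_one hf
  funext x
  rw [h₁rad.apply_eq, h₂rad.apply_eq]
  exact h₁.eqOn_of_integral_eq h₂ hv (by positivity) hn hδ (hint k₁) (hint k₂)
    (mul_left_cancel₀ (left_ne_zero_of_mul_eq_one k₁) (k₁.trans k₂.symm)) (norm_nonneg x)
end
end

section
/- Explicit family of radial solutions for V = 1 (Remark after Theorem 1.15). Let n > 0 and λ > 0, and define ψ_{λ,n} : ℝ² → ℝ by ψ_{λ,n}(x) = -2·log(λ^{2n}·‖x‖^{2n} + 1) + log(n/π) + 2n·log λ. Then -Δψ_{λ,n}(x) = 8πn·‖x‖^{2(n-1)}·e^{ψ_{λ,n}(x)} for every x ∈ ℝ²∖{0}, and ∫_{ℝ²} ‖x‖^{2(n-1)}·e^{ψ_{λ,n}(x)} dx = 1. -/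
open MeasureTheory Real Filter Bornology Metric
open scoped NNReal

noncomputable section

/-- Chain rule for the Laplacian of a function of `‖y‖ ^ 2`. -/
theorem lap_comp_norm_sq {g g₁ : ℝ → ℝ} {g₂ : ℝ} {x : R2}
    (hg : ∀ᶠ s in nhds (‖x‖ ^ 2), HasDerivAt g (g₁ s) s)
    (hg₁ : HasDerivAt g₁ g₂ (‖x‖ ^ 2)) :
    lap (fun y : R2 => g (‖y‖ ^ 2)) x = 4 * (‖x‖ ^ 2 * g₂ + g₁ (‖x‖ ^ 2)) := by
  have hsq (y : R2) : HasFDerivAt (fun z : R2 => ‖z‖ ^ 2) (2 • innerSL ℝ y) y :=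
    (hasStrictFDerivAt_norm_sq y).hasFDerivAt
  have hfirst : fderiv ℝ (fun y : R2 => g (‖y‖ ^ 2)) =ᶠ[nhds x]
      fun y => g₁ (‖y‖ ^ 2) • ((2 : ℝ) • innerSL ℝ) y := by
    filter_upwards [(hsq x).continuousAt.eventually hg] with y hy
    refine (hy.comp_hasFDerivAt y (hsq y)).fderiv.trans ?_
    ext v
    simp
  have hsecond := ((hg₁.comp_hasFDerivAt x (hsq x)).smul
    ((2 : ℝ) • innerSL ℝ (E := R2)).hasFDerivAt).fderiv
  have hinner (u v : R2) : innerSL ℝ u v = u 0 * v 0 + u 1 * v 1 := by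
    simp [innerSL_apply_apply, PiLp.inner_apply, Fin.sum_univ_two, mul_comm]
  have hnorm : ‖x‖ ^ 2 = x 0 ^ 2 + x 1 ^ 2 := by
    simp [EuclideanSpace.norm_sq_eq, Fin.sum_univ_two]
  unfold lap
  simp only [iteratedFDeriv_two_apply, hfirst.fderiv_eq.trans hsecond]
  simp [Fin.sum_univ_two, hinner]
  rw [hnorm]
  ring

theorem rpow_two_mul_eq_sq_rpow {r : ℝ} (hr : 0 ≤ r) (n : ℝ) : r ^ (2 * n) = (r ^ 2) ^ n := by
  rw [rpow_mul hr, rpow_two]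

theorem exp_liouville_profile {n lam t : ℝ} (hn : 0 < n) (hlam : 0 < lam) (ht : 0 ≤ t) :
    Real.exp (-2 * Real.log (lam ^ (2 * n) * t + 1) + Real.log (n / π)
      + 2 * n * Real.log lam) = n / π * lam ^ (2 * n) / (lam ^ (2 * n) * t + 1) ^ 2 := by
  have hpos : 0 < lam ^ (2 * n) * t + 1 := by positivity
  have hdouble : -2 * Real.log (lam ^ (2 * n) * t + 1)
      = -Real.log ((lam ^ (2 * n) * t + 1) ^ 2) := by
    rw [Real.log_pow]; push_cast; ring
  rw [← Real.log_rpow hlam, hdouble, Real.exp_add, Real.exp_add, Real.exp_neg,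
    Real.exp_log (by positivity), Real.exp_log (by positivity), Real.exp_log (by positivity)]
  ring

theorem hasDerivAt_mul_rpow_add_one (a n : ℝ) {s : ℝ} (hs : 0 < s) :
    HasDerivAt (fun s : ℝ => a * s ^ n + 1) (a * (n * s ^ (n - 1))) s :=
  ((hasDerivAt_rpow_const (Or.inl hs.ne')).const_mul a).add_const 1

/-- The Laplacian of `-2 log (a ‖y‖ ^ (2n) + 1) + c` away from the origin. -/
theorem lap_liouville_profile {a : ℝ} (ha : 0 < a) (n c : ℝ) {x : R2} (hx : x ≠ 0) :
    lap (fun y : R2 => -2 * Real.log (a * (‖y‖ ^ 2) ^ n + 1) + c) x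
      = -(8 * n ^ 2 * a * (‖x‖ ^ 2) ^ (n - 1) / (a * (‖x‖ ^ 2) ^ n + 1) ^ 2) := by
  have hs : 0 < ‖x‖ ^ 2 := by positivity
  have hden {s : ℝ} (hs : 0 < s) : a * s ^ n + 1 ≠ 0 := by positivity
  have hg : ∀ᶠ s in nhds (‖x‖ ^ 2),
      HasDerivAt (fun s : ℝ => -2 * Real.log (a * s ^ n + 1) + c)
        (-2 * (a * (n * s ^ (n - 1)) / (a * s ^ n + 1))) s := by
    filter_upwards [lt_mem_nhds hs] with s hs
    exact (((hasDerivAt_mul_rpow_add_one a n hs).log (hden hs)).const_mul (-2)).add_const c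
  have hg₁ := ((((hasDerivAt_rpow_const (p := n - 1) (Or.inl hs.ne')).const_mul n).const_mul
    a).div (hasDerivAt_mul_rpow_add_one a n hs) (hden hs)).const_mul (-2)
  rw [lap_comp_norm_sq hg hg₁]
  have hne := hden hs
  generalize ‖x‖ ^ 2 = s at *
  have hsub₂ : s ^ (n - 1 - 1) = s ^ (n - 1) / s := rpow_sub_one hs.ne' _
  have hmul : s ^ n = s ^ (n - 1) * s := by rw [rpow_sub_one hs.ne']; field_simp
  rw [hsub₂]
  rw [hmul] at hne ⊢
  field_simp
  ring

theorem integral_Ioi_liouville_profile {a m : ℝ} (ha : 0 < a) (hm : 0 < m) :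
    ∫ r in Set.Ioi (0 : ℝ), a * (m * r ^ (m - 1)) / (a * r ^ m + 1) ^ 2 = 1 := by
  have hderiv : ∀ r ∈ Set.Ioi (0 : ℝ), HasDerivAt (fun r : ℝ => -(a * r ^ m + 1)⁻¹)
      (a * (m * r ^ (m - 1)) / (a * r ^ m + 1) ^ 2) r := by
    intro r (hr : 0 < r)
    refine ((hasDerivAt_mul_rpow_add_one a m hr).inv (by positivity)).neg.congr_deriv ?_
    rw [neg_div, neg_neg]
  have hcont : ContinuousWithinAt (fun r : ℝ => -(a * r ^ m + 1)⁻¹) (Set.Ici 0) 0 := by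
    have : ContinuousAt (fun r : ℝ => r ^ m) 0 := continuousAt_rpow_const _ _ (Or.inr hm.le)
    refine ((((this.const_mul a).add_const 1)).inv₀ ?_).neg.continuousWithinAt
    simp [zero_rpow hm.ne']
  have hlim : Tendsto (fun r : ℝ => -(a * r ^ m + 1)⁻¹) atTop (nhds 0) := by
    simpa using (tendsto_inv_atTop_zero.comp (tendsto_atTop_add_const_right _ 1
      ((tendsto_rpow_atTop hm).const_mul_atTop ha))).neg
  rw [integral_Ioi_of_hasDerivAt_of_nonneg hcont hderiv _ hlim]
  · simp [zero_rpow hm.ne']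
  · intro r (hr : 0 < r)
    positivity

/-- Remark 1.16: the explicit family ψ_{λ,n} solves the Liouville equation with
V(x) = ‖x‖^{2(n-1)} and total integral one. -/
theorem explicit_radial_family (n lam : ℝ) (hn : 0 < n) (hlam : 0 < lam) :
    (∀ x : R2, x ≠ 0 →
      -lap (fun y : R2 =>
          -2 * Real.log (lam ^ (2*n) * ‖y‖ ^ (2*n) + 1) + Real.log (n / π)
            + 2 * n * Real.log lam) x
        = 8 * π * n * ‖x‖ ^ (2*(n-1)) *
          Real.exp (-2 * Real.log (lam ^ (2*n) * ‖x‖ ^ (2*n) + 1)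
            + Real.log (n / π) + 2 * n * Real.log lam)) ∧
    (∫ x : R2, ‖x‖ ^ (2*(n-1)) *
        Real.exp (-2 * Real.log (lam ^ (2*n) * ‖x‖ ^ (2*n) + 1)
          + Real.log (n / π) + 2 * n * Real.log lam)) = 1 := by
  have ha : 0 < lam ^ (2 * n) := by positivity
  refine ⟨fun x hx => ?_, ?_⟩
  · rw [exp_liouville_profile hn hlam (by positivity)]
    simp only [rpow_two_mul_eq_sq_rpow (norm_nonneg _), add_assoc]
    have h := lap_liouville_profile ha n (Real.log (n / π) + 2 * n * Real.log lam) hx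
    rw [rpow_two_mul_eq_sq_rpow hlam.le] at h ⊢
    rw [h]
    field_simp
  · simp_rw [fun x : R2 => exp_liouville_profile hn hlam (rpow_nonneg (norm_nonneg x) (2 * n))]
    rw [integral_fun_norm_addHaar (volume : Measure R2) (fun r : ℝ => r ^ (2 * (n - 1)) *
      (n / π * lam ^ (2 * n) / (lam ^ (2 * n) * r ^ (2 * n) + 1) ^ 2))]
    have hball : (volume : Measure R2).real (ball 0 1) = π := by
      simp [measureReal_def, EuclideanSpace.volume_ball_fin_two, pi_nonneg]
    have hprofile : ∫ r in Set.Ioi (0 : ℝ), r ^ (Module.finrank ℝ R2 - 1) •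
        (r ^ (2 * (n - 1)) *
          (n / π * lam ^ (2 * n) / (lam ^ (2 * n) * r ^ (2 * n) + 1) ^ 2)) = 1 / (2 * π) := by
      have hone := integral_Ioi_liouville_profile ha (show 0 < 2 * n by positivity)
      refine Eq.trans ?_ ((congrArg (1 / (2 * π) * ·) hone).trans (mul_one _))
      simp only [← integral_const_mul]
      refine setIntegral_congr_fun measurableSet_Ioi fun r (hr : 0 < r) => ?_
      have hpow : r ^ (2 * n - 1) = r ^ (2 * (n - 1)) * r := by
        rw [← rpow_add_one hr.ne']; ring_nf
      simp only [finrank_euclideanSpace, Fintype.card_fin, smul_eq_mul, hpow]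
      have : lam ^ (2 * n) * r ^ (2 * n) + 1 ≠ 0 := by positivity
      field_simp
      ring
    rw [hprofile, hball]
    simp
end
end

section
/- Radial oscillation and gradient bounds (Proposition 2.1). Let R>0 and let φ : ℝ² → ℝ be radially symmetric and continuously differentiable on D(0,R)∖{0} with ∫_{D(0,R)∖{0}} ‖∇φ(x)‖² dx < ∞. Then for all 0 < s ≤ r < R and all points x, y with ‖x‖ = r, ‖y‖ = s, one has |φ(x) - φ(y)|² ≤ (log(r/s)/(2π)) · ∫_{D(0,R)∖{0}} ‖∇φ‖² dx. If moreover φ is twice continuously differentiable on D(0,R)∖{0} and Δφ is integrable on D(0,R)∖{0}, then ‖x‖·‖∇φ(x)‖ ≤ (1/(2π)) · ∫_{D(0,R)∖{0}} |Δφ| dx for every x ∈ D(0,R)∖{0}. -/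
open MeasureTheory Real Filter Bornology Metric
open scoped NNReal

noncomputable section

open Set

theorem hasFDerivAt_norm_of_ne_zero {E : Type*} [NormedAddCommGroup E] [InnerProductSpace ℝ E]
    {x : E} (hx : x ≠ 0) : HasFDerivAt (fun y : E => ‖y‖) (‖x‖⁻¹ • innerSL ℝ x) x := by
  have hx' : ‖x‖ ≠ 0 := norm_ne_zero_iff.2 hx
  have h := (hasStrictFDerivAt_norm_sq x).hasFDerivAt.sqrt (pow_ne_zero 2 hx')
  simp only [Real.sqrt_sq (norm_nonneg _)] at h
  convert! h using 1
  ext v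
  simp
  field_simp

theorem ball_diff_singleton_ae_eq (R : ℝ) :
    (ball (0 : R2) R \ {0} : Set R2) =ᵐ[volume] ball (0 : R2) R :=
  sdiff_null_ae_eq_self (measure_singleton 0)

/-- A function equal to `G ‖x‖` on a punctured disc is integrable there iff `t * G t` is integrable
on the corresponding interval. -/
theorem integrableOn_punctured_ball_iff {R : ℝ} {F : R2 → ℝ} {G : ℝ → ℝ}
    (hFG : ∀ x ∈ ball (0 : R2) R \ {0}, F x = G ‖x‖) :
    IntegrableOn F (ball (0 : R2) R \ {0}) ↔ IntegrableOn (fun t => t * G t) (Ioo 0 R) := by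
  have hm : MeasurableSet (ball (0 : R2) R \ {0}) :=
    measurableSet_ball.diff (measurableSet_singleton 0)
  rw [integrableOn_congr_fun hFG hm,
    integrableOn_congr_set_ae (ball_diff_singleton_ae_eq R),
    integrableOn_fun_norm_addHaar]
  simp

/-- Integration in polar coordinates of a radial function over a punctured disc. -/
theorem setIntegral_punctured_ball {R : ℝ} {F : R2 → ℝ} {G : ℝ → ℝ}
    (hFG : ∀ x ∈ ball (0 : R2) R \ {0}, F x = G ‖x‖) :
    ∫ x in ball (0 : R2) R \ {0}, F x = 2 * π * ∫ t in Ioo 0 R, t * G t := by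
  have hm : MeasurableSet (ball (0 : R2) R \ {0}) :=
    measurableSet_ball.diff (measurableSet_singleton 0)
  have hvol : (volume : Measure R2).real (ball 0 1) = π := by
    simp [Measure.real, EuclideanSpace.volume_ball_fin_two, ENNReal.toReal_ofReal pi_pos.le]
  have h := integral_fun_norm_addHaar (volume : Measure R2) ((Iio R).indicator G)
  have hball : (fun x : R2 => (Iio R).indicator G ‖x‖) =
      (ball (0 : R2) R).indicator fun x => G ‖x‖ := by
    ext x
    simp [indicator]
  have hIoi : (fun t : ℝ => t ^ (Module.finrank ℝ R2 - 1) • (Iio R).indicator G t) =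
      (Iio R).indicator fun t => t * G t := by
    ext t
    by_cases ht : t < R <;> simp [ht]
  rw [hball, hIoi, integral_indicator measurableSet_ball, setIntegral_indicator measurableSet_Iio,
    Ioi_inter_Iio, hvol] at h
  rw [setIntegral_congr_fun hm hFG, setIntegral_congr_set (ball_diff_singleton_ae_eq R), h]
  simp [mul_assoc]

/-- Weighted Cauchy–Schwarz for increments: `|f r - f s|² ≤ log (r / s) * ∫ t (f' t)²`. -/
theorem sq_sub_le_log_mul_integral {f f' : ℝ → ℝ} {s r : ℝ} (hs : 0 < s) (hsr : s ≤ r)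
    (hf : ∀ t ∈ Icc s r, HasDerivAt f (f' t) t) (hf' : ContinuousOn f' (Icc s r)) :
    |f r - f s| ^ 2 ≤ Real.log (r / s) * ∫ t in s..r, t * f' t ^ 2 := by
  rcases hsr.eq_or_lt with rfl | hlt
  · simp
  have hlog : 0 < Real.log (r / s) := Real.log_pos ((one_lt_div hs).2 hlt)
  have hpos : ∀ t ∈ Icc s r, 0 < t := fun t ht => hs.trans_le ht.1
  have hI : ∫ t in s..r, f' t = f r - f s :=
    intervalIntegral.integral_eq_sub_of_hasDerivAt (by rwa [uIcc_of_le hsr])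
      (hf'.intervalIntegrable_of_Icc hsr)
  have hinv : IntervalIntegrable (fun t : ℝ => t⁻¹) volume s r :=
    (continuousOn_inv₀.mono fun t ht => (hpos t ht).ne').intervalIntegrable_of_Icc hsr
  have hen : IntervalIntegrable (fun t : ℝ => t * f' t ^ 2) volume s r :=
    (continuousOn_id.mul (hf'.pow 2)).intervalIntegrable_of_Icc hsr
  have hlin : IntervalIntegrable f' volume s r := hf'.intervalIntegrable_of_Icc hsr
  set c : ℝ := (f r - f s) / Real.log (r / s) with hc
  have hmono := intervalIntegral.integral_mono_on (f := fun t => 2 * c * f' t)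
    (g := fun t => t * f' t ^ 2 + c ^ 2 * t⁻¹) hsr (hlin.const_mul _)
    (hen.add (hinv.const_mul _)) fun t ht => by
      have h0 := hpos t ht
      have h1 : t * f' t ^ 2 + c ^ 2 * t⁻¹ - 2 * c * f' t = t⁻¹ * (t * f' t - c) ^ 2 := by
        field_simp
        ring
      have h2 : 0 ≤ t⁻¹ * (t * f' t - c) ^ 2 := by positivity
      linarith
  rw [intervalIntegral.integral_add hen (hinv.const_mul _), intervalIntegral.integral_const_mul,
    intervalIntegral.integral_const_mul, hI, integral_inv_of_pos hs (hs.trans hlt)] at hmono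
  have hcl : f r - f s = c * Real.log (r / s) := by rw [hc]; field_simp
  rw [sq_abs, hcl]
  rw [hcl] at hmono
  nlinarith

/-- If `t (f t)²` is integrable near the origin, then `t f t` takes arbitrarily small values
there. -/
theorem exists_abs_mul_lt_of_integrableOn {f : ℝ → ℝ} {r ε : ℝ} (hr : 0 < r) (hε : 0 < ε)
    (hf : IntegrableOn (fun t => t * f t ^ 2) (Ioo 0 r)) :
    ∃ s ∈ Ioo 0 r, |s * f s| < ε := by
  by_contra! h
  have hinv : IntegrableOn (fun t : ℝ => t⁻¹) (Ioo 0 r) := by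
    refine Integrable.mono' (hf.const_mul (ε ^ 2)⁻¹) measurable_inv.aestronglyMeasurable ?_
    filter_upwards [ae_restrict_mem measurableSet_Ioo] with t ht
    have h0 : 0 < t := ht.1
    have h1 : ε ^ 2 ≤ (t * f t) ^ 2 := by
      rw [← sq_abs (t * f t)]
      exact pow_le_pow_left₀ hε.le (h t ht) 2
    rw [Real.norm_of_nonneg (by positivity), inv_mul_eq_div, le_div_iff₀ (by positivity),
      inv_mul_le_iff₀ h0]
    nlinarith
  have := (intervalIntegrable_iff_integrableOn_Ioo_of_le hr.le).2 hinv
  rw [intervalIntegrable_inv_iff] at this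
  rcases this with h | h
  · exact hr.ne h
  · exact h left_mem_uIcc

theorem abs_sub_le_setIntegral_abs {h h' : ℝ → ℝ} {s r R : ℝ} (hs : 0 < s) (hsr : s ≤ r)
    (hrR : r < R) (hh : ∀ t ∈ Ioo 0 R, HasDerivAt h (h' t) t)
    (hint : IntegrableOn h' (Ioo 0 R)) :
    |h r - h s| ≤ ∫ t in Ioo 0 R, |h' t| := by
  have hsub : Ioc s r ⊆ Ioo 0 R := fun t ht => ⟨hs.trans ht.1, ht.2.trans_lt hrR⟩
  have hI : IntervalIntegrable h' volume s r :=
    (intervalIntegrable_iff_integrableOn_Ioc_of_le hsr).2 (hint.mono_set hsub)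
  have hftc : ∫ t in s..r, h' t = h r - h s := by
    refine intervalIntegral.integral_eq_sub_of_hasDerivAt (fun t ht => ?_) hI
    rw [uIcc_of_le hsr] at ht
    exact hh t ⟨hs.trans_le ht.1, ht.2.trans_lt hrR⟩
  rw [← hftc]
  refine (intervalIntegral.norm_integral_le_integral_norm (f := h') hsr).trans ?_
  rw [intervalIntegral.integral_of_le hsr]
  exact setIntegral_mono_set hint.norm (ae_of_all _ fun _ => norm_nonneg _)
    hsub.eventuallyLE

/-- The radial profile of a function on the plane. -/
def radialProfile (φ : R2 → ℝ) (t : ℝ) : ℝ := φ (t • EuclideanSpace.single 0 1)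

theorem norm_smul_single_zero_one {t : ℝ} (ht : 0 ≤ t) :
    ‖t • (EuclideanSpace.single 0 1 : R2)‖ = t := by
  simp [norm_smul, abs_of_nonneg ht]

theorem RadSym.eq_radialProfile {φ : R2 → ℝ} (hφ : RadSym φ) (x : R2) :
    φ x = radialProfile φ ‖x‖ :=
  hφ _ _ (norm_smul_single_zero_one (norm_nonneg x)).symm

theorem contDiffOn_radialProfile {φ : R2 → ℝ} {R : ℝ} {n : WithTop ℕ∞}
    (hφ : ContDiffOn ℝ n φ (ball 0 R \ {0})) : ContDiffOn ℝ n (radialProfile φ) (Ioo 0 R) := by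
  refine hφ.comp (t := ball (0 : R2) R \ {0})
    (contDiff_id.smul contDiff_const).contDiffOn fun t ht => ⟨?_, ?_⟩
  · rw [mem_ball_zero_iff]
    exact (norm_smul_single_zero_one ht.1.le).trans_lt ht.2
  · rw [mem_singleton_iff, ← norm_eq_zero]
    exact (norm_smul_single_zero_one ht.1.le).trans_ne ht.1.ne'

section Radial

variable {φ : R2 → ℝ} {R : ℝ}

theorem norm_mem_Ioo_of_mem_punctured_ball {x : R2} (hx : x ∈ ball (0 : R2) R \ {0}) :
    ‖x‖ ∈ Ioo 0 R :=
  ⟨norm_pos_iff.2 hx.2, mem_ball_zero_iff.1 hx.1⟩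

theorem hasDerivAt_radialProfile (hC1 : ContDiffOn ℝ 1 φ (ball (0 : R2) R \ {0})) {t : ℝ}
    (ht : t ∈ Ioo 0 R) :
    HasDerivAt (radialProfile φ) (deriv (radialProfile φ) t) t :=
  (((contDiffOn_radialProfile hC1).differentiableOn one_ne_zero).differentiableAt
    (isOpen_Ioo.mem_nhds ht)).hasDerivAt

theorem RadSym.hasFDerivAt (hrad : RadSym φ) (hC1 : ContDiffOn ℝ 1 φ (ball (0 : R2) R \ {0}))
    {x : R2} (hx : x ∈ ball (0 : R2) R \ {0}) :
    HasFDerivAt φ ((deriv (radialProfile φ) ‖x‖ / ‖x‖) • innerSL ℝ x) x := by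
  have h := (hasDerivAt_radialProfile hC1 (norm_mem_Ioo_of_mem_punctured_ball hx)).comp_hasFDerivAt
    x (hasFDerivAt_norm_of_ne_zero hx.2)
  rw [smul_smul, ← div_eq_mul_inv] at h
  exact h.congr_of_eventuallyEq (Eventually.of_forall hrad.eq_radialProfile)

theorem RadSym.norm_gradient (hrad : RadSym φ)
    (hC1 : ContDiffOn ℝ 1 φ (ball (0 : R2) R \ {0}))
    {x : R2} (hx : x ∈ ball (0 : R2) R \ {0}) :
    ‖gradient φ x‖ = |deriv (radialProfile φ) ‖x‖| := by
  have hx' := (norm_mem_Ioo_of_mem_punctured_ball hx).1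
  rw [gradient, LinearIsometryEquiv.norm_map, (hrad.hasFDerivAt hC1 hx).fderiv, norm_smul,
    innerSL_apply_norm, norm_div, norm_norm, Real.norm_eq_abs]
  field_simp

theorem hasDerivAt_deriv_radialProfile_div (hC2 : ContDiffOn ℝ 2 φ (ball (0 : R2) R \ {0}))
    {t : ℝ} (ht : t ∈ Ioo 0 R) :
    HasDerivAt (fun t => deriv (radialProfile φ) t / t)
      (deriv (fun t => deriv (radialProfile φ) t / t) t) t := by
  have h := (contDiffOn_radialProfile hC2).deriv_of_isOpen (m := 1) isOpen_Ioo (by norm_num)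
  have h1 := (h.differentiableOn one_ne_zero).differentiableAt (isOpen_Ioo.mem_nhds ht)
  exact (h1.div differentiableAt_id ht.1.ne').hasDerivAt

/-- The Laplacian of a radial function with profile `f` is `t g' + 2 g`, where `g = f' / t`. -/
theorem RadSym.lap_eq (hrad : RadSym φ) (hC2 : ContDiffOn ℝ 2 φ (ball (0 : R2) R \ {0}))
    {x : R2} (hx : x ∈ ball (0 : R2) R \ {0}) :
    lap φ x = ‖x‖ * deriv (fun t => deriv (radialProfile φ) t / t) ‖x‖
      + 2 * (deriv (radialProfile φ) ‖x‖ / ‖x‖) := by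
  have hx' := norm_mem_Ioo_of_mem_punctured_ball hx
  have hC1 : ContDiffOn ℝ 1 φ (ball (0 : R2) R \ {0}) := hC2.of_le (by norm_num)
  have hopen : IsOpen (ball (0 : R2) R \ {0}) := isOpen_ball.sdiff isClosed_singleton
  set g : ℝ → ℝ := fun t => deriv (radialProfile φ) t / t with hg
  have hev : fderiv ℝ φ =ᶠ[nhds x] fun y => g ‖y‖ • innerSL ℝ y := by
    filter_upwards [hopen.mem_nhds hx] with y hy
    exact (hrad.hasFDerivAt hC1 hy).fderiv
  have hgn := (hasDerivAt_deriv_radialProfile_div hC2 hx').comp_hasFDerivAt x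
    (hasFDerivAt_norm_of_ne_zero hx.2)
  have hD := (hgn.smul (innerSL ℝ (E := R2)).hasFDerivAt).congr_of_eventuallyEq hev
  have hsq : ‖x‖ ^ 2 = x 0 ^ 2 + x 1 ^ 2 := by
    simp [EuclideanSpace.norm_sq_eq, Fin.sum_univ_two]
  have h2 (v : R2) : fderiv ℝ (fderiv ℝ φ) x v v = g ‖x‖ * inner ℝ v v
      + deriv g ‖x‖ * (‖x‖⁻¹ * inner ℝ x v) * inner ℝ x v := by
    rw [hD.fderiv]
    rfl
  simp only [lap, iteratedFDeriv_two_apply, Fin.sum_univ_two, Matrix.cons_val_zero,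
    Matrix.cons_val_one, h2]
  simp [EuclideanSpace.inner_single_right, hg]
  have hne : ‖x‖ ≠ 0 := hx'.1.ne'
  field_simp
  rw [hsq]
  ring

end Radial

/-- Proposition 2.1: radial oscillation bound and pointwise gradient bound. -/
theorem radial_oscillation_gradient_bounds (R : ℝ) (hR : 0 < R)
    (φ : R2 → ℝ) (hrad : RadSym φ)
    (hC1 : ContDiffOn ℝ 1 φ (ball (0:R2) R \ {0}))
    (hgrad : IntegrableOn (fun x : R2 => ‖gradient φ x‖ ^ 2)
      (ball (0:R2) R \ {0})) :
    (∀ s r : ℝ, 0 < s → s ≤ r → r < R → ∀ x y : R2, ‖x‖ = r → ‖y‖ = s →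
      |φ x - φ y| ^ 2 ≤ (Real.log (r / s) / (2*π)) *
        ∫ z in ball (0:R2) R \ {0}, ‖gradient φ z‖ ^ 2) ∧
    (ContDiffOn ℝ 2 φ (ball (0:R2) R \ {0}) →
      IntegrableOn (lap φ) (ball (0:R2) R \ {0}) →
      ∀ x ∈ ball (0:R2) R \ {0},
        ‖x‖ * ‖gradient φ x‖ ≤ (1/(2*π)) *
          ∫ z in ball (0:R2) R \ {0}, |lap φ z|) := by
  set f : ℝ → ℝ := radialProfile φ with hf
  have hgn : ∀ x ∈ ball (0 : R2) R \ {0}, ‖gradient φ x‖ ^ 2 = (deriv f ‖x‖) ^ 2 := by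
    intro x hx
    rw [hrad.norm_gradient hC1 hx, sq_abs]
  have hen : IntegrableOn (fun t => t * deriv f t ^ 2) (Ioo 0 R) :=
    (integrableOn_punctured_ball_iff (G := fun t => deriv f t ^ 2) hgn).1 hgrad
  refine ⟨?_, ?_⟩
  · rintro s r hs hsr hrR x y rfl rfl
    have hsub : Icc ‖y‖ ‖x‖ ⊆ Ioo 0 R := fun t ht => ⟨hs.trans_le ht.1, ht.2.trans_lt hrR⟩
    have h := sq_sub_le_log_mul_integral (f := f) (f' := deriv f) hs hsr
      (fun t ht => hasDerivAt_radialProfile hC1 (hsub ht))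
      (((contDiffOn_radialProfile hC1).continuousOn_deriv_of_isOpen isOpen_Ioo le_rfl).mono hsub)
    have hle : ∫ t in ‖y‖..‖x‖, t * deriv f t ^ 2 ≤ ∫ t in Ioo 0 R, t * deriv f t ^ 2 := by
      rw [intervalIntegral.integral_of_le hsr]
      refine setIntegral_mono_set hen ?_ (Ioc_subset_Icc_self.trans hsub).eventuallyLE
      filter_upwards [ae_restrict_mem measurableSet_Ioo] with t ht
      exact mul_nonneg ht.1.le (sq_nonneg _)
    have hlog : 0 ≤ Real.log (‖x‖ / ‖y‖) := Real.log_nonneg ((one_le_div hs).2 hsr)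
    rw [hrad.eq_radialProfile x, hrad.eq_radialProfile y,
      setIntegral_punctured_ball (G := fun t => deriv f t ^ 2) hgn]
    refine (h.trans (mul_le_mul_of_nonneg_left hle hlog)).trans_eq ?_
    field_simp
  · intro hC2 hlap x hx
    have hx' := norm_mem_Ioo_of_mem_punctured_ball hx
    set g : ℝ → ℝ := fun t => deriv f t / t with hg
    have hL := fun z (hz : z ∈ ball (0 : R2) R \ {0}) => hrad.lap_eq hC2 hz
    have hint := (integrableOn_punctured_ball_iff
      (G := fun t => t * deriv g t + 2 * g t) hL).1 hlap
    have hder : ∀ t ∈ Ioo 0 R, HasDerivAt (fun t => t * deriv f t)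
        (t * (t * deriv g t + 2 * g t)) t := by
      intro t ht
      have h := (hasDerivAt_pow 2 t).mul (hasDerivAt_deriv_radialProfile_div hC2 ht)
      refine (h.congr_of_eventuallyEq ?_).congr_deriv (by simp [hg, hf]; ring)
      filter_upwards [isOpen_Ioo.mem_nhds ht] with u hu
      have : u ≠ 0 := hu.1.ne'
      simp only [Pi.mul_apply, ← hf]
      field_simp
    rw [hrad.norm_gradient hC1 hx, setIntegral_punctured_ball
      (G := fun t => |t * deriv g t + 2 * g t|) (fun z hz => congrArg abs (hL z hz))]
    have habs : ∫ t in Ioo 0 R, t * |t * deriv g t + 2 * g t| =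
        ∫ t in Ioo 0 R, |t * (t * deriv g t + 2 * g t)| :=
      setIntegral_congr_fun measurableSet_Ioo fun t ht => by
        simp only [abs_mul, abs_of_pos ht.1]
    rw [habs, ← mul_assoc, one_div_mul_cancel (by positivity), one_mul]
    refine le_of_forall_pos_le_add fun ε hε => ?_
    obtain ⟨s, hs, hsε⟩ := exists_abs_mul_lt_of_integrableOn hx'.1 hε
      (hen.mono_set (Ioo_subset_Ioo_right hx'.2.le))
    have hsub := abs_sub_le_setIntegral_abs hs.1 hs.2.le hx'.2 hder hint
    have htri := abs_sub_abs_le_abs_sub (‖x‖ * deriv f ‖x‖) (s * deriv f s)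
    rw [abs_mul ‖x‖, abs_norm] at htri
    linarith
end
end

section
/- Hölder regularity of radial solutions (Proposition 2.2). Let R>0, δ>0, and let V : ℝ² → ℝ be radially symmetric with x ↦ |V(x)|·‖x‖^{-δ} integrable on D(0,R). Let ψ : ℝ² → ℝ be radially symmetric, continuously differentiable on D(0,R)∖{0}, with ∫_{D(0,R)∖{0}} ‖∇ψ‖² dx < ∞ and V·e^{ψ} integrable on D(0,R), and suppose ψ is a weak solution of -Δψ = V·e^{ψ} on D(0,R) (i.e., ∫ ψ·Δφ dx = -∫ V·e^{ψ}·φ dx for every smooth φ compactly supported in D(0,R)). Then there is a continuous function ψ̃ : D(0,R) → ℝ agreeing with ψ on D(0,R)∖{0}, such that: if δ > 1, ψ̃ is Lipschitz on every compact subset of D(0,R); and if δ ≤ 1, then for every α with 0 < α < δ, ψ̃ is α-Hölder continuous on every compact subset of D(0,R). -/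
open MeasureTheory Real Filter Bornology Metric
open scoped NNReal

noncomputable section

section
open Set
open scoped Topology ContDiff

/-- Integration of a function of `‖x‖ ^ 2` over a disc, in the variable `t = ‖x‖ ^ 2`. -/
lemma setIntegral_ball_comp_norm_sq {R : ℝ} (hR : 0 < R) (F : ℝ → ℝ) :
    ∫ x in ball (0 : R2) R, F (‖x‖ ^ 2) =
      (volume : Measure R2).real (ball 0 1) * ∫ t in Ioo 0 (R ^ 2), F t := by
  have h1 : ∫ x in ball (0 : R2) R, F (‖x‖ ^ 2) =
      ∫ x : R2, (fun y => (Iio (R ^ 2)).indicator F (y ^ 2)) ‖x‖ := by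
    rw [← integral_indicator measurableSet_ball]
    refine integral_congr_ae (Eventually.of_forall fun x => ?_)
    have : ‖x‖ ^ 2 < R ^ 2 ↔ ‖x‖ < R := sq_lt_sq₀ (norm_nonneg x) hR.le
    simp [indicator, this]
  have h2 := integral_comp_rpow_Ioi_of_pos (g := (Iio (R ^ 2)).indicator F)
    (p := 2) (by norm_num)
  rw [h1, integral_fun_norm_addHaar volume (fun y => (Iio (R ^ 2)).indicator F (y ^ 2))]
  rw [setIntegral_indicator measurableSet_Iio, Ioi_inter_Iio] at h2
  rw [← h2, finrank_euclideanSpace_fin, nsmul_eq_mul, smul_eq_mul]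
  have h3 : ∀ x : ℝ, (2 * x ^ ((2 : ℝ) - 1)) • (Iio (R ^ 2)).indicator F (x ^ (2 : ℝ)) =
      2 * (x ^ (2 - 1) • (Iio (R ^ 2)).indicator F (x ^ 2)) := by
    intro x
    norm_num [mul_assoc]
  simp_rw [h3]
  rw [integral_const_mul]
  push_cast
  ring

lemma integrableOn_ball_comp_norm_sq {R : ℝ} (hR : 0 < R) (F : ℝ → ℝ) :
    IntegrableOn (fun x : R2 => F (‖x‖ ^ 2)) (ball 0 R) ↔ IntegrableOn F (Ioo 0 (R ^ 2)) := by
  rw [integrableOn_fun_norm_addHaar volume (f := fun y => F (y ^ 2))]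
  have h2 := integrableOn_Ioi_comp_rpow_iff' ((Iio (R ^ 2)).indicator F) (p := 2) (by norm_num)
  have h3 : IntegrableOn ((Iio (R ^ 2)).indicator F) (Ioi 0) ↔ IntegrableOn F (Ioo 0 (R ^ 2)) := by
    rw [IntegrableOn, integrable_indicator_iff measurableSet_Iio, IntegrableOn,
      Measure.restrict_restrict measurableSet_Iio, inter_comm, Ioi_inter_Iio, IntegrableOn]
  rw [← h3, ← h2]
  have h4 : (Ioo 0 R) = Iio R ∩ Ioi 0 := by rw [inter_comm, Ioi_inter_Iio]
  rw [h4, IntegrableOn, ← Measure.restrict_restrict measurableSet_Iio,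
    ← IntegrableOn,
    ← integrable_indicator_iff measurableSet_Iio, ← IntegrableOn]
  refine integrableOn_congr_fun (fun x hx => ?_) measurableSet_Ioi
  have : x ^ 2 < R ^ 2 ↔ x < R := sq_lt_sq₀ (le_of_lt hx) hR.le
  by_cases h : x < R <;> (simp [indicator, this, h]; try norm_num)

lemma lap_comp_norm_sq_s12 {h k : ℝ → ℝ} {k' : ℝ → ℝ} (hh : ∀ t, HasDerivAt h (k t) t)
    (hk : ∀ t, HasDerivAt k (k' t) t) (x : R2) :
    lap (fun x => h (‖x‖ ^ 2)) x = 4 * (k (‖x‖ ^ 2) + ‖x‖ ^ 2 * k' (‖x‖ ^ 2)) := by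
  have h1 : fderiv ℝ (fun x : R2 => h (‖x‖ ^ 2)) =
      fun y => k (‖y‖ ^ 2) • ((2 : ℝ) • innerSL ℝ y) := by
    ext1 y
    have := (hh (‖y‖ ^ 2)).comp_hasFDerivAt y (hasStrictFDerivAt_norm_sq y).hasFDerivAt
    refine (this.congr_fderiv ?_).fderiv
    ext z
    simp
  have h2 : HasFDerivAt (fun y : R2 => k (‖y‖ ^ 2) • ((2 : ℝ) • innerSL ℝ y)) _ x :=
    ((hk (‖x‖ ^ 2)).comp_hasFDerivAt x (hasStrictFDerivAt_norm_sq x).hasFDerivAt).smul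
      ((innerSL ℝ (E := R2)).hasFDerivAt.const_smul (2 : ℝ))
  have h3 : ‖x‖ ^ 2 = x 0 ^ 2 + x 1 ^ 2 := by
    simp [EuclideanSpace.norm_sq_eq]
  simp only [lap, iteratedFDeriv_two_apply, h1, h2.fderiv]
  have h4 (i : Fin 2) : innerSL ℝ (EuclideanSpace.single i (1 : ℝ) : R2)
      (EuclideanSpace.single i 1) = 1 := by
    rw [innerSL_apply_apply]; simp
  simp [EuclideanSpace.inner_single_right, h4]
  rw [h3]
  ring

/-- A function on `(0, A)` with `∫ t w'(t)² dt < ∞` grows slower than any multiple of `log t`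
at the origin. -/
lemma exp_le_rpow_neg_of_integrableOn {A t₁ ε : ℝ} {w w' : ℝ → ℝ} (ht₁ : t₁ ∈ Ioo 0 A) (hε : 0 < ε)
    (hw : ∀ t ∈ Ioo 0 A, HasDerivAt w (w' t) t) (hw' : ContinuousOn w' (Ioo 0 A))
    (hE : IntegrableOn (fun t => t * w' t ^ 2) (Ioo 0 A)) :
    ∃ C, 0 ≤ C ∧ ∀ t ∈ Ioc 0 t₁, Real.exp (w t) ≤ C * t ^ (-ε) := by
  set η := 1 / (4 * ε) with hη
  have hηpos : 0 < η := by positivity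
  set E := ∫ s in Ioo 0 A, s * w' s ^ 2
  refine ⟨Real.exp (w t₁ + η * E) * t₁ ^ ε, by have := ht₁.1; positivity, fun t ht => ?_⟩
  have hIcc : Icc t t₁ ⊆ Ioo 0 A := fun x hx => ⟨ht.1.trans_le hx.1, hx.2.trans_lt ht₁.2⟩
  have hc : ContinuousOn (fun s => s * w' s ^ 2) (Ioo 0 A) := by fun_prop
  have hB : ∀ x ∈ Icc t t₁, HasDerivAt
      (fun x => η * (∫ s in t..x, s * w' s ^ 2) + ε * (Real.log x - Real.log t))
      (η * (x * w' x ^ 2) + ε * x⁻¹) x := by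
    intro x hx
    have hx' := hIcc hx
    refine (HasDerivAt.const_mul η ?_).add (((Real.hasDerivAt_log hx'.1.ne').sub_const _).const_mul ε)
    refine intervalIntegral.integral_hasDerivAt_right ?_ ?_ (hc.continuousAt (Ioo_mem_nhds hx'.1 hx'.2))
    · refine (hc.mono ?_).intervalIntegrable
      rw [uIcc_of_le hx.1]
      exact (Icc_subset_Icc_right hx.2).trans hIcc
    · exact hc.stronglyMeasurableAtFilter isOpen_Ioo x hx'
  have key := image_norm_le_of_norm_deriv_right_le_deriv_boundary' (f := fun x => w x - w t)
    (f' := w') (a := t) (b := t₁)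
    (fun x hx => ((hw x (hIcc hx)).sub_const _).continuousAt.continuousWithinAt)
    (fun x hx => ((hw x (hIcc ⟨hx.1, hx.2.le⟩)).sub_const _).hasDerivWithinAt)
    (by simp) (fun x hx => (hB x hx).continuousAt.continuousWithinAt)
    (fun x hx => (hB x ⟨hx.1, hx.2.le⟩).hasDerivWithinAt)
    (by
      intro x hx
      have hx0 : 0 < x := ht.1.trans_le hx.1
      have h1 : η * (x * w' x ^ 2) + ε * x⁻¹ - |w' x| =
          (x * |w' x| - 2 * ε) ^ 2 / (4 * ε * x) := by
        rw [← sq_abs (w' x), hη]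
        field_simp
        ring
      have h2 : 0 ≤ (x * |w' x| - 2 * ε) ^ 2 / (4 * ε * x) := by positivity
      rw [Real.norm_eq_abs]
      linarith) (right_mem_Icc.2 ht.2)
  have hI : ∫ s in t..t₁, s * w' s ^ 2 ≤ E := by
    rw [intervalIntegral.integral_of_le ht.2]
    refine setIntegral_mono_set hE ?_ (LE.le.eventuallyLE
      fun x hx => ⟨ht.1.trans hx.1, hx.2.trans_lt ht₁.2⟩)
    filter_upwards [ae_restrict_mem measurableSet_Ioo] with s hs
    have := hs.1
    simp only [Pi.zero_apply]
    positivity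
  have h3 : w t ≤ (w t₁ + η * E) + Real.log t₁ * ε + Real.log t * (-ε) := by
    rw [Real.norm_eq_abs] at key
    have h5 := (abs_le.1 key).1
    have := mul_le_mul_of_nonneg_left hI hηpos.le
    linarith
  rw [Real.rpow_def_of_pos ht.1, Real.rpow_def_of_pos ht₁.1, ← Real.exp_add, ← Real.exp_add]
  exact Real.exp_le_exp.2 h3

lemma abs_deriv_le_rpow {A t₁ δ β : ℝ} {w w' v : ℝ → ℝ} (ht₁ : t₁ ∈ Ioo 0 A)
    (hβ : 0 < β) (hβδ : β < δ / 2)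
    (hw : ∀ t ∈ Ioo 0 A, HasDerivAt w (w' t) t) (hw' : ContinuousOn w' (Ioo 0 A))
    (hE : IntegrableOn (fun t => t * w' t ^ 2) (Ioo 0 A))
    (hv : IntegrableOn (fun t => |v t| * t ^ (-δ / 2)) (Ioo 0 A))
    (hG : IntegrableOn (fun t => v t * Real.exp (w t)) (Ioo 0 A))
    (hflux : ∀ t ∈ Ioo 0 A, 4 * t * w' t = -∫ s in 0..t, v s * Real.exp (w s)) :
    ∃ C, 0 ≤ C ∧ ∀ t ∈ Ioc 0 t₁, |w' t| ≤ C * t ^ (β - 1) := by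
  obtain ⟨C, hC, hexp⟩ := exp_le_rpow_neg_of_integrableOn ht₁ (sub_pos.2 hβδ) hw hw' hE
  set M := ∫ s in Ioo 0 A, |v s| * s ^ (-δ / 2)
  have hM : 0 ≤ M := setIntegral_nonneg measurableSet_Ioo fun s hs => by
    have := hs.1
    positivity
  refine ⟨C * M / 4, by positivity, fun t ht => ?_⟩
  have hsub : Ioc 0 t ⊆ Ioo 0 A := fun s hs => ⟨hs.1, (hs.2.trans ht.2).trans_lt ht₁.2⟩
  have h1 : |∫ s in 0..t, v s * Real.exp (w s)| ≤ C * t ^ β * M := by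
    rw [intervalIntegral.integral_of_le ht.1.le]
    calc |∫ s in Ioc 0 t, v s * Real.exp (w s)|
        ≤ ∫ s in Ioc 0 t, |v s * Real.exp (w s)| := abs_integral_le_integral_abs
      _ ≤ ∫ s in Ioc 0 t, C * t ^ β * (|v s| * s ^ (-δ / 2)) := by
        refine setIntegral_mono_on (hG.mono_set hsub).abs ((hv.mono_set hsub).const_mul _)
          measurableSet_Ioc fun s hs => ?_
        have hs0 := hs.1
        rw [abs_mul, abs_of_pos (Real.exp_pos _)]
        have h2 := hexp s ⟨hs.1, hs.2.trans ht.2⟩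
        have h3 : s ^ (-(δ / 2 - β)) = s ^ (-δ / 2) * s ^ β := by
          rw [← Real.rpow_add hs0]; congr 1; ring
        have h4 : s ^ β ≤ t ^ β := Real.rpow_le_rpow hs0.le hs.2 hβ.le
        rw [h3] at h2
        calc |v s| * Real.exp (w s) ≤ |v s| * (C * (s ^ (-δ / 2) * s ^ β)) := by gcongr
          _ ≤ |v s| * (C * (s ^ (-δ / 2) * t ^ β)) := by gcongr
          _ = _ := by ring
      _ = C * t ^ β * ∫ s in Ioc 0 t, |v s| * s ^ (-δ / 2) := integral_const_mul _ _
      _ ≤ C * t ^ β * M := by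
        have := ht.1
        refine mul_le_mul_of_nonneg_left ?_ (by positivity)
        refine setIntegral_mono_set hv ?_ hsub.eventuallyLE
        filter_upwards [ae_restrict_mem measurableSet_Ioo] with s hs
        have := hs.1
        simp only [Pi.zero_apply]
        positivity
  have h5 := hflux t ⟨ht.1, ht.2.trans_lt ht₁.2⟩
  rw [← abs_neg, ← h5, abs_mul, abs_of_pos (by linarith [ht.1] : 0 < 4 * t)] at h1
  rw [Real.rpow_sub_one ht.1.ne']
  have ht0 := ht.1
  rw [show C * M / 4 * (t ^ β / t) = (C * t ^ β * M) / (4 * t) by field_simp, le_div_iff₀ (by positivity)]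
  linarith

lemma abs_rpow_sub_rpow_le {a b p : ℝ} (ha : 0 ≤ a) (hb : 0 ≤ b) (hp : 0 ≤ p) (hp1 : p ≤ 1) :
    |a ^ p - b ^ p| ≤ |a - b| ^ p := by
  wlog hab : b ≤ a generalizing a b
  · rw [abs_sub_comm, abs_sub_comm a b]
    exact this hb ha (le_of_not_ge hab)
  rw [abs_of_nonneg (sub_nonneg.2 hab), abs_of_nonneg (sub_nonneg.2 (Real.rpow_le_rpow hb hab hp))]
  have := Real.rpow_add_le_add_rpow (sub_nonneg.2 hab) hb hp hp1
  rw [sub_add_cancel] at this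
  linarith

/-- Power-type bounds on the derivative in `t = r²` give Hölder bounds in the radius `r`. -/
lemma abs_sub_le_of_abs_deriv_le_rpow {A t₁ α C : ℝ} {w w' : ℝ → ℝ} (ht₁ : t₁ ∈ Ioo 0 A)
    (hα : 0 < α) (hα1 : α ≤ 1) (hC : 0 ≤ C)
    (hw : ∀ t ∈ Ioo 0 A, HasDerivAt w (w' t) t)
    (hb : ∀ t ∈ Ioc 0 t₁, |w' t| ≤ C * t ^ (α / 2 - 1))
    {r s : ℝ} (hr : 0 < r) (hs : 0 < s) (hr₁ : r ^ 2 ≤ t₁) (hs₁ : s ^ 2 ≤ t₁) :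
    |w (r ^ 2) - w (s ^ 2)| ≤ 2 * C / α * |r - s| ^ α := by
  wlog hsr : s ≤ r generalizing r s
  · rw [abs_sub_comm, abs_sub_comm r s]
    exact this hs hr hs₁ hr₁ (le_of_not_ge hsr)
  have hIcc : Icc (s ^ 2) (r ^ 2) ⊆ Ioc 0 t₁ :=
    fun x hx => ⟨(by positivity : 0 < s ^ 2).trans_le hx.1, hx.2.trans hr₁⟩
  have hIoo : Icc (s ^ 2) (r ^ 2) ⊆ Ioo 0 A :=
    fun x hx => ⟨(hIcc hx).1, (hIcc hx).2.trans_lt ht₁.2⟩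
  have hB : ∀ x ∈ Icc (s ^ 2) (r ^ 2), HasDerivAt
      (fun x => 2 * C / α * (x ^ (α / 2) - (s ^ 2) ^ (α / 2)))
      (C * x ^ (α / 2 - 1)) x := by
    intro x hx
    refine (((Real.hasDerivAt_rpow_const (p := α / 2) (Or.inl (hIoo hx).1.ne')).sub_const
      ((s ^ 2) ^ (α / 2))).const_mul (2 * C / α)).congr_deriv ?_
    field_simp
  have key := image_norm_le_of_norm_deriv_right_le_deriv_boundary' (f := fun x => w x - w (s ^ 2))
    (f' := w') (a := s ^ 2) (b := r ^ 2)
    (fun x hx => ((hw x (hIoo hx)).sub_const _).continuousAt.continuousWithinAt)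
    (fun x hx => ((hw x (hIoo ⟨hx.1, hx.2.le⟩)).sub_const _).hasDerivWithinAt)
    (by simp) (fun x hx => (hB x hx).continuousAt.continuousWithinAt)
    (fun x hx => (hB x ⟨hx.1, hx.2.le⟩).hasDerivWithinAt)
    (fun x hx => hb x (hIcc ⟨hx.1, hx.2.le⟩))
    (right_mem_Icc.2 (pow_le_pow_left₀ hs.le hsr 2))
  have hpow : ∀ y : ℝ, 0 < y → (y ^ 2) ^ (α / 2) = y ^ α := fun y hy => by
    rw [← Real.rpow_natCast, ← Real.rpow_mul hy.le]; congr 1; push_cast; ring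
  simp only [hpow r hr, hpow s hs, Real.norm_eq_abs] at key
  refine key.trans (mul_le_mul_of_nonneg_left ?_ (by positivity))
  exact (le_abs_self _).trans (abs_rpow_sub_rpow_le hr.le hs.le hα.le hα1)

/-- The weak equation tested against radial functions, in the variable `t = ‖x‖ ^ 2`. -/
lemma weak_form_norm_sq {R : ℝ} (hR : 0 < R) {ψ g : R2 → ℝ} {w G : ℝ → ℝ}
    (hψ : ∀ x, ψ x = w (‖x‖ ^ 2)) (hg : ∀ x, g x = G (‖x‖ ^ 2))
    (hweak : ∀ φ : R2 → ℝ, ContDiff ℝ (⊤ : ℕ∞) φ → HasCompactSupport φ →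
      tsupport φ ⊆ ball (0 : R2) R →
      ∫ x in ball (0 : R2) R, ψ x * lap φ x = -∫ x in ball (0 : R2) R, g x * φ x)
    {h k k' : ℝ → ℝ} {b : ℝ} (hb : b < R ^ 2) (hcd : ContDiff ℝ ∞ h)
    (hh : ∀ t, HasDerivAt h (k t) t) (hk : ∀ t, HasDerivAt k (k' t) t)
    (hsupp : ∀ t, b < t → h t = 0) :
    ∫ t in Ioo 0 (R ^ 2), w t * (4 * (k t + t * k' t)) = -∫ t in Ioo 0 (R ^ 2), G t * h t := by
  have hts : tsupport (fun x : R2 => h (‖x‖ ^ 2)) ⊆ closedBall 0 (√b) := by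
    refine closure_minimal (fun x hx => ?_) isClosed_closedBall
    rw [mem_closedBall_zero_iff]
    by_contra hlt
    exact hx (hsupp _ ((Real.sqrt_lt' ((Real.sqrt_nonneg b).trans_lt (not_le.1 hlt))).1
      (not_le.1 hlt)))
  have hbR : √b < R := (Real.sqrt_lt' hR).2 hb
  have := hweak (fun x => h (‖x‖ ^ 2)) (hcd.comp (contDiff_norm_sq ℝ))
    ((isCompact_closedBall _ _).of_isClosed_subset (isClosed_tsupport _) hts)
    (hts.trans (closedBall_subset_ball hbR))
  simp_rw [lap_comp_norm_sq_s12 hh hk, hψ, hg] at this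
  rw [setIntegral_ball_comp_norm_sq hR (fun t => w t * (4 * (k t + t * k' t))),
    setIntegral_ball_comp_norm_sq hR (fun t => G t * h t), ← mul_neg] at this
  refine mul_left_cancel₀ (ENNReal.toReal_pos ?_ ?_).ne' this
  · exact (measure_ball_pos _ _ one_pos).ne'
  · exact measure_ball_lt_top.ne

lemma integral_mul_primitive {A : ℝ} (hA : 0 < A) {G h k : ℝ → ℝ} (hG : IntegrableOn G (Ioo 0 A))
    (hcd : ContDiff ℝ ∞ h) (hh : ∀ t, HasDerivAt h (k t) t) (hhA : h A = 0) :
    ∫ t in Ioo 0 A, G t * h t = -∫ t in Ioo 0 A, k t * ∫ s in 0..t, G s := by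
  have hGi : IntervalIntegrable G volume 0 A :=
    (intervalIntegrable_iff_integrableOn_Ioo_of_le hA.le).2 hG
  have hH := hGi.absolutelyContinuousOnInterval_intervalIntegral (left_mem_uIcc)
  have hh' : AbsolutelyContinuousOnInterval h 0 A :=
    (hcd.of_le (by simp)).contDiffOn.absolutelyContinuousOnInterval
  have key := hh'.integral_mul_deriv_eq_deriv_mul hH
  have hd : deriv h = k := funext fun t => (hh t).deriv
  rw [hhA, intervalIntegral.integral_same, hd] at key
  rw [← integral_Ioc_eq_integral_Ioo, ← integral_Ioc_eq_integral_Ioo,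
    ← intervalIntegral.integral_of_le hA.le, ← intervalIntegral.integral_of_le hA.le]
  have h2 : ∫ t in 0..A, G t * h t = ∫ t in 0..A, h t * deriv (fun x => ∫ v in 0..x, G v) t := by
    refine intervalIntegral.integral_congr_ae ?_
    filter_upwards [hGi.ae_hasDerivAt_integral] with t ht htA
    rw [(ht (uIoc_subset_uIcc htA) 0 left_mem_uIcc).deriv, mul_comm]
  rw [h2, key]
  ring

/-- The flux of a radial solution through a circle equals the integral of the source inside. -/
lemma flux_eq_neg_integral {R : ℝ} (hR : 0 < R) {ψ g : R2 → ℝ} {w w' G : ℝ → ℝ}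
    (hψ : ∀ x, ψ x = w (‖x‖ ^ 2)) (hg : ∀ x, g x = G (‖x‖ ^ 2))
    (hweak : ∀ φ : R2 → ℝ, ContDiff ℝ (⊤ : ℕ∞) φ → HasCompactSupport φ →
      tsupport φ ⊆ ball (0 : R2) R →
      ∫ x in ball (0 : R2) R, ψ x * lap φ x = -∫ x in ball (0 : R2) R, g x * φ x)
    (hw : ∀ t ∈ Ioo 0 (R ^ 2), HasDerivAt w (w' t) t) (hw' : ContinuousOn w' (Ioo 0 (R ^ 2)))
    (hG : IntegrableOn G (Ioo 0 (R ^ 2))) {t : ℝ} (ht : t ∈ Ioo 0 (R ^ 2)) :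
    4 * t * w' t = -∫ s in 0..t, G s := by
  set A := R ^ 2
  have hA : 0 < A := by positivity
  have hH : ContinuousOn (fun t => ∫ s in 0..t, G s) (Ioo 0 A) := by
    have hGi : IntervalIntegrable G volume 0 A :=
      (intervalIntegrable_iff_integrableOn_Ioo_of_le hA.le).2 hG
    refine (hGi.absolutelyContinuousOnInterval_intervalIntegral left_mem_uIcc).continuousOn.mono ?_
    rw [uIcc_of_le hA.le]
    exact Ioo_subset_Icc_self
  have hcont : ContinuousOn (fun t => 4 * t * w' t + ∫ s in 0..t, G s) (Ioo 0 A) := by fun_prop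
  suffices h : EqOn (fun t => 4 * t * w' t + ∫ s in 0..t, G s) 0 (Ioo 0 A) by
    have := h ht
    simp only [Pi.zero_apply] at this
    linarith
  refine Measure.eqOn_open_of_ae_eq (μ := volume) ?_ isOpen_Ioo hcont continuousOn_const
  refine (ae_restrict_iff' measurableSet_Ioo).2 ?_
  refine isOpen_Ioo.ae_eq_zero_of_integral_contDiff_smul_eq_zero
    (hcont.locallyIntegrableOn measurableSet_Ioo) fun k hkcd hkc hks => ?_
  obtain ⟨ε, hε, hεsub⟩ := IsCompact.exists_cthickening_subset_open hkc isOpen_Ioo hks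
  set a := min ε (A / 3)
  have ha : 0 < a := by positivity
  have haA : a ≤ A / 3 := min_le_right _ _
  set b := A - a
  have hab : a ≤ b := by simp only [b]; linarith
  have hk0 : ∀ t ∈ tsupport k, t ∈ Ioo a b := by
    intro t h1
    have h2 : ∀ s, dist s t ≤ ε → s ∈ Ioo 0 A := fun s hs =>
      hεsub (mem_cthickening_of_dist_le s t ε _ h1 hs)
    have h3 := (h2 (t - ε) (by simp [abs_of_pos hε])).1
    have h4 := (h2 (t + ε) (by simp [abs_of_pos hε])).2
    have h5 : a ≤ ε := min_le_left _ _
    exact ⟨by linarith, by simp only [b]; linarith⟩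
  have hkz : ∀ t, t ∉ Ioo a b → k t = 0 := fun t ht => by
    by_contra h
    exact ht (hk0 t (subset_tsupport k h))
  set h : ℝ → ℝ := fun t => ∫ s in b..t, k s
  have hkcont := hkcd.continuous
  have hh : ∀ t, HasDerivAt h (k t) t := fun t =>
    intervalIntegral.integral_hasDerivAt_right (hkcont.intervalIntegrable _ _)
      (hkcont.stronglyMeasurableAtFilter _ _) hkcont.continuousAt
  have hhcd : ContDiff ℝ ∞ h := by
    rw [contDiff_infty_iff_deriv]
    refine ⟨fun t => (hh t).differentiableAt, ?_⟩
    rwa [funext fun t => (hh t).deriv]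
  have hk : ∀ t, HasDerivAt k (deriv k t) t := fun t =>
    ((hkcd.differentiable (by simp)) t).hasDerivAt
  have hk'cont : Continuous (deriv k) := hkcd.continuous_deriv (by simp)
  have hhz : ∀ t, b ≤ t → h t = 0 := fun t ht => by
    simp only [h]
    rw [intervalIntegral.integral_congr (g := fun _ => (0 : ℝ)), intervalIntegral.integral_zero]
    intro s hs
    rw [uIcc_of_le ht] at hs
    exact hkz s fun h => h.2.not_ge hs.1
  have hbA : b < A := by simp only [b]; linarith
  have hweak' := weak_form_norm_sq hR hψ hg hweak hbA hhcd hh hk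
    (fun t ht => hhz t ht.le)
  rw [integral_mul_primitive hA hG hhcd hh (hhz A hbA.le), neg_neg] at hweak'
  have hsub : Icc a b ⊆ Ioo 0 A := fun x hx => ⟨ha.trans_le hx.1, hx.2.trans_lt hbA⟩
  have hsub' : Ioo a b ⊆ Ioo 0 A := Ioo_subset_Icc_self.trans hsub
  have hparts := intervalIntegral.integral_mul_deriv_eq_deriv_mul (a := a) (b := b)
    (u := w) (u' := w') (v := fun t => 4 * (t * k t)) (v' := fun t => 4 * (1 * k t + t * deriv k t))
    (fun x hx => hw x (hsub (by rwa [uIcc_of_le hab] at hx)))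
    (fun x _ => ((hasDerivAt_id x).mul (hk x)).const_mul 4)
    (ContinuousOn.intervalIntegrable (hw'.mono (by rwa [uIcc_of_le hab])))
    (Continuous.intervalIntegrable (by fun_prop) _ _)
  rw [hkz a (by simp), hkz b (by simp)] at hparts
  have hrestr : ∀ f : ℝ → ℝ, (∀ t, t ∉ Ioo a b → f t = 0) →
      ∫ t in Ioo 0 A, f t = ∫ t in a..b, f t := by
    intro f hf
    rw [intervalIntegral.integral_of_le hab, integral_Ioc_eq_integral_Ioo]
    exact setIntegral_eq_of_subset_of_forall_sdiff_eq_zero measurableSet_Ioo hsub'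
      fun x hx => hf x hx.2
  have hdkz : ∀ t, t ∉ Ioo a b → deriv k t = 0 := fun t ht => by
    by_contra hne
    exact ht (hk0 t (support_deriv_subset hne))
  rw [hrestr _ fun t ht => by simp [hkz t ht, hdkz t ht]] at hweak'
  rw [hrestr _ fun t ht => by simp [hkz t ht]] at hweak'
  have hfull : ∫ t, k t • (4 * t * w' t + ∫ s in 0..t, G s) =
      ∫ t in a..b, k t • (4 * t * w' t + ∫ s in 0..t, G s) := by
    rw [intervalIntegral.integral_of_le hab, integral_Ioc_eq_integral_Ioo]
    exact (setIntegral_eq_integral_of_forall_compl_eq_zero fun x hx => by simp [hkz x hx]).symm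
  have hii : ∀ f : ℝ → ℝ, ContinuousOn f (Ioo 0 A) → IntervalIntegrable f volume a b :=
    fun f hf => ContinuousOn.intervalIntegrable (hf.mono (by rwa [uIcc_of_le hab]))
  have hsplit : ∫ t in a..b, k t • (4 * t * w' t + ∫ s in 0..t, G s) =
      (∫ t in a..b, w' t * (4 * (t * k t))) + ∫ t in a..b, k t * ∫ s in 0..t, G s := by
    rw [← intervalIntegral.integral_add (hii _ (by fun_prop)) (hii _ (by fun_prop))]
    refine intervalIntegral.integral_congr fun t _ => ?_
    simp only [smul_eq_mul]
    ring
  rw [hfull, hsplit, ← hweak']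
  simp only [one_mul] at hparts
  rw [hparts]
  ring

lemma norm_gradient_sq_eq {ψ : R2 → ℝ} {w : ℝ → ℝ} (hψ : ∀ x, ψ x = w (‖x‖ ^ 2)) {x : R2}
    {d : ℝ} (hw : HasDerivAt w d (‖x‖ ^ 2)) :
    ‖gradient ψ x‖ ^ 2 = 4 * (‖x‖ ^ 2 * d ^ 2) := by
  have h1 := hw.comp_hasFDerivAt x (hasStrictFDerivAt_norm_sq x).hasFDerivAt
  have h2 : HasGradientAt ψ ((2 * d) • x) x := by
    rw [hasGradientAt_iff_hasFDerivAt]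
    refine (h1.congr_of_eventuallyEq (Eventually.of_forall hψ)).congr_fderiv ?_
    ext z
    simp
    ring
  rw [h2.gradient, norm_smul, mul_pow, Real.norm_eq_abs, sq_abs]
  ring

/-- A Hölder estimate in the radius away from the origin extends to the continuous extension. -/
lemma holderOnWith_closedBall {ψ : R2 → ℝ} {w : ℝ → ℝ} {L ρ C : ℝ} {α : ℝ≥0}
    (hα : 0 < α) (hC : 0 ≤ C)
    (hψ : ∀ x, ψ x = w (‖x‖ ^ 2)) (hL : Tendsto (fun r => w (r ^ 2)) (𝓝[>] 0) (𝓝 L))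
    (hb : ∀ r s, 0 < r → 0 < s → r ≤ ρ → s ≤ ρ →
      |w (r ^ 2) - w (s ^ 2)| ≤ C * |r - s| ^ (α : ℝ)) :
    HolderOnWith C.toNNReal α (fun x => if x = 0 then L else ψ x) (closedBall 0 ρ) := by
  have hα' : (0 : ℝ) < α := hα
  have h0 : ∀ r, 0 < r → r ≤ ρ → |w (r ^ 2) - L| ≤ C * |r| ^ (α : ℝ) := by
    intro r hr hrρ
    have hlim : Tendsto (fun s => C * |r - s| ^ (α : ℝ)) (𝓝[>] 0) (𝓝 (C * |r - 0| ^ (α : ℝ))) := by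
      refine Tendsto.mono_left (Continuous.tendsto ?_ 0) nhdsWithin_le_nhds
      exact continuous_const.mul ((continuous_const.sub continuous_id).abs.rpow_const
        fun _ => Or.inr hα'.le)
    rw [sub_zero] at hlim
    refine le_of_tendsto_of_tendsto (tendsto_const_nhds.sub hL).abs hlim ?_
    filter_upwards [Ioo_mem_nhdsGT (hr.trans_le hrρ)] with s hs
    exact hb r s hr hs.1 hrρ hs.2.le
  have key : ∀ x ∈ closedBall (0 : R2) ρ, ∀ y ∈ closedBall (0 : R2) ρ,
      |(if x = 0 then L else ψ x) - (if y = 0 then L else ψ y)| ≤ C * |‖x‖ - ‖y‖| ^ (α : ℝ) := by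
    intro x hx y hy
    rw [mem_closedBall_zero_iff] at hx hy
    by_cases hx0 : x = 0 <;> by_cases hy0 : y = 0
    · simp [hx0, hy0, hα'.ne']
    · simp only [hx0, hy0, if_true, if_false, norm_zero, zero_sub, abs_neg, hψ]
      rw [abs_sub_comm]
      exact h0 _ (norm_pos_iff.2 hy0) hy
    · simp only [hx0, hy0, if_true, if_false, norm_zero, sub_zero, hψ]
      exact h0 _ (norm_pos_iff.2 hx0) hx
    · simp only [hx0, hy0, if_false, hψ]
      exact hb _ _ (norm_pos_iff.2 hx0) (norm_pos_iff.2 hy0) hx hy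
  intro x hx y hy
  rw [edist_dist, edist_dist, Real.dist_eq, ENNReal.ofReal_rpow_of_nonneg dist_nonneg hα'.le,
    ← ENNReal.ofReal, ← ENNReal.ofReal_mul hC]
  refine ENNReal.ofReal_le_ofReal ((key x hx y hy).trans (mul_le_mul_of_nonneg_left ?_ hC))
  exact Real.rpow_le_rpow (abs_nonneg _) (by rw [dist_eq_norm]; exact abs_norm_sub_norm_le x y)
    hα'.le

lemma exists_tendsto_of_abs_sub_le_rpow {f : ℝ → ℝ} {ρ C α : ℝ} (hρ : 0 < ρ) (hα : 0 < α)
    (hb : ∀ r s, 0 < r → 0 < s → r ≤ ρ → s ≤ ρ → |f r - f s| ≤ C * |r - s| ^ α) :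
    ∃ L, Tendsto f (𝓝[>] 0) (𝓝 L) := by
  refine cauchy_map_iff_exists_tendsto.1 ?_
  refine cauchy_map_iff.2 ⟨inferInstance, ?_⟩
  rw [Metric.uniformity_basis_dist.tendsto_right_iff]
  intro ε hε
  have hlim : Tendsto (fun p : ℝ × ℝ => C * |p.1 - p.2| ^ α) (𝓝[>] 0 ×ˢ 𝓝[>] 0) (𝓝 0) := by
    have h1 : Continuous fun p : ℝ × ℝ => C * |p.1 - p.2| ^ α :=
      continuous_const.mul ((continuous_fst.sub continuous_snd).abs.rpow_const
        fun _ => Or.inr hα.le)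
    have h2 := h1.tendsto (0, 0)
    rw [nhds_prod_eq] at h2
    simp only [sub_self, abs_zero, Real.zero_rpow hα.ne', mul_zero] at h2
    exact h2.mono_left (Filter.prod_mono nhdsWithin_le_nhds nhdsWithin_le_nhds)
  have hmem := Ioo_mem_nhdsGT hρ
  filter_upwards [hlim.eventually_lt_const hε, prod_mem_prod hmem hmem] with p hp hp'
  exact (hb _ _ hp'.1.1 hp'.2.1 hp'.1.2.le hp'.2.2.le).trans_lt hp

end

/-- Proposition 2.2: Hölder regularity of radially symmetric solutions. -/
theorem holder_regularity (R δ : ℝ) (hR : 0 < R) (hδ : 0 < δ)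
    (V : R2 → ℝ) (hVrad : RadSym V)
    (hVint : IntegrableOn (fun x : R2 => |V x| * ‖x‖ ^ (-δ)) (ball (0:R2) R))
    (ψ : R2 → ℝ) (hψrad : RadSym ψ)
    (hψC1 : ContDiffOn ℝ 1 ψ (ball (0:R2) R \ {0}))
    (hψgrad : IntegrableOn (fun x : R2 => ‖gradient ψ x‖ ^ 2)
      (ball (0:R2) R \ {0}))
    (hVeψ : IntegrableOn (fun x : R2 => V x * Real.exp (ψ x)) (ball (0:R2) R))
    (hweak : ∀ φ : R2 → ℝ, ContDiff ℝ (⊤ : ℕ∞) φ → HasCompactSupport φ →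
      tsupport φ ⊆ ball (0:R2) R →
      ∫ x in ball (0:R2) R, ψ x * lap φ x =
        -∫ x in ball (0:R2) R, V x * Real.exp (ψ x) * φ x) :
    ∃ ψt : R2 → ℝ, ContinuousOn ψt (ball (0:R2) R) ∧
      (∀ x ∈ ball (0:R2) R \ {0}, ψt x = ψ x) ∧
      (1 < δ → ∀ K : Set R2, K ⊆ ball (0:R2) R → IsCompact K →
        ∃ L : ℝ≥0, LipschitzOnWith L ψt K) ∧
      (δ ≤ 1 → ∀ α : ℝ≥0, 0 < α → (α : ℝ) < δ →
        ∀ K : Set R2, K ⊆ ball (0:R2) R → IsCompact K →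
          ∃ Ch : ℝ≥0, HolderOnWith Ch α ψt K) := by
  set e : R2 := EuclideanSpace.single 0 1
  have he : ∀ t : ℝ, 0 ≤ t → ‖√t • e‖ = √t := fun t _ => by
    simp [e, norm_smul, abs_of_nonneg (Real.sqrt_nonneg t)]
  have hrad : ∀ f : R2 → ℝ, RadSym f → ∀ x, f x = f (√(‖x‖ ^ 2) • e) := fun f hf x =>
    hf _ _ (by rw [he _ (sq_nonneg _), Real.sqrt_sq (norm_nonneg x)])
  set w : ℝ → ℝ := fun t => ψ (√t • e)
  set v : ℝ → ℝ := fun t => V (√t • e)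
  have hψw : ∀ x, ψ x = w (‖x‖ ^ 2) := hrad ψ hψrad
  have hVv : ∀ x, V x = v (‖x‖ ^ 2) := hrad V hVrad
  have hA : 0 < R ^ 2 := by positivity
  have hwC1 : ContDiffOn ℝ 1 w (Set.Ioo 0 (R ^ 2)) := by
    have hsqrt : ContDiffOn ℝ 1 (fun t => √t) (Set.Ioo 0 (R ^ 2)) := fun t ht =>
      (Real.contDiffAt_sqrt ht.1.ne').contDiffWithinAt
    refine hψC1.comp (hsqrt.fun_smul contDiffOn_const) fun t ht => ?_
    · have h1 := he t ht.1.le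
      refine ⟨?_, ?_⟩
      · rw [mem_ball_zero_iff, h1]
        exact (Real.sqrt_lt' hR).2 ht.2
      · intro h
        rw [Set.mem_singleton_iff.1 h, norm_zero] at h1
        exact (Real.sqrt_pos.2 ht.1).ne h1
  have hw : ∀ t ∈ Set.Ioo 0 (R ^ 2), HasDerivAt w (deriv w t) t := fun t ht =>
    ((hwC1.differentiableOn (by simp)).differentiableAt (isOpen_Ioo.mem_nhds ht)).hasDerivAt
  have hw' : ContinuousOn (deriv w) (Set.Ioo 0 (R ^ 2)) :=
    hwC1.continuousOn_deriv_of_isOpen isOpen_Ioo le_rfl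
  have hE : IntegrableOn (fun t => t * deriv w t ^ 2) (Set.Ioo 0 (R ^ 2)) := by
    rw [← integrableOn_ball_comp_norm_sq hR]
    have h1 : IntegrableOn (fun x => ‖gradient ψ x‖ ^ 2) (ball (0 : R2) R) := by
      refine hψgrad.congr_set_ae ?_
      exact (sdiff_null_ae_eq_self (measure_singleton 0)).symm
    refine (h1.div_const 4).congr ?_
    filter_upwards [ae_restrict_mem measurableSet_ball,
      (Measure.ae_ne (volume.restrict (ball (0 : R2) R)) 0)] with x hx hx0
    have hx' : ‖x‖ ^ 2 ∈ Set.Ioo 0 (R ^ 2) := by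
      have := norm_pos_iff.2 hx0
      exact ⟨by positivity, (sq_lt_sq₀ (norm_nonneg x) hR.le).2 (mem_ball_zero_iff.1 hx)⟩
    rw [norm_gradient_sq_eq hψw (hw _ hx')]
    ring
  have hv : IntegrableOn (fun t => |v t| * t ^ (-δ / 2)) (Set.Ioo 0 (R ^ 2)) := by
    rw [← integrableOn_ball_comp_norm_sq hR]
    refine hVint.congr (Eventually.of_forall fun x => ?_)
    simp only [hVv x]
    rw [← Real.rpow_natCast ‖x‖ 2, ← Real.rpow_mul (norm_nonneg x)]
    congr 2
    push_cast
    ring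
  have hG : IntegrableOn (fun t => v t * Real.exp (w t)) (Set.Ioo 0 (R ^ 2)) := by
    rw [← integrableOn_ball_comp_norm_sq hR]
    exact hVeψ.congr (Eventually.of_forall fun x => by simp only [hVv x, hψw x])
  have hflux : ∀ t ∈ Set.Ioo 0 (R ^ 2),
      4 * t * deriv w t = -∫ s in 0..t, v s * Real.exp (w s) := fun t ht =>
    flux_eq_neg_integral hR hψw (g := fun x => V x * Real.exp (ψ x))
      (G := fun t => v t * Real.exp (w t)) (fun x => by simp only [hVv x, hψw x])
      hweak hw hw' hG ht
  have hbound : ∀ α : ℝ, 0 < α → α ≤ 1 → α < δ → ∀ ρ, 0 < ρ → ρ < R → ∃ C, 0 ≤ C ∧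
      ∀ r s, 0 < r → 0 < s → r ≤ ρ → s ≤ ρ → |w (r ^ 2) - w (s ^ 2)| ≤ C * |r - s| ^ α := by
    intro α hα hα1 hαδ ρ hρ hρR
    have ht₁ : ρ ^ 2 ∈ Set.Ioo 0 (R ^ 2) := ⟨by positivity, (sq_lt_sq₀ hρ.le hR.le).2 hρR⟩
    obtain ⟨C, hC, hCb⟩ := abs_deriv_le_rpow ht₁ (half_pos hα) (by linarith) hw hw' hE hv hG hflux
    exact ⟨2 * C / α, by positivity, fun r s hr hs hrρ hsρ =>
      abs_sub_le_of_abs_deriv_le_rpow ht₁ hα hα1 hC hw hCb hr hs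
        (pow_le_pow_left₀ hr.le hrρ 2) (pow_le_pow_left₀ hs.le hsρ 2)⟩
  set α₀ : ℝ := min δ 1 / 2
  have hmin : 0 < min δ 1 := lt_min hδ one_pos
  have hα₀ : 0 < α₀ := half_pos hmin
  have hα₀1 : α₀ ≤ 1 := (half_le_self hmin.le).trans (min_le_right _ _)
  have hα₀δ : α₀ < δ := (half_lt_self hmin).trans_le (min_le_left _ _)
  obtain ⟨L, hL⟩ : ∃ L, Tendsto (fun r => w (r ^ 2)) (nhdsWithin 0 (Set.Ioi 0)) (nhds L) := by
    obtain ⟨C, -, hC⟩ := hbound α₀ hα₀ hα₀1 hα₀δ (R / 2) (by positivity) (by linarith)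
    exact exists_tendsto_of_abs_sub_le_rpow (by positivity : 0 < R / 2) hα₀ hC
  have hholder : ∀ α : ℝ≥0, 0 < α → (α : ℝ) ≤ 1 → (α : ℝ) < δ → ∀ ρ, 0 < ρ → ρ < R →
      ∃ C : ℝ≥0, HolderOnWith C α (fun x => if x = 0 then L else ψ x) (closedBall 0 ρ) := by
    intro α hα hα1 hαδ ρ hρ hρR
    obtain ⟨C, hC, hCb⟩ := hbound α hα hα1 hαδ ρ hρ hρR
    exact ⟨_, holderOnWith_closedBall hα hC hψw hL hCb⟩
  have hcompact : ∀ K : Set R2, K ⊆ ball (0 : R2) R → IsCompact K →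
      ∃ ρ, 0 < ρ ∧ ρ < R ∧ K ⊆ closedBall 0 ρ := by
    intro K hK hKc
    obtain ⟨ρ, hρ, hKρ⟩ := exists_pos_lt_subset_ball hR hKc.isClosed hK
    exact ⟨ρ, hρ.1, hρ.2, hKρ.trans ball_subset_closedBall⟩
  refine ⟨fun x => if x = 0 then L else ψ x, ?_, fun x hx => if_neg hx.2, ?_, ?_⟩
  · intro x hx
    rw [mem_ball_zero_iff] at hx
    obtain ⟨ρ, hρ, hρR⟩ := exists_between hx
    obtain ⟨C, hC⟩ := hholder ⟨α₀, hα₀.le⟩ hα₀ hα₀1 hα₀δ ρ ((norm_nonneg x).trans_lt hρ) hρR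
    have h1 := hC.continuousOn hα₀ x (mem_closedBall_zero_iff.2 hρ.le)
    refine (h1.continuousAt ?_).continuousWithinAt
    exact mem_of_superset (isOpen_ball.mem_nhds (mem_ball_zero_iff.2 hρ)) ball_subset_closedBall
  · intro hδ1 K hK hKc
    obtain ⟨ρ, hρ, hρR, hKρ⟩ := hcompact K hK hKc
    obtain ⟨C, hC⟩ := hholder 1 one_pos le_rfl hδ1 ρ hρ hρR
    exact ⟨C, holderOnWith_one.1 (hC.mono hKρ)⟩
  · intro hδ1 α hα hαδ K hK hKc
    obtain ⟨ρ, hρ, hρR, hKρ⟩ := hcompact K hK hKc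
    obtain ⟨C, hC⟩ := hholder α hα (hαδ.le.trans hδ1) hαδ ρ hρ hρR
    exact ⟨C, hC.mono hKρ⟩
end
end

section
/- Logarithmic asymptotics of solutions (Lemma 2.4). Let V, ψ : ℝ² → ℝ be locally integrable and set f := V·e^{ψ}. Assume f is integrable on ℝ² and |f|^p is integrable for some p>1, and that ψ is a weak solution of -Δψ = f on ℝ². Assume either (i) ψ is bounded above almost everywhere and ∫_{ℝ²} f dx ≥ 0, or (ii) ψ is bounded below almost everywhere and ∫_{ℝ²} f dx ≤ 0. Then ψ has a continuous representative ψ̃ (i.e. ψ = ψ̃ a.e.) satisfying ψ̃(x)/log‖x‖ → -(∫_{ℝ²} f dx)/(2π) as ‖x‖ → ∞. If in addition ∫_{ℝ²} |V(y)|·e^{ψ(y)}·log(‖y‖+1) dy < ∞, then there is a constant C>0 such that, writing m := ∫_{ℝ²} f dx, one has -(m/(2π))·log(‖x‖+1) - C ≤ ψ(x) ≤ -(m/(2π))·log(‖x‖+1) + C for a.e. x ∈ ℝ². -/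
open MeasureTheory Real Filter Bornology Metric
open scoped NNReal

noncomputable section

abbrev stdVec (i : Fin 2) : R2 := EuclideanSpace.single i 1

lemma lap_eq_sum_fderiv {φ : R2 → ℝ} (hφ : ContDiff ℝ 2 φ) (x : R2) :
    lap φ x = ∑ i, fderiv ℝ (fun y => fderiv ℝ φ y (stdVec i)) x (stdVec i) := by
  refine Finset.sum_congr rfl fun i _ => ?_
  have hd : DifferentiableAt ℝ (fderiv ℝ φ) x :=
    ((hφ.fderiv_right (m := 1) le_rfl).differentiable one_ne_zero) x
  rw [iteratedFDeriv_two_apply, fderiv_clm_apply hd (differentiableAt_const _)]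
  simp

lemma continuous_lap {φ : R2 → ℝ} (hφ : ContDiff ℝ 2 φ) : Continuous (lap φ) := by
  refine continuous_finsetSum _ fun i _ => ?_
  exact (hφ.continuous_iteratedFDeriv le_rfl).eval_const _

lemma hasCompactSupport_lap {φ : R2 → ℝ} (hs : HasCompactSupport φ) :
    HasCompactSupport (lap φ) := by
  refine (hs.iteratedFDeriv (𝕜 := ℝ) 2).mono fun x hx => ?_
  contrapose! hx
  simp only [Function.mem_support, not_not] at hx ⊢
  simp [lap, hx]

lemma lap_comp_add_right (φ : R2 → ℝ) (a x : R2) :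
    lap (fun y => φ (y + a)) x = lap φ (x + a) := by
  simp only [lap, iteratedFDeriv_comp_add_right]

lemma lap_comp_const_sub {φ : R2 → ℝ} (hφ : ContDiff ℝ 2 φ) (a x : R2) :
    lap (fun y => φ (a - y)) x = lap φ (a - x) := by
  have hφ' : ContDiff ℝ 2 (fun y => φ (a - y)) := hφ.comp (contDiff_const.sub contDiff_id)
  have key {f : R2 → ℝ} (hf : Differentiable ℝ f) (y v : R2) :
      fderiv ℝ (fun z => f (a - z)) y v = -fderiv ℝ f (a - y) v := by
    have h := (hf (a - y)).hasFDerivAt.comp y ((hasFDerivAt_id y).const_sub a)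
    have h' : HasFDerivAt (fun z => f (a - z)) _ y := h
    rw [h'.fderiv]
    simp
  have hd (i : Fin 2) : Differentiable ℝ fun y => fderiv ℝ φ y (stdVec i) :=
    ((hφ.fderiv_right (m := 1) le_rfl).clm_apply contDiff_const).differentiable one_ne_zero
  rw [lap_eq_sum_fderiv hφ', lap_eq_sum_fderiv hφ]
  refine Finset.sum_congr rfl fun i _ => ?_
  simp only [key (hφ.differentiable two_ne_zero)]
  rw [fderiv_fun_neg]
  simp [key (hd i)]

open ContinuousLinearMap in
lemma fderiv_convolution_apply {ρ h : R2 → ℝ} (hs : HasCompactSupport ρ) (hρ : ContDiff ℝ 1 ρ)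
    (hh : LocallyIntegrable h) (x v : R2) :
    fderiv ℝ (convolution ρ h (lsmul ℝ ℝ) volume) x v =
      convolution (fun y => fderiv ℝ ρ y v) h (lsmul ℝ ℝ) volume x := by
  rw [(hs.hasFDerivAt_convolution_left (lsmul ℝ ℝ) hρ hh x).fderiv]
  simp only [convolution]
  rw [ContinuousLinearMap.integral_apply]
  · simp
  · exact (hs.fderiv (𝕜 := ℝ)).convolutionExists_left _ (hρ.continuous_fderiv one_ne_zero) hh x

open ContinuousLinearMap in
lemma lap_convolution {ρ h : R2 → ℝ} (hs : HasCompactSupport ρ) (hρ : ContDiff ℝ 2 ρ)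
    (hh : LocallyIntegrable h) (x : R2) :
    lap (convolution ρ h (lsmul ℝ ℝ) volume) x = ∫ y, h y * lap (fun z => ρ (x - z)) y := by
  have hρ1 : ContDiff ℝ 1 ρ := hρ.of_le one_le_two
  have hρ' (i : Fin 2) : ContDiff ℝ 1 fun y => fderiv ℝ ρ y (stdVec i) :=
    (hρ.fderiv_right (m := 1) le_rfl).clm_apply contDiff_const
  have hs' (i : Fin 2) : HasCompactSupport fun y => fderiv ℝ ρ y (stdVec i) :=
    hs.fderiv_apply (𝕜 := ℝ) _
  rw [lap_eq_sum_fderiv (hs.contDiff_convolution_left (n := 2) _ hρ hh)]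
  have h1 (i : Fin 2) : (fun y => fderiv ℝ (convolution ρ h (lsmul ℝ ℝ) volume) y (stdVec i)) =
      convolution (fun y => fderiv ℝ ρ y (stdVec i)) h (lsmul ℝ ℝ) volume :=
    funext fun y => fderiv_convolution_apply hs hρ1 hh y _
  simp only [h1, fderiv_convolution_apply (hs' _) (hρ' _) hh,
    lap_comp_const_sub hρ, lap_eq_sum_fderiv hρ, convolution_lsmul_swap, smul_eq_mul]
  rw [← integral_finsetSum]
  · simp only [Finset.mul_sum, mul_comm]
  · intro i _
    exact (((hs' i).fderiv_apply (𝕜 := ℝ) _).convolutionExists_left (lsmul ℝ ℝ)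
      (((hρ' i).continuous_fderiv one_ne_zero).clm_apply continuous_const) hh x).integrable_swap

open InnerProductSpace Laplacian in
lemma harmonicAt_comp_orthonormalBasisOneI {u : R2 → ℝ} (hu : ContDiff ℝ 2 u)
    (hlap : ∀ x, lap u x = 0) (z : ℂ) :
    HarmonicAt (u ∘ Complex.orthonormalBasisOneI.repr) z := by
  set e : ℂ →L[ℝ] R2 :=
    Complex.orthonormalBasisOneI.repr.toContinuousLinearEquiv.toContinuousLinearMap
  have he0 : e 1 = stdVec 0 := by
    have h := Complex.orthonormalBasisOneI.repr_self 0
    simp only [Complex.coe_orthonormalBasisOneI] at h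
    exact h
  have he1 : e Complex.I = stdVec 1 := by
    have h := Complex.orthonormalBasisOneI.repr_self 1
    simp only [Complex.coe_orthonormalBasisOneI] at h
    exact h
  refine ⟨(hu.comp e.contDiff).contDiffAt, Eventually.of_forall fun w => ?_⟩
  have hD : (Δ (u ∘ e)) w = lap u (e w) := by
    rw [laplacian_eq_iteratedFDeriv_complexPlane]
    simp only [e.iteratedFDeriv_comp_right hu w le_rfl, lap, Fin.sum_univ_two,
      ContinuousMultilinearMap.compContinuousLinearMap_apply]
    congr 2 <;> ext i <;> fin_cases i <;> simp [he0, he1]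
  exact hD.trans (hlap _)

lemma tendsto_log_add_div_sub_atTop (A B k r : ℝ) :
    Tendsto (fun R : ℝ => 2 * (A + B * Real.log (R + k)) * r / (R - r)) atTop (nhds 0) := by
  have h1 : (fun R : ℝ => A + B * Real.log (R + k)) =o[atTop] fun R : ℝ => R := by
    refine (Asymptotics.isLittleO_const_id_atTop A).add (Asymptotics.IsLittleO.const_mul_left ?_ B)
    have h2 : Tendsto (fun R : ℝ => R + k) atTop atTop := tendsto_atTop_add_const_right _ k tendsto_id
    refine (Real.isLittleO_log_id_atTop.comp_tendsto h2).trans_isBigO ?_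
    refine (Asymptotics.isBigO_refl _ _).add (Asymptotics.isLittleO_const_id_atTop k).isBigO
  have h3 : (fun R : ℝ => R) =O[atTop] fun R : ℝ => R - r := by
    refine Asymptotics.IsBigO.of_bound 2 ?_
    filter_upwards [eventually_ge_atTop (2 * |r|)] with R hR
    have := le_abs_self r
    have := abs_nonneg r
    rw [Real.norm_eq_abs, Real.norm_eq_abs, abs_of_nonneg (by linarith), abs_of_nonneg (by linarith)]
    linarith
  have := ((h1.trans_isBigO h3).tendsto_div_nhds_zero).const_mul (2 * r)
  rw [mul_zero] at this
  refine this.congr fun R => ?_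
  ring

lemma eq_of_harmonic_of_le_log {u : R2 → ℝ} (hu : ContDiff ℝ 2 u) (hlap : ∀ x, lap u x = 0)
    {A B : ℝ} (hB : 0 ≤ B) (hle : ∀ x, u x ≤ A + B * Real.log (‖x‖ + 3)) (x : R2) :
    u x = u 0 := by
  obtain ⟨F, hF, hFu⟩ := InnerProductSpace.HarmonicOnNhd.exists_analyticOnNhd_univ_re_eq
    (fun z _ => harmonicAt_comp_orthonormalBasisOneI hu hlap z)
  have hre (z : ℂ) : (F z).re = u (Complex.orthonormalBasisOneI.repr z) := congrFun hFu z
  have hdiff : Differentiable ℂ F := fun z => (hF z trivial).differentiableAt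
  obtain ⟨z, rfl⟩ := Complex.orthonormalBasisOneI.repr.surjective x
  suffices hzero : F z - F 0 = 0 by
    have := congrArg Complex.re hzero
    simpa [hre, sub_eq_zero] using this
  set A' : ℝ := |A| + |u 0| + 1
  have hbound (R : ℝ) (hR : ‖z‖ < R) :
      ‖F z - F 0‖ ≤ 2 * (A' + B * Real.log (R + 3)) * ‖z‖ / (R - ‖z‖) := by
    have hR0 : 0 < R := (norm_nonneg z).trans_lt hR
    have hlog : 0 ≤ B * Real.log (R + 3) := mul_nonneg hB (Real.log_nonneg (by linarith))
    refine Complex.borelCaratheodory_zero (f := fun w => F w - F 0) (by positivity)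
      (hdiff.sub_const _).differentiableOn (fun w hw => ?_) hR0 (by simpa using hR) (sub_self _)
    have hw' : ‖w‖ < R := by simpa using hw
    have h1 := hle (Complex.orthonormalBasisOneI.repr w)
    rw [LinearIsometryEquiv.norm_map] at h1
    have h2 : Real.log (‖w‖ + 3) ≤ Real.log (R + 3) :=
      Real.log_le_log (by positivity) (by linarith)
    have h3 := mul_le_mul_of_nonneg_left h2 hB
    have h4 := le_abs_self A
    have h5 := neg_abs_le (u 0)
    simp only [Set.mem_ofPred_eq, Complex.sub_re, hre, map_zero, A']
    linarith
  have hlim := tendsto_log_add_div_sub_atTop A' B 3 ‖z‖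
  have := ge_of_tendsto hlim ((eventually_gt_atTop ‖z‖).mono hbound)
  exact norm_le_zero_iff.1 this

open ContinuousLinearMap in
lemma lap_convolution_normed_eq_zero {h : R2 → ℝ} (hh : LocallyIntegrable h)
    (hweak : IsWeakSol h fun _ => 0) (ρ : ContDiffBump (0 : R2)) (x : R2) :
    lap (convolution (ρ.normed volume) h (lsmul ℝ ℝ) volume) x = 0 := by
  rw [lap_convolution ρ.hasCompactSupport_normed ρ.contDiff_normed hh, hweak]
  · simp
  · exact ρ.contDiff_normed.comp (contDiff_const.sub contDiff_id)
  · exact ρ.hasCompactSupport_normed.comp_homeomorph (Homeomorph.subLeft x)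

open ContinuousLinearMap in
lemma convolution_normed_le {h : R2 → ℝ} (hh : LocallyIntegrable h) {A B : ℝ} (hB : 0 ≤ B)
    (hle : ∀ᵐ x : R2, h x ≤ A + B * Real.log (‖x‖ + 2)) (ρ : ContDiffBump (0 : R2))
    (hρ : ρ.rOut ≤ 1) (x : R2) :
    convolution (ρ.normed volume) h (lsmul ℝ ℝ) volume x ≤ A + B * Real.log (‖x‖ + 3) := by
  have hint : Integrable fun t : R2 => ρ.normed volume (x - t) :=
    ρ.integrable_normed.comp_sub_left x
  rw [convolution_lsmul_swap]
  calc ∫ t, ρ.normed volume (x - t) • h t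
      ≤ ∫ t, ρ.normed volume (x - t) * (A + B * Real.log (‖x‖ + 3)) := by
        refine integral_mono_ae
          (ρ.hasCompactSupport_normed.convolutionExists_left (lsmul ℝ ℝ)
            ρ.continuous_normed hh x).integrable_swap (hint.mul_const _) ?_
        filter_upwards [hle] with t ht
        by_cases h0 : ρ.normed volume (x - t) = 0
        · simp [h0]
        · have hmem : x - t ∈ Function.support (ρ.normed volume) := h0
          rw [ρ.support_normed_eq, mem_ball_zero_iff] at hmem
          refine mul_le_mul_of_nonneg_left (ht.trans ?_) (ρ.nonneg_normed _)
          gcongr 2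
          refine Real.log_le_log (by positivity) ?_
          have := norm_sub_norm_le t x
          rw [norm_sub_rev] at this
          linarith
    _ = A + B * Real.log (‖x‖ + 3) := by
        rw [integral_mul_const, integral_sub_left_eq_self (ρ.normed volume) volume x,
          ρ.integral_normed, one_mul]

/-- **Liouville's theorem**: a weakly harmonic function on the plane bounded above by a
logarithm is almost everywhere constant. -/
lemma ae_eq_const_of_isWeakSol_zero_of_le_log {h : R2 → ℝ} (hh : LocallyIntegrable h)
    (hweak : IsWeakSol h fun _ => 0) {A B : ℝ} (hB : 0 ≤ B)
    (hle : ∀ᵐ x : R2, h x ≤ A + B * Real.log (‖x‖ + 2)) :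
    ∃ c : ℝ, h =ᵐ[volume] fun _ => c := by
  let ρ (n : ℕ) : ContDiffBump (0 : R2) :=
    { rIn := 1 / (n + 1) / 2
      rOut := 1 / (n + 1)
      rIn_pos := by positivity
      rIn_lt_rOut := half_lt_self (by positivity) }
  set u : ℕ → R2 → ℝ := fun n =>
    convolution ((ρ n).normed volume) h (ContinuousLinearMap.lsmul ℝ ℝ) volume
  have hconst (n : ℕ) (x : R2) : u n x = u n 0 := by
    refine eq_of_harmonic_of_le_log
      ((ρ n).hasCompactSupport_normed.contDiff_convolution_left (n := 2) _
        (ρ n).contDiff_normed hh)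
      (lap_convolution_normed_eq_zero hh hweak (ρ n)) hB
      (convolution_normed_le hh hB hle (ρ n) ?_) x
    rw [div_le_one (by positivity)]
    simp
  have hlim : ∀ᵐ x : R2, Tendsto (fun n => u n x) atTop (nhds (h x)) := by
    refine ContDiffBump.ae_convolution_tendsto_right_of_locallyIntegrable (K := 2)
      tendsto_one_div_add_atTop_nhds_zero_nat (Eventually.of_forall fun n => ?_) hh
    simp only [ρ]
    linarith
  obtain ⟨x₀, hx₀⟩ := hlim.exists
  refine ⟨h x₀, ?_⟩
  filter_upwards [hlim] with x hx
  simp only [hconst] at hx hx₀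
  exact tendsto_nhds_unique hx hx₀

lemma integral_mul_lap_comm {u φ : R2 → ℝ} (hu : ContDiff ℝ 2 u) (hφ : ContDiff ℝ 2 φ)
    (hs : HasCompactSupport φ) : ∫ x, u x * lap φ x = ∫ x, lap u x * φ x := by
  have hint {a b : R2 → ℝ} (ha : Continuous a) (hb : Continuous b) (hbs : HasCompactSupport b) :
      Integrable fun x => a x * b x :=
    (ha.mul hb).integrable_of_hasCompactSupport hbs.mul_left
  have hd {a : R2 → ℝ} (ha : ContDiff ℝ 2 a) (i : Fin 2) :
      ContDiff ℝ 1 fun y => fderiv ℝ a y (stdVec i) :=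
    (ha.fderiv_right (m := 1) le_rfl).clm_apply contDiff_const
  have hc {a : R2 → ℝ} (ha : ContDiff ℝ 1 a) (i : Fin 2) :
      Continuous fun y => fderiv ℝ a y (stdVec i) :=
    (ha.continuous_fderiv one_ne_zero).clm_apply continuous_const
  have hu1 : ContDiff ℝ 1 u := hu.of_le one_le_two
  have hφ1 : ContDiff ℝ 1 φ := hφ.of_le one_le_two
  have hs1 (i : Fin 2) : HasCompactSupport fun y => fderiv ℝ φ y (stdVec i) :=
    hs.fderiv_apply (𝕜 := ℝ) _
  simp only [lap_eq_sum_fderiv hu, lap_eq_sum_fderiv hφ, Finset.mul_sum, Finset.sum_mul]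
  rw [integral_finsetSum _ fun i _ =>
      hint hu.continuous (hc (hd hφ i) i) ((hs1 i).fderiv_apply (𝕜 := ℝ) _),
    integral_finsetSum _ fun i _ => hint (hc (hd hu i) i) hφ.continuous hs]
  refine Finset.sum_congr rfl fun i _ => ?_
  rw [integral_mul_fderiv_eq_neg_fderiv_mul_of_integrable
      (hint (hc hu1 i) (hc hφ1 i) (hs1 i))
      (hint hu.continuous (hc (hd hφ i) i) ((hs1 i).fderiv_apply (𝕜 := ℝ) _))
      (hint hu.continuous (hc hφ1 i) (hs1 i))
      (fun x _ => hu.differentiable two_ne_zero x)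
      (fun x _ => (hd hφ i).differentiable one_ne_zero x),
    integral_mul_fderiv_eq_neg_fderiv_mul_of_integrable
      (hint (hc (hd hu i) i) hφ.continuous hs)
      (hint (hc hu1 i) (hc hφ1 i) (hs1 i))
      (hint (hc hu1 i) hφ.continuous hs)
      (fun x _ => (hd hu i).differentiable one_ne_zero x)
      (fun x _ => hφ.differentiable two_ne_zero x), neg_neg]

lemma contDiff_log_norm_sq_add {ε : ℝ} (hε : 0 < ε) :
    ContDiff ℝ 2 fun x : R2 => 1 / 2 * Real.log (‖x‖ ^ 2 + ε ^ 2) :=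
  contDiff_const.mul (((contDiff_norm_sq ℝ).add contDiff_const).log fun x => by positivity)

lemma lap_log_norm_sq_add {ε : ℝ} (hε : 0 < ε) (x : R2) :
    lap (fun x : R2 => 1 / 2 * Real.log (‖x‖ ^ 2 + ε ^ 2)) x =
      2 * ε ^ 2 / (‖x‖ ^ 2 + ε ^ 2) ^ 2 := by
  have hpos (y : R2) : ‖y‖ ^ 2 + ε ^ 2 ≠ 0 := by positivity
  have hsq (y : R2) : HasFDerivAt (fun x : R2 => ‖x‖ ^ 2 + ε ^ 2) (2 • innerSL ℝ y) y :=
    (hasStrictFDerivAt_norm_sq y).hasFDerivAt.add_const _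
  have h1 (y : R2) (i : Fin 2) :
      fderiv ℝ (fun x : R2 => 1 / 2 * Real.log (‖x‖ ^ 2 + ε ^ 2)) y (stdVec i) =
        y i / (‖y‖ ^ 2 + ε ^ 2) := by
    rw [(((hsq y).log (hpos y)).const_mul (1 / 2)).fderiv]
    simp [EuclideanSpace.inner_single_right]
    field_simp
  have h2 (i : Fin 2) : fderiv ℝ (fun y : R2 => y i / (‖y‖ ^ 2 + ε ^ 2)) x (stdVec i) =
      1 / (‖x‖ ^ 2 + ε ^ 2) - 2 * x i ^ 2 / (‖x‖ ^ 2 + ε ^ 2) ^ 2 := by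
    have hi : HasFDerivAt (fun y : R2 => y i) (EuclideanSpace.proj (𝕜 := ℝ) i) x :=
      (EuclideanSpace.proj (𝕜 := ℝ) i).hasFDerivAt
    have := hi.mul ((hasDerivAt_inv (hpos x)).comp_hasFDerivAt x (hsq x))
    simp only [div_eq_mul_inv]
    have h3 := this.fderiv
    simp only [Function.comp_def, Pi.mul_def] at h3
    rw [h3]
    simp [EuclideanSpace.inner_single_right]
    have := hpos x
    field_simp
    ring
  rw [lap_eq_sum_fderiv (contDiff_log_norm_sq_add hε)]
  simp only [h1, h2, Fin.sum_univ_two]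
  have hn : ‖x‖ ^ 2 = x 0 ^ 2 + x 1 ^ 2 := by
    simp [EuclideanSpace.norm_sq_eq, Fin.sum_univ_two]
  have := hpos x
  field_simp
  rw [hn]
  ring

lemma integral_poisson_kernel_sq :
    ∫ x : R2, (π * (1 + ‖x‖ ^ 2) ^ 2)⁻¹ = 1 := by
  rw [integral_fun_norm_addHaar volume fun r : ℝ => (π * (1 + r ^ 2) ^ 2)⁻¹]
  have hball : (volume : Measure R2).real (ball 0 1) = π := by
    simp [Measure.real, EuclideanSpace.volume_ball_fin_two, Real.pi_nonneg]
  have hderiv (y : ℝ) : HasDerivAt (fun y : ℝ => -((2 * π)⁻¹ * (1 + y ^ 2)⁻¹))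
      (y * (π * (1 + y ^ 2) ^ 2)⁻¹) y := by
    have hpos : 1 + y ^ 2 ≠ 0 := by positivity
    have h := ((((hasDerivAt_pow 2 y).const_add 1).inv hpos).const_mul (2 * π)⁻¹).neg
    refine h.congr_deriv ?_
    have := Real.pi_ne_zero
    field_simp
    simp
  have hlim : Tendsto (fun y : ℝ => -((2 * π)⁻¹ * (1 + y ^ 2)⁻¹)) atTop (nhds 0) := by
    have h : Tendsto (fun y : ℝ => 1 + y ^ 2) atTop atTop :=
      tendsto_atTop_add_const_left _ _ (tendsto_pow_atTop two_ne_zero)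
    simpa using (h.inv_tendsto_atTop.const_mul (2 * π)⁻¹).neg
  have hint : ∫ y in Set.Ioi (0 : ℝ), y * (π * (1 + y ^ 2) ^ 2)⁻¹ = (2 * π)⁻¹ := by
    rw [integral_Ioi_of_hasDerivAt_of_nonneg (hderiv 0).continuousAt.continuousWithinAt
      (fun y _ => hderiv y) (fun y (hy : 0 < y) => by positivity) hlim]
    simp
  simp only [finrank_euclideanSpace, Fintype.card_fin, hball, Nat.add_one_sub_one, pow_one,
    smul_eq_mul, hint]
  have := Real.pi_ne_zero
  simp

lemma tendsto_norm_sq_mul_poisson_kernel_sq :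
    Tendsto (fun x : R2 => ‖x‖ ^ 2 * (π * (1 + ‖x‖ ^ 2) ^ 2)⁻¹) (cobounded R2) (nhds 0) := by
  have h : Tendsto (fun x : R2 => ‖x‖ ^ 2) (cobounded R2) atTop :=
    (tendsto_pow_atTop two_ne_zero).comp tendsto_norm_cobounded_atTop
  refine squeeze_zero (fun x => by positivity) (fun x => ?_)
    (h.inv_tendsto_atTop.congr fun x => rfl)
  by_cases hx : ‖x‖ ^ 2 = 0
  · simp [hx]
  · have hx' : 0 < ‖x‖ ^ 2 := lt_of_le_of_ne (by positivity) (Ne.symm hx)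
    rw [Pi.inv_apply, ← div_eq_mul_inv, div_le_iff₀ (by positivity)]
    have hπ : 1 ≤ π := by linarith [Real.pi_gt_three]
    rw [← div_eq_inv_mul, le_div_iff₀ hx']
    nlinarith [sq_nonneg (‖x‖ ^ 2)]

lemma tendsto_integral_log_norm_sq_add_mul_lap {φ : R2 → ℝ} (hφ : ContDiff ℝ 2 φ)
    (hs : HasCompactSupport φ) :
    Tendsto (fun c : ℝ => ∫ x : R2, 1 / 2 * Real.log (‖x‖ ^ 2 + c⁻¹ ^ 2) * lap φ x) atTop
      (nhds (2 * π * φ 0)) := by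
  have h := tendsto_integral_comp_smul_smul_of_integrable
    (μ := (volume : Measure R2)) (φ := fun x => (π * (1 + ‖x‖ ^ 2) ^ 2)⁻¹)
    (fun x => by positivity) integral_poisson_kernel_sq
    (by simpa using tendsto_norm_sq_mul_poisson_kernel_sq)
    (hφ.continuous.integrable_of_hasCompactSupport hs) hφ.continuous.continuousAt
  refine (h.const_mul (2 * π)).congr' ?_
  filter_upwards [eventually_gt_atTop 0] with c hc
  rw [integral_mul_lap_comm (contDiff_log_norm_sq_add (inv_pos.2 hc)) hφ hs,
    ← integral_const_mul]
  refine integral_congr_ae (Eventually.of_forall fun x => ?_)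
  simp only [lap_log_norm_sq_add (inv_pos.2 hc), finrank_euclideanSpace, Fintype.card_fin,
    norm_smul, Real.norm_eq_abs, abs_of_pos hc, smul_eq_mul]
  have := Real.pi_ne_zero
  have h1 : ‖x‖ ^ 2 + c⁻¹ ^ 2 ≠ 0 := by positivity
  have h2 : 1 + (c * ‖x‖) ^ 2 ≠ 0 := by positivity
  have h3 : ‖x‖ ^ 2 + c⁻¹ ^ 2 = c⁻¹ ^ 2 * (1 + (c * ‖x‖) ^ 2) := by
    field_simp
    ring
  rw [h3]
  field_simp

lemma integrable_posLog_inv_norm_rpow {q : ℝ} (hq : 0 < q) :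
    Integrable fun x : R2 => (log⁺ ‖x‖⁻¹) ^ q := by
  rw [integrable_fun_norm_addHaar volume (f := fun r : ℝ => (log⁺ r⁻¹) ^ q)]
  simp only [finrank_euclideanSpace, Fintype.card_fin, Nat.add_one_sub_one, pow_one, smul_eq_mul]
  have hmeas : Measurable fun r : ℝ => r * (log⁺ r⁻¹) ^ q := by
    have := continuous_posLog.measurable
    fun_prop
  have hdom : IntegrableOn ((Set.Ioc (0 : ℝ) 1).indicator fun _ => q ^ q) (Set.Ioi 0) :=
    ((integrable_indicator_iff measurableSet_Ioc).2 (by simp)).integrableOn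
  refine Integrable.mono' hdom hmeas.aestronglyMeasurable ?_
  filter_upwards [ae_restrict_mem measurableSet_Ioi] with r (hr : 0 < r)
  have hnn : 0 ≤ log⁺ r⁻¹ := posLog_nonneg
  rw [Real.norm_eq_abs, abs_of_nonneg (by positivity)]
  rcases le_or_gt r 1 with hr1 | hr1
  · rw [Set.indicator_of_mem (Set.mem_Ioc.2 ⟨hr, hr1⟩)]
    have hle : log⁺ r⁻¹ ≤ r⁻¹ ^ q⁻¹ * q := by
      rw [posLog_eq_log (by rw [abs_of_pos (inv_pos.2 hr)]; exact (one_le_inv₀ hr).2 hr1)]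
      simpa [div_eq_mul_inv] using
        Real.log_le_rpow_div (inv_pos.2 hr).le (inv_pos.2 hq)
    calc r * (log⁺ r⁻¹) ^ q ≤ r * (r⁻¹ ^ q⁻¹ * q) ^ q := by gcongr
      _ = q ^ q := by
        rw [Real.mul_rpow (by positivity) hq.le, ← Real.rpow_mul (by positivity),
          inv_mul_cancel₀ hq.ne', Real.rpow_one]
        field_simp
  · rw [Set.indicator_of_notMem (by simp [hr1])]
    have : log⁺ r⁻¹ = 0 := by
      rw [posLog_eq_zero_iff, abs_of_pos (inv_pos.2 hr)]
      exact inv_le_one_of_one_le₀ hr1.le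
    simp [this, hq.ne']

lemma integrable_posLog_inv_norm : Integrable fun x : R2 => log⁺ ‖x‖⁻¹ := by
  simpa using integrable_posLog_inv_norm_rpow one_pos

lemma integral_log_norm_mul_lap {φ : R2 → ℝ} (hφ : ContDiff ℝ 2 φ) (hs : HasCompactSupport φ) :
    ∫ x : R2, Real.log ‖x‖ * lap φ x = 2 * π * φ 0 := by
  have hcs := hasCompactSupport_lap hs
  have hcont := continuous_lap hφ
  refine tendsto_nhds_unique ?_ (tendsto_integral_log_norm_sq_add_mul_lap hφ hs)
  have hdom : Integrable fun x : R2 =>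
      log⁺ ‖x‖⁻¹ * |lap φ x| + 1 / 2 * Real.log (‖x‖ ^ 2 + 1) * |lap φ x| := by
    refine Integrable.add ?_ ?_
    · simpa using integrable_posLog_inv_norm.locallyIntegrable.integrable_smul_right_of_hasCompactSupport
        hcont.abs hcs.abs
    · refine Continuous.integrable_of_hasCompactSupport ?_ hcs.abs.mul_left
      have hne (x : R2) : ‖x‖ ^ 2 + 1 ≠ 0 := by positivity
      fun_prop (disch := assumption)
  have hne : ∀ᵐ x : R2, x ≠ 0 := by
    simp [ae_iff]
  refine tendsto_integral_filter_of_dominated_convergence _ ?_ ?_ hdom ?_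
  · filter_upwards [eventually_gt_atTop 0] with c hc
    exact ((contDiff_log_norm_sq_add (inv_pos.2 hc)).continuous.mul hcont).aestronglyMeasurable
  · filter_upwards [eventually_ge_atTop 1] with c hc
    filter_upwards [hne] with x hx
    have hx0 : 0 < ‖x‖ := norm_pos_iff.2 hx
    have hc1 : c⁻¹ ≤ 1 := inv_le_one_of_one_le₀ hc
    have hc0 : 0 < c⁻¹ := by positivity
    rw [norm_mul, Real.norm_eq_abs, Real.norm_eq_abs, ← add_mul]
    gcongr
    have hup : Real.log (‖x‖ ^ 2 + c⁻¹ ^ 2) ≤ Real.log (‖x‖ ^ 2 + 1) :=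
      Real.log_le_log (by positivity) (by nlinarith)
    have hlow : 2 * Real.log ‖x‖ ≤ Real.log (‖x‖ ^ 2 + c⁻¹ ^ 2) := by
      rw [show 2 * Real.log ‖x‖ = Real.log (‖x‖ ^ 2) by simp]
      exact Real.log_le_log (by positivity) (by nlinarith)
    have h1 : 0 ≤ Real.log (‖x‖ ^ 2 + 1) := Real.log_nonneg (by nlinarith)
    have h2 : -Real.log ‖x‖ ≤ log⁺ ‖x‖⁻¹ := by
      rw [← Real.log_inv]
      exact le_max_right _ _
    have h3 : 0 ≤ log⁺ ‖x‖⁻¹ := posLog_nonneg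
    rw [abs_le]
    constructor <;> linarith
  · filter_upwards [hne] with x hx
    have hx0 : 0 < ‖x‖ := norm_pos_iff.2 hx
    refine Tendsto.mul_const _ ?_
    have hlim : Tendsto (fun c : ℝ => ‖x‖ ^ 2 + c⁻¹ ^ 2) atTop (nhds (‖x‖ ^ 2)) := by
      simpa using (tendsto_inv_atTop_zero.pow 2).const_add (‖x‖ ^ 2)
    have := ((Real.continuousAt_log (by positivity)).tendsto.comp hlim).const_mul (1 / 2)
    simpa using this

/-- `log ‖x - y‖ / (2π)` is the fundamental solution of the Laplacian in the plane. -/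
lemma integral_log_norm_sub_mul_lap {φ : R2 → ℝ} (hφ : ContDiff ℝ 2 φ)
    (hs : HasCompactSupport φ) (y : R2) :
    ∫ x : R2, Real.log ‖x - y‖ * lap φ x = 2 * π * φ y := by
  have h := integral_log_norm_mul_lap (φ := fun z => φ (z + y))
    (hφ.comp (contDiff_id.add contDiff_const)) (hs.comp_homeomorph (Homeomorph.addRight y))
  simp only [lap_comp_add_right, zero_add] at h
  rw [← h, ← integral_sub_right_eq_self (fun z => Real.log ‖z‖ * lap φ (z + y)) y]
  simp

lemma abs_posLog_norm_sub_sub_log_le (x y : R2) :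
    |log⁺ ‖x - y‖ - Real.log (‖y‖ + 1)| ≤ Real.log (‖x‖ + 2) := by
  have hx := norm_nonneg x
  have hy := norm_nonneg y
  have hM : 1 ≤ max 1 ‖x - y‖ := le_max_left _ _
  have hM' : ‖x - y‖ ≤ max 1 ‖x - y‖ := le_max_right _ _
  rw [posLog_eq_log_max_one (norm_nonneg _), abs_le]
  constructor
  · have h : Real.log (‖y‖ + 1) ≤ Real.log (max 1 ‖x - y‖ * (‖x‖ + 2)) := by
      refine Real.log_le_log (by positivity) ?_
      have := norm_sub_norm_le y x
      rw [norm_sub_rev] at this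
      nlinarith
    rw [Real.log_mul (by positivity) (by positivity)] at h
    linarith
  · have h : Real.log (max 1 ‖x - y‖) ≤ Real.log ((‖y‖ + 1) * (‖x‖ + 2)) := by
      refine Real.log_le_log (by positivity) (max_le (by nlinarith) ?_)
      have := norm_sub_le x y
      nlinarith
    rw [Real.log_mul (by positivity) (by positivity)] at h
    linarith

def farPotential (f : R2 → ℝ) (x : R2) : ℝ :=
  ∫ y, (log⁺ ‖x - y‖ - Real.log (‖y‖ + 1)) * f y

def nearPotential (f : R2 → ℝ) (x : R2) : ℝ :=
  ∫ y, log⁺ ‖x - y‖⁻¹ * f y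

/-- The logarithmic potential of `f`, normalised so that it converges for every integrable `f`. -/
def logPotential (f : R2 → ℝ) (x : R2) : ℝ :=
  -(2 * π)⁻¹ * (farPotential f x - nearPotential f x)

lemma continuous_farKernel :
    Continuous fun p : R2 × R2 => log⁺ ‖p.1 - p.2‖ - Real.log (‖p.2‖ + 1) := by
  refine (continuous_posLog.comp (by fun_prop)).sub (Continuous.log (by fun_prop) fun p => ?_)
  positivity

lemma integrable_farKernel_mul {f : R2 → ℝ} (hf : Integrable f) (x : R2) :
    Integrable fun y => (log⁺ ‖x - y‖ - Real.log (‖y‖ + 1)) * f y :=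
  hf.bdd_mul (continuous_farKernel.comp (Continuous.prodMk_right x)).aestronglyMeasurable
    (Eventually.of_forall fun y => abs_posLog_norm_sub_sub_log_le x y)

lemma abs_farPotential_le {f : R2 → ℝ} (hf : Integrable f) (x : R2) :
    |farPotential f x| ≤ Real.log (‖x‖ + 2) * ∫ y, |f y| := by
  rw [farPotential, ← integral_const_mul]
  rw [← Real.norm_eq_abs]
  refine norm_integral_le_of_norm_le (hf.abs.const_mul _) (Eventually.of_forall fun y => ?_)
  rw [norm_mul]
  exact mul_le_mul_of_nonneg_right (abs_posLog_norm_sub_sub_log_le x y) (norm_nonneg _)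

lemma continuous_farPotential {f : R2 → ℝ} (hf : Integrable f) : Continuous (farPotential f) := by
  refine continuous_iff_continuousAt.2 fun x₀ => ?_
  refine continuousAt_of_dominated (bound := fun y => Real.log (‖x₀‖ + 3) * |f y|)
    (Eventually.of_forall fun x => (integrable_farKernel_mul hf x).aestronglyMeasurable) ?_
    (hf.abs.const_mul _) (Eventually.of_forall fun y => ?_)
  · filter_upwards [ball_mem_nhds x₀ one_pos] with x hx
    refine Eventually.of_forall fun y => ?_
    rw [norm_mul]
    refine mul_le_mul_of_nonneg_right ((abs_posLog_norm_sub_sub_log_le x y).trans ?_)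
      (norm_nonneg _)
    refine Real.log_le_log (by positivity) ?_
    have := norm_sub_norm_le x x₀
    rw [mem_ball_iff_norm] at hx
    linarith
  · exact ((continuous_farKernel.comp (Continuous.prodMk_left y)).mul
      continuous_const).continuousAt

instance isCountablyGenerated_cobounded_R2 : (cobounded R2).IsCountablyGenerated := by
  rw [← comap_norm_atTop]
  infer_instance

lemma tendsto_log_norm_cobounded : Tendsto (fun x : R2 => Real.log ‖x‖) (cobounded R2) atTop :=
  Real.tendsto_log_atTop.comp tendsto_norm_cobounded_atTop

lemma tendsto_farKernel_div_log (y : R2) :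
    Tendsto (fun x : R2 => (log⁺ ‖x - y‖ - Real.log (‖y‖ + 1)) / Real.log ‖x‖)
      (cobounded R2) (nhds 1) := by
  have hbound : Tendsto (fun x : R2 =>
      (log⁺ ‖x - y‖ - Real.log (‖y‖ + 1) - Real.log ‖x‖) / Real.log ‖x‖)
      (cobounded R2) (nhds 0) := by
    refine squeeze_zero_norm'
      (a := fun x => (Real.log (‖y‖ + 2) + Real.log 2 + Real.log (‖y‖ + 1)) / Real.log ‖x‖) ?_
      (tendsto_const_nhds.div_atTop tendsto_log_norm_cobounded)
    filter_upwards [tendsto_norm_cobounded_atTop.eventually_gt_atTop 1] with x hx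
    have hlog : 0 < Real.log ‖x‖ := Real.log_pos hx
    rw [norm_div, Real.norm_eq_abs, Real.norm_eq_abs, abs_of_pos hlog]
    gcongr
    have h1 := abs_posLog_norm_sub_sub_log_le y x
    rw [norm_sub_rev, abs_le] at h1
    have h2 : Real.log ‖x‖ ≤ Real.log (‖x‖ + 1) := Real.log_le_log (by linarith) (by linarith)
    have h3 : Real.log (‖x‖ + 1) ≤ Real.log (2 * ‖x‖) :=
      Real.log_le_log (by linarith) (by linarith)
    rw [Real.log_mul two_ne_zero (by linarith)] at h3
    have h4 : 0 ≤ Real.log (‖y‖ + 1) := Real.log_nonneg (by linarith [norm_nonneg y])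
    have h5 : 0 ≤ Real.log 2 := Real.log_nonneg one_le_two
    rw [abs_le]
    constructor <;> linarith
  have := hbound.add_const 1
  rw [zero_add] at this
  refine this.congr' ?_
  filter_upwards [tendsto_norm_cobounded_atTop.eventually_gt_atTop 1] with x hx
  have hlog : Real.log ‖x‖ ≠ 0 := (Real.log_pos hx).ne'
  field_simp
  ring

lemma tendsto_farPotential_div_log {f : R2 → ℝ} (hf : Integrable f) :
    Tendsto (fun x => farPotential f x / Real.log ‖x‖) (cobounded R2) (nhds (∫ y, f y)) := by
  have h : Tendsto (fun x : R2 =>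
      ∫ y, (log⁺ ‖x - y‖ - Real.log (‖y‖ + 1)) / Real.log ‖x‖ * f y) (cobounded R2)
      (nhds (∫ y, f y)) := by
    refine tendsto_integral_filter_of_dominated_convergence (fun y => 2 * |f y|) ?_ ?_
      (hf.abs.const_mul 2) ?_
    · refine Eventually.of_forall fun x => ?_
      refine (((integrable_farKernel_mul hf x).div_const
        (Real.log ‖x‖)).congr ?_).aestronglyMeasurable
      exact Eventually.of_forall fun y => by ring
    · filter_upwards [tendsto_norm_cobounded_atTop.eventually_ge_atTop 2] with x hx
      refine Eventually.of_forall fun y => ?_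
      have hlog : 0 < Real.log ‖x‖ := Real.log_pos (by linarith)
      rw [norm_mul, norm_div, Real.norm_eq_abs (Real.log ‖x‖), abs_of_pos hlog]
      refine mul_le_mul_of_nonneg_right ?_ (norm_nonneg _)
      rw [div_le_iff₀ hlog]
      refine (abs_posLog_norm_sub_sub_log_le x y).trans ?_
      have : 2 * Real.log ‖x‖ = Real.log (‖x‖ ^ 2) := by simp
      rw [this]
      exact Real.log_le_log (by linarith) (by nlinarith)
    · exact Eventually.of_forall fun y => by
        simpa using (tendsto_farKernel_div_log y).mul_const (f y)
  refine h.congr fun x => ?_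
  rw [farPotential, ← integral_div]
  exact integral_congr_ae (Eventually.of_forall fun y => by ring)

lemma abs_farPotential_sub_le {f : R2 → ℝ} (hf : Integrable f)
    (hlog : Integrable fun y => |f y| * Real.log (‖y‖ + 1)) (x : R2) :
    |farPotential f x - (∫ y, f y) * Real.log (‖x‖ + 1)| ≤
      ∫ y, (2 * (|f y| * Real.log (‖y‖ + 1)) + Real.log 2 * |f y|) := by
  have heq : farPotential f x - (∫ y, f y) * Real.log (‖x‖ + 1) =
      ∫ y, ((log⁺ ‖x - y‖ - Real.log (‖y‖ + 1)) * f y - f y * Real.log (‖x‖ + 1)) := by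
    rw [integral_sub (integrable_farKernel_mul hf x) (hf.mul_const _), integral_mul_const]
    rfl
  rw [heq]
  rw [← Real.norm_eq_abs]
  refine norm_integral_le_of_norm_le ((hlog.const_mul 2).add (hf.abs.const_mul _))
    (Eventually.of_forall fun y => ?_)
  have h1 := abs_posLog_norm_sub_sub_log_le y x
  have hy := norm_nonneg y
  rw [norm_sub_rev, abs_le] at h1
  have h2 : Real.log (‖y‖ + 2) ≤ Real.log (2 * (‖y‖ + 1)) :=
    Real.log_le_log (by linarith) (by linarith)
  rw [Real.log_mul two_ne_zero (by linarith)] at h2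
  have h3 : 0 ≤ Real.log (‖y‖ + 1) := Real.log_nonneg (by linarith)
  have h4 : |log⁺ ‖x - y‖ - Real.log (‖y‖ + 1) - Real.log (‖x‖ + 1)| ≤
      2 * Real.log (‖y‖ + 1) + Real.log 2 := by
    rw [abs_le]
    constructor <;> linarith
  calc ‖(log⁺ ‖x - y‖ - Real.log (‖y‖ + 1)) * f y - f y * Real.log (‖x‖ + 1)‖
      = |log⁺ ‖x - y‖ - Real.log (‖y‖ + 1) - Real.log (‖x‖ + 1)| * |f y| := by
        rw [Real.norm_eq_abs, ← abs_mul]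
        ring_nf
    _ ≤ (2 * Real.log (‖y‖ + 1) + Real.log 2) * |f y| := by gcongr
    _ = 2 * (|f y| * Real.log (‖y‖ + 1)) + Real.log 2 * |f y| := by ring

lemma memLp_ofReal_of_integrable_abs_rpow {f : R2 → ℝ} {p : ℝ} (hp : 0 < p)
    (hf : AEStronglyMeasurable f) (hfp : Integrable fun x => |f x| ^ p) :
    MemLp f (ENNReal.ofReal p) := by
  rw [← integrable_norm_rpow_iff hf (by simpa using hp) ENNReal.ofReal_ne_top,
    ENNReal.toReal_ofReal hp.le]
  exact hfp

section HolderConvolution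

variable {f g : R2 → ℝ} {p q : ENNReal} [q.HolderConjugate p]

lemma integrable_comp_sub_left_mul (hg : MemLp g q) (hf : MemLp f p) (x : R2) :
    Integrable fun y => g (x - y) * f y :=
  (hg.comp_measurePreserving (Measure.measurePreserving_sub_left volume x)).integrable_mul hf

lemma enorm_integral_comp_sub_left_mul_le (hg : MemLp g q) (hf : MemLp f p) (x : R2) :
    ‖∫ y, g (x - y) * f y‖ₑ ≤ eLpNorm g q volume * eLpNorm f p volume := by
  have hmp := Measure.measurePreserving_sub_left (volume : Measure R2) x
  refine (enorm_integral_le_lintegral_enorm _).trans ?_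
  rw [← eLpNorm_one_eq_lintegral_enorm, ← eLpNorm_comp_measurePreserving hg.1 hmp]
  exact eLpNorm_smul_le_mul_eLpNorm (p := q) (q := p) (r := 1) (φ := g ∘ fun y => x - y) hf.1
    (hg.comp_measurePreserving hmp).1

lemma continuous_integral_comp_sub_left_mul (hq : q ≠ ⊤) (hg : MemLp g q) (hf : MemLp f p)
    (hf1 : Integrable f) : Continuous fun x => ∫ y, g (x - y) * f y := by
  refine continuous_of_uniform_approx_of_continuous fun u hu => ?_
  obtain ⟨ε, hε, hεu⟩ := uniformity_basis_edist.mem_iff.1 hu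
  obtain ⟨δ, hδ, hδε⟩ : ∃ δ : ENNReal, δ ≠ 0 ∧ δ * eLpNorm f p volume < ε := by
    obtain ⟨δ, hδ, h⟩ := ENNReal.exists_nnreal_pos_mul_lt hf.2.ne hε.ne'
    exact ⟨δ, by simpa using hδ.ne', h⟩
  obtain ⟨k, hks, hk, hkc, hkq⟩ := hg.exists_hasCompactSupport_eLpNorm_sub_le hq hδ
  refine ⟨fun x => ∫ y, k (x - y) * f y, ?_, fun x => hεu ?_⟩
  · have := hks.continuous_convolution_left (ContinuousLinearMap.mul ℝ ℝ) hkc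
      hf1.locallyIntegrable (μ := volume)
    refine this.congr fun x => ?_
    rw [convolution_eq_swap]
    rfl
  · have h := enorm_integral_comp_sub_left_mul_le (hg.sub hkq) hf x
    simp only [Pi.sub_apply, sub_mul] at h
    rw [integral_sub (integrable_comp_sub_left_mul hg hf x)
      (integrable_comp_sub_left_mul hkq hf x)] at h
    change edist _ _ < ε
    rw [edist_eq_enorm_sub]
    exact (h.trans (mul_le_mul_left hk _)).trans_lt hδε

end HolderConvolution

section NearPotential

variable {f : R2 → ℝ} {p : ℝ}

lemma memLp_posLog_inv_norm {q : ℝ} (hq : 0 < q) :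
    MemLp (fun z : R2 => log⁺ ‖z‖⁻¹) (ENNReal.ofReal q) := by
  refine memLp_ofReal_of_integrable_abs_rpow hq
    integrable_posLog_inv_norm.aestronglyMeasurable ?_
  simpa only [abs_of_nonneg posLog_nonneg] using integrable_posLog_inv_norm_rpow hq

lemma integrable_nearKernel_mul (hp : 1 < p) (hf : Integrable f)
    (hfp : Integrable fun x => |f x| ^ p) (x : R2) :
    Integrable fun y => log⁺ ‖x - y‖⁻¹ * f y := by
  have hpq := (Real.HolderConjugate.conjExponent hp).symm
  have := hpq.ennrealOfReal
  exact integrable_comp_sub_left_mul (memLp_posLog_inv_norm hpq.pos)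
    (memLp_ofReal_of_integrable_abs_rpow (by linarith) hf.1 hfp) x

lemma exists_abs_nearPotential_le (hp : 1 < p) (hf : Integrable f)
    (hfp : Integrable fun x => |f x| ^ p) : ∃ N, ∀ x, |nearPotential f x| ≤ N := by
  have hpq := (Real.HolderConjugate.conjExponent hp).symm
  have := hpq.ennrealOfReal
  have hg := memLp_posLog_inv_norm hpq.pos
  have hfm := memLp_ofReal_of_integrable_abs_rpow (by linarith) hf.1 hfp
  refine ⟨(eLpNorm (fun z : R2 => log⁺ ‖z‖⁻¹) (ENNReal.ofReal p.conjExponent) volume *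
    eLpNorm f (ENNReal.ofReal p) volume).toReal, fun x => ?_⟩
  rw [← Real.norm_eq_abs, ← toReal_enorm]
  exact ENNReal.toReal_mono (ENNReal.mul_ne_top hg.2.ne hfm.2.ne)
    (enorm_integral_comp_sub_left_mul_le hg hfm x)

lemma continuous_nearPotential (hp : 1 < p) (hf : Integrable f)
    (hfp : Integrable fun x => |f x| ^ p) : Continuous (nearPotential f) := by
  have hpq := (Real.HolderConjugate.conjExponent hp).symm
  have := hpq.ennrealOfReal
  exact continuous_integral_comp_sub_left_mul ENNReal.ofReal_ne_top
    (memLp_posLog_inv_norm hpq.pos)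
    (memLp_ofReal_of_integrable_abs_rpow (by linarith) hf.1 hfp) hf

lemma continuous_logPotential (hp : 1 < p) (hf : Integrable f)
    (hfp : Integrable fun x => |f x| ^ p) : Continuous (logPotential f) :=
  continuous_const.mul ((continuous_farPotential hf).sub (continuous_nearPotential hp hf hfp))

lemma integral_logKernel_mul_lap {φ : R2 → ℝ} (hφ : ContDiff ℝ 2 φ) (hs : HasCompactSupport φ)
    (y : R2) :
    ∫ x, (log⁺ ‖x - y‖ - Real.log (‖y‖ + 1) - log⁺ ‖x - y‖⁻¹) * lap φ x = 2 * π * φ y := by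
  have hlap : Integrable (lap φ) :=
    (continuous_lap hφ).integrable_of_hasCompactSupport (hasCompactSupport_lap hs)
  have h0 : ∫ x, lap φ x = 0 := by
    have h := integral_mul_lap_comm (u := fun _ => (1 : ℝ)) contDiff_const hφ hs
    have h1 (x : R2) : lap (fun _ => (1 : ℝ)) x = 0 := by
      simp [lap, iteratedFDeriv_const_of_ne two_ne_zero]
    simpa [h1] using h
  rw [← integral_log_norm_sub_mul_lap hφ hs y]
  have heq (x : R2) : (log⁺ ‖x - y‖ - Real.log (‖y‖ + 1) - log⁺ ‖x - y‖⁻¹) * lap φ x =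
      Real.log ‖x - y‖ * lap φ x - Real.log (‖y‖ + 1) * lap φ x := by
    rw [← posLog_sub_posLog_inv (x := ‖x - y‖)]
    ring
  have hint : Integrable fun x => Real.log ‖x - y‖ * lap φ x := by
    obtain ⟨K, hK⟩ := (hasCompactSupport_lap hs).exists_bound_of_continuous (continuous_lap hφ)
    have hfar : Integrable fun x => log⁺ ‖x - y‖ * lap φ x :=
      ((continuous_posLog.comp (by fun_prop)).mul
        (continuous_lap hφ)).integrable_of_hasCompactSupport (hasCompactSupport_lap hs).mul_left
    have hnear : Integrable fun x => log⁺ ‖x - y‖⁻¹ * lap φ x :=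
      (integrable_posLog_inv_norm.comp_sub_right y).mul_bdd
        (continuous_lap hφ).aestronglyMeasurable (Eventually.of_forall hK)
    refine (hfar.sub hnear).congr (Eventually.of_forall fun x => ?_)
    simp only [Pi.sub_apply, ← posLog_sub_posLog_inv (x := ‖x - y‖)]
    ring
  simp_rw [heq]
  rw [integral_sub hint (hlap.const_mul _), integral_const_mul, h0, mul_zero, sub_zero]

lemma isWeakSol_logPotential (hp : 1 < p) (hf : Integrable f)
    (hfp : Integrable fun x => |f x| ^ p) : IsWeakSol (logPotential f) f := by
  intro φ hφ hs
  have hφ2 : ContDiff ℝ 2 φ := hφ.of_le (by norm_cast)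
  have hlc := continuous_lap hφ2
  have hls := hasCompactSupport_lap hs
  obtain ⟨K, hK⟩ := hls.exists_bound_of_continuous hlc
  have hfar : Integrable (fun z : R2 × R2 =>
      (log⁺ ‖z.1 - z.2‖ - Real.log (‖z.2‖ + 1)) * (lap φ z.1 * f z.2))
      (volume.prod volume) := by
    have h1 : Integrable fun x : R2 => Real.log (‖x‖ + 2) * lap φ x := by
      refine Continuous.integrable_of_hasCompactSupport ?_ hls.mul_left
      refine (Continuous.log (by fun_prop) fun x => ?_).mul hlc
      positivity
    refine (h1.mul_prod hf).mono (continuous_farKernel.aestronglyMeasurable.mul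
      ((hlc.comp continuous_fst).aestronglyMeasurable.mul hf.1.comp_snd))
      (Eventually.of_forall fun z => ?_)
    have h2 := abs_posLog_norm_sub_sub_log_le z.1 z.2
    simp only [norm_mul, mul_assoc]
    gcongr
    exact h2.trans (le_abs_self _)
  have hnear : Integrable (fun z : R2 × R2 => log⁺ ‖z.1 - z.2‖⁻¹ * (lap φ z.1 * f z.2))
      (volume.prod volume) := by
    have h1 : Integrable (fun z : R2 × R2 => f z.2 * log⁺ ‖z.1 - z.2‖⁻¹) (volume.prod volume) :=
      hf.convolution_integrand (ContinuousLinearMap.mul ℝ ℝ) integrable_posLog_inv_norm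
    refine (h1.mul_bdd (hlc.comp continuous_fst).aestronglyMeasurable
      (Eventually.of_forall fun z => hK z.1)).congr (Eventually.of_forall fun z => ?_)
    simp only [Function.comp_apply]
    ring
  have hker (x : R2) : logPotential f x * lap φ x = -(2 * π)⁻¹ * ∫ y,
      ((log⁺ ‖x - y‖ - Real.log (‖y‖ + 1)) * (lap φ x * f y) -
        log⁺ ‖x - y‖⁻¹ * (lap φ x * f y)) := by
    rw [logPotential, farPotential, nearPotential, ← integral_sub (integrable_farKernel_mul hf x)
      (integrable_nearKernel_mul hp hf hfp x), mul_assoc, ← integral_mul_const]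
    congr 2 with y
    ring
  have hinner (y : R2) : ∫ x, ((log⁺ ‖x - y‖ - Real.log (‖y‖ + 1)) * (lap φ x * f y) -
        log⁺ ‖x - y‖⁻¹ * (lap φ x * f y)) = 2 * π * (f y * φ y) := by
    rw [mul_comm (f y), ← mul_assoc, ← integral_logKernel_mul_lap hφ2 hs y, ← integral_mul_const]
    congr 1 with x
    ring
  simp_rw [hker]
  rw [integral_const_mul, integral_integral_swap (hfar.sub hnear)]
  simp_rw [hinner]
  rw [integral_const_mul]
  field_simp

end NearPotential

lemma IsWeakSol.sub {ψ₁ ψ₂ g₁ g₂ : R2 → ℝ} (hψ₁ : LocallyIntegrable ψ₁)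
    (hψ₂ : LocallyIntegrable ψ₂) (hg₁ : LocallyIntegrable g₁) (hg₂ : LocallyIntegrable g₂)
    (h₁ : IsWeakSol ψ₁ g₁) (h₂ : IsWeakSol ψ₂ g₂) :
    IsWeakSol (fun x => ψ₁ x - ψ₂ x) fun x => g₁ x - g₂ x := by
  intro φ hφ hs
  have hint {a b : R2 → ℝ} (ha : LocallyIntegrable a) (hb : Continuous b)
      (hbs : HasCompactSupport b) : Integrable fun x => a x * b x := by
    simpa only [smul_eq_mul, mul_comm] using
      ha.integrable_smul_left_of_hasCompactSupport hb hbs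
  have hlc := continuous_lap (hφ.of_le (by norm_cast) : ContDiff ℝ 2 φ)
  have hls := hasCompactSupport_lap hs
  simp_rw [sub_mul]
  rw [integral_sub (hint hψ₁ hlc hls) (hint hψ₂ hlc hls), h₁ φ hφ hs, h₂ φ hφ hs,
    integral_sub (hint hg₁ hφ.continuous hs) (hint hg₂ hφ.continuous hs)]
  ring

lemma exists_abs_logPotential_le {f : R2 → ℝ} {p : ℝ} (hp : 1 < p) (hf : Integrable f)
    (hfp : Integrable fun x => |f x| ^ p) :
    ∃ A B : ℝ, 0 ≤ B ∧ ∀ x, |logPotential f x| ≤ A + B * Real.log (‖x‖ + 2) := by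
  obtain ⟨N, hN⟩ := exists_abs_nearPotential_le hp hf hfp
  refine ⟨(2 * π)⁻¹ * N, (2 * π)⁻¹ * ∫ y, |f y|, by positivity, fun x => ?_⟩
  have h := (abs_sub (farPotential f x) (nearPotential f x)).trans
    (add_le_add (abs_farPotential_le hf x) (hN x))
  rw [logPotential, abs_mul, abs_neg, abs_of_pos (by positivity)]
  refine (mul_le_mul_of_nonneg_left h (by positivity)).trans_eq ?_
  ring

lemma IsWeakSol.exists_ae_eq_logPotential_add_const {ψ f : R2 → ℝ} {p : ℝ} (hp : 1 < p)
    (hψ : LocallyIntegrable ψ) (hf : Integrable f) (hfp : Integrable fun x => |f x| ^ p)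
    (hweak : IsWeakSol ψ f)
    (hbdd : (∃ M : ℝ, ∀ᵐ x : R2, ψ x ≤ M) ∨ ∃ M : ℝ, ∀ᵐ x : R2, M ≤ ψ x) :
    ∃ c : ℝ, ψ =ᵐ[volume] fun x => logPotential f x + c := by
  have hL : LocallyIntegrable (logPotential f) :=
    (continuous_logPotential hp hf hfp).locallyIntegrable
  have hLw := isWeakSol_logPotential hp hf hfp
  obtain ⟨A, B, hB, hAB⟩ := exists_abs_logPotential_le hp hf hfp
  rcases hbdd with ⟨M, hM⟩ | ⟨M, hM⟩
  · have hw := hweak.sub hψ hL hf.locallyIntegrable hf.locallyIntegrable hLw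
    simp only [sub_self] at hw
    obtain ⟨c, hc⟩ := ae_eq_const_of_isWeakSol_zero_of_le_log (A := M + A) (hψ.sub hL) hw hB
      (hM.mono fun x hx => by
        have := (abs_le.1 (hAB x)).1
        simp only [Pi.sub_apply]
        linarith)
    exact ⟨c, hc.mono fun x hx => by simp only [Pi.sub_apply] at hx; linarith⟩
  · have hw := hLw.sub hL hψ hf.locallyIntegrable hf.locallyIntegrable hweak
    simp only [sub_self] at hw
    obtain ⟨c, hc⟩ := ae_eq_const_of_isWeakSol_zero_of_le_log (A := A - M) (hL.sub hψ) hw hB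
      (hM.mono fun x hx => by
        have := (abs_le.1 (hAB x)).2
        simp only [Pi.sub_apply]
        linarith)
    exact ⟨-c, hc.mono fun x hx => by simp only [Pi.sub_apply] at hx; linarith⟩

/-- Lemma 2.4: logarithmic asymptotics of solutions of -Δψ = V e^ψ. -/
theorem log_asymptotics (V ψ : R2 → ℝ)
    (hV : LocallyIntegrable V) (hψ : LocallyIntegrable ψ)
    (hf : Integrable (fun x : R2 => V x * Real.exp (ψ x)))
    (p : ℝ) (hp : 1 < p)
    (hfp : Integrable (fun x : R2 => |V x * Real.exp (ψ x)| ^ p))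
    (hweak : IsWeakSol ψ (fun x => V x * Real.exp (ψ x)))
    (hcase : ((∃ M : ℝ, ∀ᵐ x : R2, ψ x ≤ M) ∧
        0 ≤ ∫ x : R2, V x * Real.exp (ψ x)) ∨
      ((∃ M : ℝ, ∀ᵐ x : R2, M ≤ ψ x) ∧
        (∫ x : R2, V x * Real.exp (ψ x)) ≤ 0)) :
    ∃ ψt : R2 → ℝ, Continuous ψt ∧ ψ =ᵐ[volume] ψt ∧
      Tendsto (fun x : R2 => ψt x / Real.log ‖x‖) (cobounded R2)
        (nhds (-(∫ x : R2, V x * Real.exp (ψ x)) / (2*π))) ∧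
      (Integrable (fun y : R2 => |V y| * Real.exp (ψ y) * Real.log (‖y‖ + 1)) →
        ∃ C : ℝ, 0 < C ∧ ∀ᵐ x : R2,
          -((∫ y : R2, V y * Real.exp (ψ y)) / (2*π)) * Real.log (‖x‖ + 1) - C
              ≤ ψ x ∧
            ψ x ≤ -((∫ y : R2, V y * Real.exp (ψ y)) / (2*π)) *
              Real.log (‖x‖ + 1) + C) := by
  set f : R2 → ℝ := fun x => V x * Real.exp (ψ x) with hfdef
  obtain ⟨c, hc⟩ := hweak.exists_ae_eq_logPotential_add_const hp hψ hf hfp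
    (hcase.imp And.left And.left)
  obtain ⟨N, hN⟩ := exists_abs_nearPotential_le hp hf hfp
  refine ⟨_, (continuous_logPotential hp hf hfp).add continuous_const, hc, ?_, fun hlog => ?_⟩
  · have hrem : Tendsto (fun x : R2 => ((2 * π)⁻¹ * nearPotential f x + c) / Real.log ‖x‖)
        (cobounded R2) (nhds 0) := by
      have hinv := tendsto_log_norm_cobounded.inv_tendsto_atTop
      refine (hinv.zero_mul_isBoundedUnder_le ?_).congr fun x => (div_eq_inv_mul _ _).symm
      refine isBoundedUnder_of ⟨(2 * π)⁻¹ * N + |c|, fun x => ?_⟩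
      refine (norm_add_le _ _).trans (add_le_add ?_ le_rfl)
      rw [Real.norm_eq_abs, abs_mul, abs_of_pos (by positivity)]
      exact mul_le_mul_of_nonneg_left (hN x) (by positivity)
    have h := ((tendsto_farPotential_div_log hf).const_mul (-(2 * π)⁻¹)).add hrem
    have hlim : -(∫ x, f x) / (2 * π) = -(2 * π)⁻¹ * (∫ x, f x) + 0 := by ring
    rw [hlim]
    refine h.congr fun x => ?_
    rw [Pi.add_apply, logPotential]
    ring
  · have hlog' : Integrable fun y => |f y| * Real.log (‖y‖ + 1) := by
      simpa only [hfdef, abs_mul, Real.abs_exp] using hlog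
    set K := ∫ y, (2 * (|f y| * Real.log (‖y‖ + 1)) + Real.log 2 * |f y|)
    have key (x : R2) : |logPotential f x + c - -((∫ y, f y) / (2 * π)) * Real.log (‖x‖ + 1)| ≤
        (2 * π)⁻¹ * (K + N) + |c| := by
      have heq : logPotential f x + c - -((∫ y, f y) / (2 * π)) * Real.log (‖x‖ + 1) =
          -(2 * π)⁻¹ * ((farPotential f x - (∫ y, f y) * Real.log (‖x‖ + 1)) -
            nearPotential f x) + c := by
        rw [logPotential]
        ring
      rw [heq]
      refine (abs_add_le _ _).trans (add_le_add_left ?_ _)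
      rw [abs_mul, abs_neg, abs_of_pos (by positivity)]
      exact mul_le_mul_of_nonneg_left ((abs_sub _ _).trans
        (add_le_add (abs_farPotential_sub_le hf hlog' x) (hN x))) (by positivity)
    refine ⟨(2 * π)⁻¹ * (K + N) + |c| + 1, ?_, hc.mono fun x hx => ?_⟩
    · linarith [(abs_nonneg _).trans (key 0)]
    · have h := abs_le.1 (key x)
      rw [hx]
      exact ⟨by linarith [h.1], by linarith [h.2]⟩
end
end

section
/- Unboundedness below of the Moser energy for insufficient vanishing at the origin (Example 2.6). Let β > 2, ε > 0, C > 0, let V₀ : ℝ → ℝ be continuous and nonnegative with V₀(r) > C for all 0 ≤ r < ε, let 0 ≤ α < β - 2, and define V : ℝ² → ℝ by V(x) = ‖x‖^α · V₀(‖x‖). Then for every M ∈ ℝ there exists a radially symmetric Lipschitz function φ : ℝ² → ℝ vanishing outside the open unit ball D(0,1), such that ∫_{D(0,1)} V·e^{φ} dx > 0 and (1/2)·∫_{D(0,1)} ‖Dφ(x)‖² dx - 4πβ·log(∫_{D(0,1)} V·e^{φ} dx) ≤ M, where Dφ(x) denotes the (Fréchet) derivative of φ at x, which exists for a.e. x by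 Rademacher's theorem (with the junk value 0 elsewhere). -/
open MeasureTheory Real Filter Bornology Metric
open scoped NNReal

noncomputable section

/-- The logarithm is `1/r`-Lipschitz on `[r, ∞)`. -/
lemma abs_log_sub_log_le {r u v : ℝ} (hr : 0 < r) (hu : r ≤ u) (hv : r ≤ v) :
    |Real.log u - Real.log v| ≤ |u - v| / r := by
  wlog h : u ≤ v generalizing u v
  · rw [abs_sub_comm, abs_sub_comm u]
    exact this hv hu (le_of_not_ge h)
  have hu0 : 0 < u := hr.trans_le hu
  have hv0 : 0 < v := hr.trans_le hv
  have hlog : Real.log u ≤ Real.log v := Real.log_le_log hu0 h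
  rw [abs_sub_comm, abs_of_nonneg (sub_nonneg.2 hlog), abs_sub_comm,
    abs_of_nonneg (sub_nonneg.2 h), ← Real.log_div hv0.ne' hu0.ne']
  calc Real.log (v / u) ≤ v / u - 1 := Real.log_le_sub_one_of_pos (by positivity)
    _ = (v - u) / u := by field_simp
    _ ≤ (v - u) / r := by
        have := sub_nonneg.2 h
        gcongr

/-- The truncated logarithm `-b log ‖x‖`, capped at height `-b log δ` and set to `0` outside the
unit ball. -/
def truncLog (b δ : ℝ) (x : R2) : ℝ := -b * Real.log (max (min ‖x‖ 1) δ)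

lemma abs_truncLog_sub_le {b δ r : ℝ} (hb : 0 ≤ b) (hr : 0 < r) {x y : R2}
    (hx : r ≤ max (min ‖x‖ 1) δ) (hy : r ≤ max (min ‖y‖ 1) δ) :
    |truncLog b δ x - truncLog b δ y| ≤ b / r * ‖x - y‖ := by
  have h1 := abs_log_sub_log_le hr hx hy
  have h2 : |max (min ‖x‖ 1) δ - max (min ‖y‖ 1) δ| ≤ ‖x - y‖ :=
    ((abs_max_sub_max_le_abs _ _ _).trans (abs_inf_sub_inf_le_abs _ _ _)).trans
      (abs_norm_sub_norm_le x y)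
  unfold truncLog
  rw [← mul_sub, abs_mul, abs_neg, abs_of_nonneg hb, div_mul_eq_mul_div, mul_div_assoc]
  gcongr
  exact h1.trans (by gcongr)

lemma lipschitzWith_truncLog {b δ : ℝ} (hb : 0 ≤ b) (hδ : 0 < δ) :
    LipschitzWith (b / δ).toNNReal (truncLog b δ) := by
  refine LipschitzWith.of_dist_le_mul fun x y => ?_
  rw [Real.coe_toNNReal _ (by positivity), Real.dist_eq, dist_eq_norm]
  exact abs_truncLog_sub_le hb hδ (le_max_right _ _) (le_max_right _ _)

lemma truncLog_of_norm_le {b δ : ℝ} {x : R2} (hx : ‖x‖ ≤ δ) :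
    truncLog b δ x = -b * Real.log δ := by
  rw [truncLog, max_eq_right ((min_le_left _ _).trans hx)]

lemma fderiv_truncLog_of_norm_lt {b δ : ℝ} {x : R2} (hx : ‖x‖ < δ) :
    fderiv ℝ (truncLog b δ) x = 0 := by
  have h : truncLog b δ =ᶠ[nhds x] fun _ => -b * Real.log δ := by
    filter_upwards [(isOpen_lt continuous_norm continuous_const).mem_nhds hx] with y hy
    exact truncLog_of_norm_le (le_of_lt hy)
  rw [h.fderiv_eq]
  simp

lemma norm_fderiv_truncLog_le {b δ : ℝ} (hb : 0 ≤ b) {x : R2} (hx : 0 < ‖x‖)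
    (hx1 : ‖x‖ < 1) : ‖fderiv ℝ (truncLog b δ) x‖ ≤ b / ‖x‖ := by
  have hlim : Tendsto (fun r : ℝ => b / r) (nhdsWithin ‖x‖ (Set.Iio ‖x‖)) (nhds (b / ‖x‖)) :=
    ((continuousAt_const.div continuousAt_id hx.ne').tendsto).mono_left nhdsWithin_le_nhds
  refine ge_of_tendsto hlim ?_
  filter_upwards [Ioo_mem_nhdsLT hx] with r hr
  refine norm_fderiv_le_of_lip' ℝ (div_nonneg hb hr.1.le) ?_
  filter_upwards [(isOpen_lt continuous_const continuous_norm).mem_nhds hr.2] with y hy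
  exact abs_truncLog_sub_le hb hr.1
    (le_max_of_le_left (le_min (le_of_lt hy) (hr.2.trans hx1).le))
    (le_max_of_le_left (le_min hr.2.le (hr.2.trans hx1).le))

/-- The Dirichlet integral of the radial function `b log ‖x‖` over an annulus. -/
lemma integral_indicator_Ico_sq_div_norm {b δ : ℝ} (hδ : 0 < δ) (hδ1 : δ < 1) :
    ∫ x : R2, (Set.Ico δ 1).indicator (fun r => (b / r) ^ 2) ‖x‖
      = 2 * π * b ^ 2 * (-Real.log δ) := by
  rw [integral_fun_norm_addHaar volume ((Set.Ico δ 1).indicator fun r => (b / r) ^ 2)]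
  have hvol : (volume : Measure R2).real (ball 0 1) = π := by
    simp [Measure.real, EuclideanSpace.volume_ball_fin_two, Real.pi_pos.le]
  have hint : ∫ y in Set.Ioi (0:ℝ), y ^ (Module.finrank ℝ R2 - 1) •
      (Set.Ico δ 1).indicator (fun r => (b / r) ^ 2) y = b ^ 2 * (-Real.log δ) := by
    have : ∀ y : ℝ, y ^ (Module.finrank ℝ R2 - 1) •
        (Set.Ico δ 1).indicator (fun r => (b / r) ^ 2) y
        = (Set.Ico δ 1).indicator (fun r => b ^ 2 * r⁻¹) y := by
      intro y
      by_cases hy : y ∈ Set.Ico δ 1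
      · have : y ≠ 0 := (hδ.trans_le hy.1).ne'
        simp only [Set.indicator_of_mem hy, finrank_euclideanSpace_fin, smul_eq_mul]
        rw [Nat.add_one_sub_one, pow_one]
        field_simp
      · simp [Set.indicator_of_notMem hy]
    simp_rw [this]
    rw [setIntegral_indicator measurableSet_Ico,
      Set.inter_eq_right.2 (show Set.Ico δ 1 ⊆ Set.Ioi 0 from fun y hy => hδ.trans_le hy.1),
      integral_Ico_eq_integral_Ioc,
      ← intervalIntegral.integral_of_le hδ1.le, intervalIntegral.integral_const_mul,
      integral_inv_of_pos hδ one_pos]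
    simp
  rw [hvol, hint, finrank_euclideanSpace_fin]
  simp
  ring

lemma integral_norm_fderiv_truncLog_sq_le {b δ : ℝ} (hb : 0 ≤ b) (hδ : 0 < δ) (hδ1 : δ < 1) :
    ∫ x in ball (0:R2) 1, ‖fderiv ℝ (truncLog b δ) x‖ ^ 2
      ≤ 2 * π * b ^ 2 * (-Real.log δ) := by
  rw [← integral_indicator_Ico_sq_div_norm hδ hδ1, ← integral_indicator measurableSet_ball]
  refine integral_mono_of_nonneg (Eventually.of_forall fun x => ?_) ?_
    (Eventually.of_forall fun x => ?_)
  · exact Set.indicator_nonneg (fun _ _ => by positivity) x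
  · by_cases hb0 : b = 0
    · simp [hb0]
    · refine Integrable.of_integral_ne_zero ?_
      rw [integral_indicator_Ico_sq_div_norm hδ hδ1]
      have := Real.log_neg hδ hδ1
      have := Real.pi_pos
      simp only [ne_eq, mul_eq_zero, neg_eq_zero, not_or]
      refine ⟨⟨⟨by norm_num, by positivity⟩, by positivity⟩, by linarith⟩
  · by_cases hx : x ∈ ball (0:R2) 1
    · have hx1 : ‖x‖ < 1 := by simpa using hx
      rw [Set.indicator_of_mem hx]
      beta_reduce
      by_cases hxδ : ‖x‖ < δ
      · rw [fderiv_truncLog_of_norm_lt hxδ, Set.indicator_of_notMem (fun h => hxδ.not_ge h.1)]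
        simp
      · have hxδ' := not_lt.1 hxδ
        rw [Set.indicator_of_mem (show ‖x‖ ∈ Set.Ico δ 1 from ⟨hxδ', hx1⟩)]
        gcongr
        exact norm_fderiv_truncLog_le hb (hδ.trans_le hxδ') hx1
    · rw [Set.indicator_of_notMem hx]
      exact Set.indicator_nonneg (fun _ _ => by positivity) _

lemma volume_real_ball_diff_ball_half {δ : ℝ} (hδ : 0 < δ) :
    (volume : Measure R2).real (ball 0 δ \ ball 0 (δ / 2)) = 3 / 4 * π * δ ^ 2 := by
  rw [measureReal_sdiff (ball_subset_ball (by linarith)) measurableSet_ball]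
  simp only [Measure.real, EuclideanSpace.volume_ball_fin_two, ENNReal.toReal_mul,
    ENNReal.toReal_pow, ENNReal.toReal_ofReal hδ.le, ENNReal.toReal_ofReal (half_pos hδ).le]
  rw [ENNReal.toReal_ofReal Real.pi_pos.le]
  ring

lemma le_integral_rpow_mul_exp_truncLog {b δ α C : ℝ} {V₀ : ℝ → ℝ} (hC : 0 ≤ C)
    (hV₀c : Continuous V₀) (hV₀0 : ∀ r, 0 ≤ V₀ r) (hb : 0 ≤ b) (hα : 0 ≤ α) (hδ : 0 < δ)
    (hδ1 : δ < 1) (hV₀C : ∀ r, 0 ≤ r → r < δ → C ≤ V₀ r) :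
    (δ / 2) ^ α * C * Real.exp (-b * Real.log δ) * (3 / 4 * π * δ ^ 2)
      ≤ ∫ x in ball (0:R2) 1, ‖x‖ ^ α * V₀ ‖x‖ * Real.exp (truncLog b δ x) := by
  have hcont : Continuous fun x : R2 => ‖x‖ ^ α * V₀ ‖x‖ * Real.exp (truncLog b δ x) :=
    ((continuous_norm.rpow_const fun _ => Or.inr hα).mul (hV₀c.comp continuous_norm)).mul
      (Real.continuous_exp.comp (lipschitzWith_truncLog hb hδ).continuous)
  have hint : IntegrableOn (fun x : R2 => ‖x‖ ^ α * V₀ ‖x‖ * Real.exp (truncLog b δ x))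
      (ball 0 1) :=
    (hcont.continuousOn.integrableOn_compact (isCompact_closedBall (0:R2) 1)).mono_set
      ball_subset_closedBall
  have hsub : ball (0:R2) δ \ ball 0 (δ / 2) ⊆ ball 0 1 :=
    Set.sdiff_subset.trans (ball_subset_ball hδ1.le)
  have hmeas : MeasurableSet (ball (0:R2) δ \ ball 0 (δ / 2)) :=
    measurableSet_ball.diff measurableSet_ball
  have hfin : (volume : Measure R2) (ball 0 δ \ ball 0 (δ / 2)) ≠ ⊤ :=
    measure_ne_top_of_subset Set.sdiff_subset measure_ball_lt_top.ne
  rw [← volume_real_ball_diff_ball_half hδ]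
  refine (setIntegral_ge_of_const_le_real hmeas hfin (fun x hx => ?_)
    (hint.mono_set hsub)).trans (setIntegral_mono_set hint
      (Eventually.of_forall fun x => ?_) hsub.eventuallyLE)
  · have h1 : ‖x‖ < δ := by simpa using hx.1
    have h2 : δ / 2 ≤ ‖x‖ := by simpa using hx.2
    rw [truncLog_of_norm_le h1.le]
    have := hV₀C _ (norm_nonneg x) h1
    gcongr
  · have := hV₀0 ‖x‖
    simp only [Pi.zero_apply]
    positivity

/-- Example 2.6: the Moser energy functional is unbounded below over radially
symmetric functions when V = ‖x‖^α V₀(‖x‖) with 0 ≤ α < β - 2 and V₀ > C near 0. -/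
theorem moser_energy_unbounded_radial (β ε C : ℝ) (hβ : 2 < β) (hε : 0 < ε)
    (hC : 0 < C)
    (V₀ : ℝ → ℝ) (hV₀c : Continuous V₀) (hV₀0 : ∀ r : ℝ, 0 ≤ V₀ r)
    (hV₀C : ∀ r : ℝ, 0 ≤ r → r < ε → C < V₀ r)
    (α : ℝ) (hα0 : 0 ≤ α) (hαβ : α < β - 2) :
    ∀ M : ℝ, ∃ φ : R2 → ℝ, RadSym φ ∧ (∃ L : ℝ≥0, LipschitzWith L φ) ∧
      (∀ x : R2, x ∉ ball (0:R2) 1 → φ x = 0) ∧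
      0 < (∫ x in ball (0:R2) 1, ‖x‖ ^ α * V₀ ‖x‖ * Real.exp (φ x)) ∧
      (1/2) * (∫ x in ball (0:R2) 1, ‖fderiv ℝ φ x‖ ^ 2)
        - 4 * π * β *
          Real.log (∫ x in ball (0:R2) 1, ‖x‖ ^ α * V₀ ‖x‖ * Real.exp (φ x))
        ≤ M := by
  intro M
  have hβ0 : 0 < β := by linarith
  set K : ℝ := (1 / 2) ^ α * C * (3 / 4 * π) with hK
  have hKpos : 0 < K := by positivity
  set D : ℝ := 4 * π * β * (β - 2 - α) with hD
  have hDpos : 0 < D := mul_pos (by positivity) (by linarith)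
  obtain ⟨T, hT0, hTε, hTM⟩ : ∃ T : ℝ, 0 < T ∧ -Real.log ε < T ∧
      (-M - 4 * π * β * Real.log K) / D ≤ T :=
    ((eventually_gt_atTop 0).and ((eventually_gt_atTop _).and (eventually_ge_atTop _))).exists
  set δ : ℝ := Real.exp (-T) with hδdef
  have hδ : 0 < δ := Real.exp_pos _
  have hδ1 : δ < 1 := Real.exp_lt_one_iff.2 (by linarith)
  have hδε : δ < ε := (Real.lt_log_iff_exp_lt hε).1 (by linarith)
  have hlogδ : Real.log δ = -T := Real.log_exp _
  have hb : 0 ≤ 2 * β := by linarith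
  have hgrad := integral_norm_fderiv_truncLog_sq_le hb hδ hδ1
  have hpot := le_integral_rpow_mul_exp_truncLog hC.le hV₀c hV₀0 hb hα0 hδ hδ1
    fun r hr0 hr => (hV₀C r hr0 (hr.trans hδε)).le
  have hmass : (δ / 2) ^ α * C * Real.exp (-(2 * β) * Real.log δ) * (3 / 4 * π * δ ^ 2)
      = K * Real.exp ((2 * β - α - 2) * T) := by
    have h1 : (δ / 2) ^ α = (1 / 2) ^ α * Real.exp (-T * α) := by
      rw [div_eq_mul_one_div, Real.mul_rpow hδ.le (by norm_num), hδdef, ← Real.exp_mul, mul_comm]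
    have h2 : δ ^ 2 = Real.exp (-T * 2) := by
      rw [hδdef, ← Real.exp_nat_mul]
      ring_nf
    have h3 : (2 * β - α - 2) * T = -T * α + -(2 * β) * -T + -T * 2 := by ring
    rw [h1, h2, hlogδ, h3, Real.exp_add, Real.exp_add, hK]
    ring
  rw [hmass] at hpot
  have hpos : 0 < K * Real.exp ((2 * β - α - 2) * T) := by positivity
  refine ⟨truncLog (2 * β) δ, fun x y hxy => by simp only [truncLog, hxy],
    ⟨_, lipschitzWith_truncLog hb hδ⟩, fun x hx => ?_, hpos.trans_le hpot, ?_⟩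
  · have hx1 : 1 ≤ ‖x‖ := by simpa using hx
    simp [truncLog, min_eq_right hx1, max_eq_left hδ1.le]
  · have hlog := Real.log_le_log hpos hpot
    rw [Real.log_mul hKpos.ne' (Real.exp_pos _).ne', Real.log_exp] at hlog
    rw [hlogδ] at hgrad
    have hlog' := mul_le_mul_of_nonneg_left hlog (show 0 ≤ 4 * π * β by positivity)
    rw [div_le_iff₀ hDpos, hD] at hTM
    linarith
end
end
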